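/- Let N ≥ 1, α > 0, μ ∈ ℝ, δ > 0, C₀ > 0. Let f ∈ C²([0,∞)) satisfy f''(r) + ((N−1)/r + r/2) f'(r) + f(r)/α + |f(r)|^α f(r) = 0 for r > 0, f'(0) = 0, the decay estimate |f(r)| + (1+r)|f'(r)| ≤ C₀(1 + r²)^{-1/α} for all r ≥ 0, and r^{2/α} f(r) → μ as r → ∞; set U(t,x) = t^{-1/α} f(|x|/√t) for t > 0, x ∈ ℝ^N, and assume that for every ε > 0 and every 1 ≤ p < ∞, U(t,·) → μ|·|^{-2/α} in L^p({|x| > ε}) as t ↓ 0. Let u₀ ∈ L^∞_loc(ℝ^N \ {0}) with u₀ ∈ L^∞({|x| > 1}) and u₀(x) = μ|x|^{-2/α} for 0 < |x| < δ. Then there exist T > 0, a function u ∈ C((0,T], C_{b,u}(ℝ^N)), and a constant C such that: (a) u is C¹ in t and C² in x on (0,T) × ℝ^N and satisfies ∂_t u = Δu + |u|^α u pointwise there; (b) u − U ∈ L^∞((0,T) × ℝ^N); (c) ‖u(t,·) − U(t,·) − e^{tΔ}(u₀ − μ|·|^{-2/α})‖_{L^∞(ℝ^N)} ≤ C t for all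 0 < t < T (note u₀ − μ|·|^{-2/α} ∈ L^∞(ℝ^N), vanishing for |x| < δ); (d) u(t,·) → u₀ as t ↓ 0 in L^p(K) for every compact K ⊂ ℝ^N \ {0} and every 1 ≤ p < ∞. -/

import Mathlib

open MeasureTheory Real Set Filter ENNReal

/-- The Gaussian heat kernel `G(t,x,y) = (4πt)^{-N/2} exp(-|x-y|²/(4t))` on `ℝ^N`. -/
noncomputable def heatKernel (N : ℕ) (t : ℝ) (x y : EuclideanSpace ℝ (Fin N)) : ℝ :=
  (4 * π * t) ^ (-(N : ℝ) / 2) * Real.exp (-‖x - y‖ ^ 2 / (4 * t))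

/-- The Laplacian of `f : ℝ^N → ℝ`, as the sum of the pure second partial derivatives. -/
noncomputable def lap (N : ℕ) (f : EuclideanSpace ℝ (Fin N) → ℝ)
    (x : EuclideanSpace ℝ (Fin N)) : ℝ :=
  ∑ i : Fin N, iteratedFDeriv ℝ 2 f x ![EuclideanSpace.single i 1, EuclideanSpace.single i 1]

/-- The self-similar function `U(t,x) = t^{-1/α} f(|x|/√t)` associated with a profile `f`. -/
noncomputable def ssol (α : ℝ) (f : ℝ → ℝ) {N : ℕ} (t : ℝ)
    (x : EuclideanSpace ℝ (Fin N)) : ℝ :=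
  t ^ (-(1 / α)) * f (‖x‖ / Real.sqrt t)

namespace HeatW

/-- Shorthand for Euclidean space. -/
abbrev EN (N : ℕ) := EuclideanSpace ℝ (Fin N)

/-- Gaussian density with covariance `2 I`. -/
noncomputable def gd (N : ℕ) (z : EN N) : ℝ :=
  (4 * π) ^ (-(N : ℝ) / 2) * Real.exp (-‖z‖ ^ 2 / 4)

/-- Gaussian measure with covariance `2 I`. -/
noncomputable def gm (N : ℕ) : Measure (EN N) :=
  volume.withDensity (fun z => ENNReal.ofReal (gd N z))

lemma gd_pos {N : ℕ} (z : EN N) : 0 < gd N z := by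
  unfold gd; positivity

lemma gd_cont {N : ℕ} : Continuous (gd N) := by
  unfold gd; fun_prop

lemma integral_gm {N : ℕ} {G : Type*} [NormedAddCommGroup G] [NormedSpace ℝ G] (φ : EN N → G) :
    ∫ z, φ z ∂(gm N) = ∫ z, gd N z • φ z := by
  unfold gm
  rw [integral_withDensity_eq_integral_toReal_smul]
  · congr 1; ext z; rw [ENNReal.toReal_ofReal (gd_pos z).le]
  · exact gd_cont.measurable.ennreal_ofReal
  · simp

lemma integrable_gm {N : ℕ} {G : Type*} [NormedAddCommGroup G] [NormedSpace ℝ G] (φ : EN N → G) :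
    Integrable φ (gm N) ↔ Integrable (fun z => gd N z • φ z) := by
  unfold gm
  rw [integrable_withDensity_iff_integrable_smul']
  · congr! 2 with z; rw [ENNReal.toReal_ofReal (gd_pos z).le]
  · exact gd_cont.measurable.ennreal_ofReal
  · simp

lemma integrable_exp_sq {N : ℕ} {b : ℝ} (hb : 0 < b) :
    Integrable (fun z : EN N => Real.exp (-b * ‖z‖ ^ 2)) := by
  have h := (GaussianFourier.integrable_cexp_neg_mul_sq_norm_add (b := (b : ℂ)) (by simpa using hb)
    0 (0 : EN N)).norm
  refine h.congr (Eventually.of_forall fun z => ?_)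
  simp only [Complex.norm_exp]
  congr 1
  have : (-(b:ℂ) * (‖z‖:ℂ) ^ 2 + 0 * ((inner ℝ (0 : EN N) z : ℝ) : ℂ))
    = (((-b * ‖z‖ ^ 2 : ℝ)) : ℂ) := by push_cast; ring
  rw [this, Complex.ofReal_re]

lemma integrable_gd {N : ℕ} : Integrable (gd N) := by
  unfold gd
  refine ((integrable_exp_sq (N := N) (b := 1/4) (by norm_num)).const_mul
    ((4 * π) ^ (-(N : ℝ) / 2))).congr (Eventually.of_forall fun z => ?_)
  simp only
  congr 2; ring

lemma integral_gd {N : ℕ} : ∫ z, gd N z = 1 := by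
  unfold gd
  rw [integral_const_mul]
  have h := GaussianFourier.integral_rexp_neg_mul_sq_norm (V := EN N) (b := 1/4) (by norm_num)
  have : (fun v : EN N => Real.exp (-‖v‖ ^ 2 / 4)) = fun v => Real.exp (-(1/4) * ‖v‖ ^ 2) := by
    ext v; congr 1; ring
  rw [this, h]
  simp only [finrank_euclideanSpace, Fintype.card_fin]
  rw [show π / (1/4) = 4 * π by ring, ← Real.rpow_add (by positivity)]
  rw [show -(N : ℝ) / 2 + (N : ℝ) / 2 = 0 by ring, Real.rpow_zero]

instance gm_prob {N : ℕ} : IsProbabilityMeasure (gm N) := by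
  constructor
  unfold gm
  rw [withDensity_apply _ MeasurableSet.univ, Measure.restrict_univ,
    ← ofReal_integral_eq_lintegral_ofReal integrable_gd
      (Eventually.of_forall fun z => (gd_pos z).le), integral_gd]
  simp

lemma charFun_gm {N : ℕ} (ξ : EN N) :
    charFun (gm N) ξ = Complex.exp (-(‖ξ‖ : ℂ) ^ 2) := by
  rw [charFun_apply, integral_gm]
  have h := GaussianFourier.integral_cexp_neg_mul_sq_norm_add (V := EN N) (b := (1/4 : ℂ))
    (by norm_num) Complex.I ξ
  have e : (fun z : EN N => gd N z • Complex.exp ((inner ℝ z ξ : ℝ) * Complex.I))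
      = fun z => (((4 * π) ^ (-(N : ℝ) / 2) : ℝ) : ℂ) *
        Complex.exp (-(1/4 : ℂ) * (‖z‖ : ℂ) ^ 2 + Complex.I * (inner ℝ ξ z : ℝ)) := by
    ext z
    rw [Complex.exp_add, real_inner_comm z ξ, gd, Complex.real_smul]
    push_cast
    rw [show -(‖z‖ : ℂ) ^ 2 / 4 = -(1/4 : ℂ) * (‖z‖ : ℂ) ^ 2 by ring, mul_comm Complex.I]
    ring
  rw [e, integral_const_mul, h]
  have h4 : ((π : ℂ) / (1/4 : ℂ)) = ((4 * π : ℝ) : ℂ) := by push_cast; ring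
  have h5 : (((Module.finrank ℝ (EN N) : ℕ) : ℂ) / 2) = (((N : ℝ) / 2 : ℝ) : ℂ) := by
    simp
  rw [h4, h5, ← Complex.ofReal_cpow (by positivity), ← mul_assoc, ← Complex.ofReal_mul,
    ← Real.rpow_add (by positivity), show -(N : ℝ) / 2 + (N : ℝ) / 2 = 0 by ring, Real.rpow_zero]
  simp only [Complex.ofReal_one, one_mul, Complex.I_sq]
  congr 1; ring

lemma gm_conv {N : ℕ} {a b : ℝ} (ha : 0 ≤ a) (hb : 0 ≤ b) :
    (Measure.map (fun z : EN N => √a • z) (gm N)).conv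
      (Measure.map (fun z : EN N => √b • z) (gm N)) =
    Measure.map (fun z : EN N => √(a + b) • z) (gm N) := by
  have h1 : ∀ c : ℝ, IsProbabilityMeasure (Measure.map (fun z : EN N => c • z) (gm N)) := fun c =>
    Measure.isProbabilityMeasure_map (by fun_prop)
  have := h1 (√a); have := h1 (√b); have := h1 (√(a+b))
  apply Measure.ext_of_charFun
  ext ξ
  rw [charFun_conv, charFun_map_smul, charFun_map_smul, charFun_map_smul, charFun_gm, charFun_gm,
    charFun_gm, ← Complex.exp_add]
  congr 1
  simp only [norm_smul, Real.norm_eq_abs, abs_of_nonneg (Real.sqrt_nonneg _), Complex.ofReal_mul,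
    mul_pow]
  simp only [← Complex.ofReal_pow, Real.sq_sqrt ha,
    Real.sq_sqrt hb, Real.sq_sqrt (add_nonneg ha hb)]
  push_cast; ring

lemma gm_neg {N : ℕ} : Measure.map (fun z : EN N => -z) (gm N) = gm N := by
  have : IsProbabilityMeasure (Measure.map (fun z : EN N => -z) (gm N)) :=
    Measure.isProbabilityMeasure_map (by fun_prop)
  apply Measure.ext_of_charFun
  ext ξ
  have : (fun z : EN N => -z) = fun z => (-1 : ℝ) • z := by ext1 z; simp
  rw [this, charFun_map_smul, charFun_gm, charFun_gm]
  simp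

lemma integral_gm_neg {N : ℕ} {G : Type*} [NormedAddCommGroup G] [NormedSpace ℝ G]
    (φ : EN N → G) : ∫ z, φ (-z) ∂(gm N) = ∫ z, φ z ∂(gm N) := by
  conv_rhs => rw [← gm_neg]
  exact (integral_map_equiv (MeasurableEquiv.neg (EN N)) φ).symm

lemma pow_le_exp_sq (k : ℕ) : ∃ C : ℝ, 0 < C ∧ ∀ r : ℝ, 0 ≤ r → r ^ k ≤ C * Real.exp (r ^ 2 / 16) := by
  refine ⟨k.factorial * Real.exp 4, by positivity, fun r hr => ?_⟩
  have h := Real.pow_div_factorial_le_exp r hr k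
  rw [div_le_iff₀ (by positivity)] at h
  have h2 : Real.exp r ≤ Real.exp 4 * Real.exp (r ^ 2 / 16) := by
    rw [← Real.exp_add]
    apply Real.exp_le_exp.2
    nlinarith [sq_nonneg (r - 8)]
  nlinarith [Nat.factorial_pos k, Real.exp_pos r, (by positivity : (0:ℝ) ≤ k.factorial)]

lemma integrable_pow_gm {N : ℕ} (k : ℕ) : Integrable (fun z : EN N => ‖z‖ ^ k) (gm N) := by
  rw [integrable_gm]
  obtain ⟨C, hC, h⟩ := pow_le_exp_sq k
  refine ((integrable_exp_sq (N := N) (b := 3/16) (by norm_num)).const_mul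
    ((4 * π) ^ (-(N : ℝ) / 2) * C)).mono' ?_ (Eventually.of_forall fun z => ?_)
  · exact (gd_cont.smul (by fun_prop)).aestronglyMeasurable
  · rw [norm_smul, Real.norm_of_nonneg (gd_pos z).le, Real.norm_of_nonneg (by positivity), gd]
    have := h ‖z‖ (norm_nonneg z)
    calc _ ≤ (4 * π) ^ (-(N : ℝ) / 2) * Real.exp (-‖z‖ ^ 2 / 4) * (C * Real.exp (‖z‖ ^ 2 / 16)) := by
          gcongr
      _ = (4 * π) ^ (-(N : ℝ) / 2) * C * (Real.exp (-‖z‖ ^ 2 / 4) * Real.exp (‖z‖ ^ 2 / 16)) := by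
          ring
      _ = _ := by rw [← Real.exp_add]; congr 2; ring

lemma integrable_norm_gm {N : ℕ} : Integrable (fun z : EN N => ‖z‖) (gm N) := by
  simpa using integrable_pow_gm (N := N) 1

/-- The first absolute moment. -/
noncomputable def m1 (N : ℕ) : ℝ := ∫ z, ‖z‖ ∂(gm N)

lemma m1_nonneg (N : ℕ) : 0 ≤ m1 N := integral_nonneg fun _ => norm_nonneg _

/-- The heat semigroup. -/
noncomputable def P {N : ℕ} {G : Type*} [NormedAddCommGroup G] [NormedSpace ℝ G]
    (σ : ℝ) (φ : EN N → G) (x : EN N) : G := ∫ z, φ (x + √σ • z) ∂(gm N)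

/-- The gradient of the heat semigroup. -/
noncomputable def Q {N : ℕ} {G : Type*} [NormedAddCommGroup G] [NormedSpace ℝ G]
    (σ : ℝ) (φ : EN N → G) (x : EN N) : EN N →L[ℝ] G :=
  (1 / (2 * √σ)) • ∫ z, (innerSL ℝ z).smulRight (φ (x + √σ • z)) ∂(gm N)

end HeatW

namespace HeatW

section
variable {N : ℕ} {G : Type*} [NormedAddCommGroup G] [NormedSpace ℝ G]

lemma P_norm_le {σ M : ℝ} {φ : EN N → G} (h : ∀ y, ‖φ y‖ ≤ M) (x : EN N) : ‖P σ φ x‖ ≤ M := by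
  unfold P
  have := norm_integral_le_of_norm_le_const (μ := gm N) (f := fun z => φ (x + √σ • z)) (C := M)
    (Eventually.of_forall fun z => h _)
  simpa using this

lemma norm_smulRight_inner (z : EN N) (g : G) : ‖(innerSL ℝ z).smulRight g‖ = ‖z‖ * ‖g‖ := by
  rw [ContinuousLinearMap.norm_smulRight_apply, innerSL_apply_norm]

lemma Q_norm_le {σ M : ℝ} (hσ : 0 < σ) {φ : EN N → G} (h : ∀ y, ‖φ y‖ ≤ M) (x : EN N) :
    ‖Q σ φ x‖ ≤ M * m1 N / (2 * √σ) := by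
  unfold Q
  rw [norm_smul, Real.norm_of_nonneg (by positivity)]
  have : ‖∫ z, (innerSL ℝ z).smulRight (φ (x + √σ • z)) ∂(gm N)‖ ≤ ∫ z, M * ‖z‖ ∂(gm N) := by
    refine norm_integral_le_of_norm_le (integrable_norm_gm.const_mul M)
      (Eventually.of_forall fun z => ?_)
    rw [norm_smulRight_inner, mul_comm]
    gcongr
    exact h _
  rw [integral_const_mul] at this
  change _ ≤ M * m1 N at this
  calc _ ≤ 1 / (2 * √σ) * (M * m1 N) := by gcongr
    _ = _ := by ring

lemma meas_shift {φ : EN N → G} (hφ : StronglyMeasurable φ) (x : EN N) (c : ℝ) :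
    StronglyMeasurable fun z => φ (x + c • z) :=
  hφ.comp_measurable (by fun_prop)

lemma int_shift {M : ℝ} {φ : EN N → G} (hφ : StronglyMeasurable φ) (h : ∀ y, ‖φ y‖ ≤ M)
    (x : EN N) (c : ℝ) : Integrable (fun z => φ (x + c • z)) (gm N) :=
  (integrable_const M).mono' (meas_shift hφ x c).aestronglyMeasurable
    (Eventually.of_forall fun z => h _)

lemma P_semigroup [CompleteSpace G] {a b M : ℝ} (ha : 0 ≤ a) (hb : 0 ≤ b) {φ : EN N → G}
    (hφ : StronglyMeasurable φ) (h : ∀ y, ‖φ y‖ ≤ M) (x : EN N) :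
    P a (P b φ) x = P (a + b) φ x := by
  have h1 : ∀ c : ℝ, IsProbabilityMeasure (Measure.map (fun z : EN N => c • z) (gm N)) := fun c =>
    Measure.isProbabilityMeasure_map (by fun_prop)
  have := h1 (√a); have := h1 (√b); have := h1 (√(a+b))
  have hm : StronglyMeasurable fun y => φ (x + y) := hφ.comp_measurable (by fun_prop)
  have e1 : P (a + b) φ x = ∫ y, φ (x + y) ∂(Measure.map (fun z : EN N => √(a + b) • z) (gm N)) := by
    rw [integral_map (by fun_prop) hm.aestronglyMeasurable]; rfl
  rw [e1, ← gm_conv ha hb, integral_conv]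
  · rw [integral_map (by fun_prop)]
    · unfold P
      congr 1; ext z
      rw [integral_map (by fun_prop)]
      · simp only [add_assoc]
      · exact (hφ.comp_measurable (by fun_prop)).aestronglyMeasurable
    · apply StronglyMeasurable.aestronglyMeasurable
      apply StronglyMeasurable.integral_prod_right
        (f := fun (y : EN N) (y' : EN N) => φ (x + (y + y')))
      exact hφ.comp_measurable (by fun_prop)
  · exact (integrable_const M).mono' hm.aestronglyMeasurable (Eventually.of_forall fun z => h _)

lemma gd_hasFDerivAt (z : EN N) :
    HasFDerivAt (gd N) ((-(gd N z / 2)) • innerSL ℝ z) z := by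
  have h1 : HasFDerivAt (fun z : EN N => ‖z‖ ^ 2) (2 • innerSL ℝ z) z :=
    (hasStrictFDerivAt_norm_sq z).hasFDerivAt
  have h2 : HasFDerivAt (fun z : EN N => -‖z‖ ^ 2 / 4) ((-(1/4 : ℝ)) • (2 • innerSL ℝ z)) z := by
    refine (h1.const_mul (-(1/4 : ℝ))).congr_of_eventuallyEq (Eventually.of_forall fun y => ?_)
    simp only; ring
  have h3 := (h2.exp).const_mul ((4 * π) ^ (-(N : ℝ) / 2))
  refine h3.congr_fderiv ?_
  ext v
  simp [gd]; ring

lemma gd_shift_bound : ∃ C : ℝ, ∀ (w z : EN N), ‖z - w‖ ≤ 1 →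
    gd N w * ‖w‖ ≤ C * Real.exp (-(3/32) * ‖z‖ ^ 2) := by
  obtain ⟨C, hC, h⟩ := pow_le_exp_sq 1
  refine ⟨(4 * π) ^ (-(N : ℝ) / 2) * C * Real.exp (3/16), fun w z hz => ?_⟩
  have h1 := h ‖w‖ (norm_nonneg w)
  have h2 : ‖z‖ ≤ ‖w‖ + 1 := by
    calc ‖z‖ = ‖w + (z - w)‖ := by congr 1; abel
      _ ≤ _ := (norm_add_le _ _).trans (by gcongr)
  have h3 : ‖z‖ ^ 2 ≤ 2 * ‖w‖ ^ 2 + 2 := by nlinarith [sq_nonneg (‖w‖ - 1), norm_nonneg z]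
  rw [pow_one] at h1
  unfold gd
  calc _ ≤ (4 * π) ^ (-(N : ℝ) / 2) * Real.exp (-‖w‖ ^ 2 / 4) * (C * Real.exp (‖w‖ ^ 2 / 16)) := by
        gcongr
    _ = (4 * π) ^ (-(N : ℝ) / 2) * C * (Real.exp (-‖w‖ ^ 2 / 4) * Real.exp (‖w‖ ^ 2 / 16)) := by
        ring
    _ = (4 * π) ^ (-(N : ℝ) / 2) * C * (Real.exp (-(3/16) * ‖w‖ ^ 2)) := by
        rw [← Real.exp_add]; congr 2; ring
    _ ≤ (4 * π) ^ (-(N : ℝ) / 2) * C * (Real.exp (3/16) * Real.exp (-(3/32) * ‖z‖ ^ 2)) := by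
        gcongr
        rw [← Real.exp_add]
        apply Real.exp_le_exp.2
        linarith
    _ = _ := by ring

lemma P_hasFDerivAt [CompleteSpace G] {σ M : ℝ} (hσ : 0 < σ) {φ : EN N → G}
    (hφ : StronglyMeasurable φ) (h : ∀ y, ‖φ y‖ ≤ M) (x : EN N) :
    HasFDerivAt (P σ φ) (Q σ φ x) x := by
  have hs : 0 < √σ := Real.sqrt_pos.2 hσ
  have hM : 0 ≤ M := (norm_nonneg _).trans (h 0)
  obtain ⟨C, hC⟩ := gd_shift_bound (N := N)
  set c := 1 / √σ with hc
  have hcs : √σ * c = 1 := by rw [hc]; field_simp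
  have hcpos : 0 < c := by positivity
  let w : EN N → EN N → EN N := fun x' z => z - c • (x' - x)
  let K : EN N → EN N → G := fun x' z => gd N (w x' z) • φ (x + √σ • z)
  let K' : EN N → EN N → (EN N →L[ℝ] G) := fun x' z =>
    ((gd N (w x' z) * (c / 2)) • innerSL ℝ (w x' z)).smulRight (φ (x + √σ • z))
  have e0 : P σ φ = fun x' => ∫ z, K x' z := by
    ext x'
    unfold P
    rw [integral_gm, ← integral_sub_right_eq_self _ (c • (x' - x))]
    congr 1; ext z
    simp only [K, w]
    congr 2
    rw [smul_sub, smul_smul, hcs, one_smul]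
    abel
  have e1 : Q σ φ x = ∫ z, K' x z := by
    unfold Q
    rw [integral_gm, ← integral_smul]
    congr 1; ext z v
    simp only [K', w, sub_self, smul_zero, sub_zero, _root_.smul_apply,
      ContinuousLinearMap.smulRight_apply, smul_smul, smul_eq_mul]
    congr 1
    rw [hc]; field_simp
  rw [e0, e1]
  have hwc : ∀ x', Continuous (w x') := fun x' => by fun_prop
  have hK : ∀ x', AEStronglyMeasurable (K x') volume := fun x' =>
    ((gd_cont.comp (hwc x')).stronglyMeasurable.smul (meas_shift hφ x _)).aestronglyMeasurable
  refine hasFDerivAt_integral_of_dominated_of_fderiv_le (F := K) (F' := K')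
    (s := Metric.ball x (√σ)) (bound := fun z => c / 2 * M * C * Real.exp (-(3/32) * ‖z‖ ^ 2))
    (Metric.ball_mem_nhds x hs)
    (Eventually.of_forall hK) ?_ ?_ ?_ ?_ ?_
  · have := (integrable_gm (N := N) (fun z => φ (x + √σ • z))).1 (int_shift hφ h x _)
    refine this.congr (Eventually.of_forall fun z => ?_)
    simp [K, w]
  · have h1 : Continuous fun z => (gd N (w x z) * (c / 2)) • innerSL ℝ (w x z) := by
      have := gd_cont.comp (hwc x)
      have h2 := (innerSL ℝ (E := EN N)).continuous.comp (hwc x)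
      exact (this.mul continuous_const).smul h2
    have h3 : Continuous fun p : (EN N →L[ℝ] ℝ) × G => p.1.smulRight p.2 := by fun_prop
    exact (h3.comp_stronglyMeasurable (h1.stronglyMeasurable.prodMk
      (meas_shift hφ x (√σ)))).aestronglyMeasurable
  · refine Eventually.of_forall fun z x' hx' => ?_
    simp only [K']
    rw [ContinuousLinearMap.norm_smulRight_apply, norm_smul, innerSL_apply_norm,
      Real.norm_of_nonneg (mul_nonneg (gd_pos _).le (by positivity))]
    have h1 : ‖z - w x' z‖ ≤ 1 := by
      simp only [w, _root_.sub_sub_cancel, norm_smul, Real.norm_of_nonneg hcpos.le]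
      rw [Metric.mem_ball, dist_eq_norm] at hx'
      rw [← hcs, mul_comm]; gcongr
    have h2 := hC _ _ h1
    calc _ ≤ gd N (w x' z) * (c / 2) * ‖w x' z‖ * M := by
          have := (gd_pos (w x' z)).le
          gcongr; exact h _
      _ = c / 2 * M * (gd N (w x' z) * ‖w x' z‖) := by ring
      _ ≤ c / 2 * M * (C * Real.exp (-(3/32) * ‖z‖ ^ 2)) := by gcongr
      _ = _ := by ring
  · exact (integrable_exp_sq (by norm_num)).const_mul _
  · refine Eventually.of_forall fun z x' hx' => ?_
    have hw : HasFDerivAt (fun x' => w x' z) (-(c • ContinuousLinearMap.id ℝ (EN N))) x' := by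
      simp only [w]
      exact (((hasFDerivAt_id x').sub_const x).const_smul c).const_sub z
    have h1 := ((gd_hasFDerivAt (w x' z)).comp x' hw).smul_const (φ (x + √σ • z))
    refine h1.congr_fderiv ?_
    ext v
    simp [K', smul_smul]
    congr 1; ring

lemma P_hasFDerivAt_C1 [CompleteSpace G] {σ M M' : ℝ} {φ : EN N → G} {φ' : EN N → EN N →L[ℝ] G}
    (hφ : ∀ y, HasFDerivAt φ (φ' y) y) (hc : Continuous φ') (h : ∀ y, ‖φ y‖ ≤ M)
    (h' : ∀ y, ‖φ' y‖ ≤ M') (x : EN N) :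
    HasFDerivAt (P σ φ) (P σ φ' x) x := by
  have hφc : Continuous φ := continuous_iff_continuousAt.2 fun y => (hφ y).continuousAt
  unfold P
  refine hasFDerivAt_integral_of_dominated_of_fderiv_le (μ := gm N)
    (F := fun x z => φ (x + √σ • z))
    (F' := fun x z => φ' (x + √σ • z)) (s := univ) (bound := fun _ => M') univ_mem
    (Eventually.of_forall fun x => (meas_shift hφc.stronglyMeasurable x _).aestronglyMeasurable)
    (int_shift hφc.stronglyMeasurable h x _)
    (meas_shift hc.stronglyMeasurable x _).aestronglyMeasurable
    (Eventually.of_forall fun z x _ => h' _) (integrable_const _)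
    (Eventually.of_forall fun z x _ => ?_)
  have := (hφ (x + √σ • z)).comp x ((hasFDerivAt_id x).add_const (√σ • z))
  simpa [Function.comp_def] using this

lemma IBP [CompleteSpace G] {σ M M' : ℝ} (hσ : 0 < σ) {φ : EN N → G} {φ' : EN N → EN N →L[ℝ] G}
    (hφ : ∀ y, HasFDerivAt φ (φ' y) y) (hc : Continuous φ') (h : ∀ y, ‖φ y‖ ≤ M)
    (h' : ∀ y, ‖φ' y‖ ≤ M') (x : EN N) : Q σ φ x = P σ φ' x := by
  have hφc : Continuous φ := continuous_iff_continuousAt.2 fun y => (hφ y).continuousAt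
  exact (P_hasFDerivAt hσ hφc.stronglyMeasurable h x).unique (P_hasFDerivAt_C1 hφ hc h h' x)

lemma P_contOn {S : Set ℝ} {F : ℝ → EN N → G} {M : ℝ}
    (hF : ContinuousOn (fun p : ℝ × EN N => F p.1 p.2) (S ×ˢ univ))
    (hM : ∀ s ∈ S, ∀ y, ‖F s y‖ ≤ M) :
    ContinuousOn (fun p : ℝ × ℝ × EN N => P p.1 (F p.2.1) p.2.2) (univ ×ˢ S ×ˢ univ) := by
  unfold P
  refine continuousOn_of_dominated (μ := gm N) (bound := fun _ => M) ?_ ?_ (integrable_const _) ?_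
  · rintro ⟨σ, s, x⟩ ⟨_, hs, _⟩
    have : Continuous (F s) := by
      rw [← continuousOn_univ]
      exact hF.comp (f := fun y => (s, y)) (by fun_prop) fun y _ => ⟨hs, mem_univ _⟩
    exact (meas_shift this.stronglyMeasurable x _).aestronglyMeasurable
  · rintro ⟨σ, s, x⟩ ⟨_, hs, _⟩
    exact Eventually.of_forall fun z => hM s hs _
  · refine Eventually.of_forall fun z => ?_
    exact hF.comp (f := fun p : ℝ × ℝ × EN N => (p.2.1, p.2.2 + √p.1 • z)) (by fun_prop)
      fun p hp => ⟨hp.2.1, mem_univ _⟩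

lemma Q_contOn {S : Set ℝ} {F : ℝ → EN N → G} {M : ℝ}
    (hF : ContinuousOn (fun p : ℝ × EN N => F p.1 p.2) (S ×ˢ univ))
    (hM : ∀ s ∈ S, ∀ y, ‖F s y‖ ≤ M) :
    ContinuousOn (fun p : ℝ × ℝ × EN N => Q p.1 (F p.2.1) p.2.2) (Ioi 0 ×ˢ S ×ˢ univ) := by
  unfold Q
  refine ContinuousOn.smul (f := fun p : ℝ × ℝ × EN N => 1 / (2 * √p.1)) (g := fun p : ℝ × ℝ × EN N =>
    ∫ z, (innerSL ℝ z).smulRight (F p.2.1 (p.2.2 + √p.1 • z)) ∂(gm N)) ?_ ?_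
  · refine ContinuousOn.div (by fun_prop) (by fun_prop) ?_
    rintro ⟨σ, s, x⟩ ⟨hσ, hs, _⟩
    have : 0 < √σ := Real.sqrt_pos.2 hσ
    positivity
  have h3 : Continuous fun p : (EN N →L[ℝ] ℝ) × G => p.1.smulRight p.2 := by fun_prop
  have h4 : Continuous fun z : EN N => innerSL ℝ z := (innerSL ℝ (E := EN N)).continuous
  refine continuousOn_of_dominated (μ := gm N) (bound := fun z => M * ‖z‖) ?_ ?_
    (integrable_norm_gm.const_mul M) ?_
  · rintro ⟨σ, s, x⟩ ⟨_, hs, _⟩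
    have : Continuous (F s) := by
      rw [← continuousOn_univ]
      exact hF.comp (f := fun y => (s, y)) (by fun_prop) fun y _ => ⟨hs, mem_univ _⟩
    exact (h3.comp_stronglyMeasurable (h4.stronglyMeasurable.prodMk
      (meas_shift this.stronglyMeasurable x (√σ)))).aestronglyMeasurable
  · rintro ⟨σ, s, x⟩ ⟨_, hs, _⟩
    refine Eventually.of_forall fun z => ?_
    rw [norm_smulRight_inner, mul_comm]
    gcongr
    exact hM s hs _
  · refine Eventually.of_forall fun z => ?_
    have := hF.comp (f := fun p : ℝ × ℝ × EN N => (p.2.1, p.2.2 + √p.1 • z))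
      (s := Ioi 0 ×ˢ S ×ˢ univ) (by fun_prop) fun p hp => ⟨hp.2.1, mem_univ _⟩
    exact h3.comp_continuousOn (continuousOn_const.prodMk this)

end

end HeatW

namespace HeatW

section
variable {N : ℕ} {G : Type*} [NormedAddCommGroup G] [NormedSpace ℝ G]

/-- Duhamel integral. -/
noncomputable def D (F : ℝ → EN N → G) (τ t : ℝ) (x : EN N) : G :=
  ∫ s in τ..t, P (t - s) (F s) x

/-- Gradient of the Duhamel integral. -/
noncomputable def DQ (F : ℝ → EN N → G) (τ t : ℝ) (x : EN N) : EN N →L[ℝ] G :=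
  ∫ s in τ..t, Q (t - s) (F s) x

lemma D_theta (F : ℝ → EN N → G) (τ t : ℝ) (x : EN N) :
    D F τ t x = (t - τ) • ∫ θ in (0:ℝ)..1,
      P ((1 - θ) * (t - τ)) (F (τ + (t - τ) * θ)) x := by
  have := intervalIntegral.smul_integral_comp_add_mul (a := 0) (b := 1)
    (fun s => P (t - s) (F s) x) (t - τ) τ
  unfold D
  rw [show τ + (t - τ) * 0 = τ by ring, show τ + (t - τ) * 1 = t by ring] at this
  rw [← this]
  congr 2; ext θ; congr 1; ring_nf

lemma DQ_theta (F : ℝ → EN N → G) (τ t : ℝ) (x : EN N) :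
    DQ F τ t x = (t - τ) • ∫ θ in (0:ℝ)..1,
      Q ((1 - θ) * (t - τ)) (F (τ + (t - τ) * θ)) x := by
  have := intervalIntegral.smul_integral_comp_add_mul (a := 0) (b := 1)
    (fun s => Q (t - s) (F s) x) (t - τ) τ
  unfold DQ
  rw [show τ + (t - τ) * 0 = τ by ring, show τ + (t - τ) * 1 = t by ring] at this
  rw [← this]
  congr 2; ext θ; congr 1; ring_nf

/-- Standing hypotheses: continuity and boundedness on a time set. -/
structure CB (S : Set ℝ) (F : ℝ → EN N → G) (M : ℝ) : Prop where
  cont : ContinuousOn (fun p : ℝ × EN N => F p.1 p.2) (S ×ˢ univ)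
  bd : ∀ s ∈ S, ∀ y, ‖F s y‖ ≤ M

lemma CB.mono {S S' : Set ℝ} {F : ℝ → EN N → G} {M : ℝ} (h : CB S F M) (hs : S' ⊆ S) :
    CB S' F M := ⟨h.cont.mono (prod_mono hs subset_rfl), fun s hs' y => h.bd s (hs hs') y⟩

lemma CB.slice {S : Set ℝ} {F : ℝ → EN N → G} {M : ℝ} (h : CB S F M) {s : ℝ} (hs : s ∈ S) :
    Continuous (F s) := by
  rw [← continuousOn_univ]
  exact h.cont.comp (f := fun y => (s, y)) (by fun_prop) fun y _ => ⟨hs, mem_univ _⟩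

lemma CB.congr {S : Set ℝ} {F F2 : ℝ → EN N → G} {M : ℝ} (h : CB S F M)
    (he : ∀ s ∈ S, ∀ y, F2 s y = F s y) : CB S F2 M :=
  ⟨h.cont.congr fun p hp => he p.1 hp.1 p.2, fun s hs y => by rw [he s hs]; exact h.bd s hs y⟩

lemma P_ii {S : Set ℝ} {F : ℝ → EN N → G} {M : ℝ} (h : CB S F M) {τ t : ℝ} (hτ : τ ≤ t)
    (hS : Ioc τ t ⊆ S) (T : ℝ) (x : EN N) :
    IntervalIntegrable (fun s => P (T - s) (F s) x) volume τ t := by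
  rw [intervalIntegrable_iff_integrableOn_Ioc_of_le hτ]
  refine Integrable.mono' (g := fun _ => M) (integrable_const _) ?_ ?_
  · refine ContinuousOn.aestronglyMeasurable ?_ (measurableSet_Ioc : MeasurableSet (Ioc τ t))
    exact (P_contOn h.cont h.bd).comp (f := fun s => (T - s, s, x)) (by fun_prop)
      fun s hs => ⟨mem_univ _, hS hs, mem_univ _⟩
  · refine (ae_restrict_iff' measurableSet_Ioc).2 (Eventually.of_forall fun s hs => ?_)
    exact P_norm_le (h.bd s (hS hs)) x

lemma D_norm_le {S : Set ℝ} {F : ℝ → EN N → G} {M : ℝ} (h : CB S F M) {τ t : ℝ} (hτ : τ ≤ t)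
    (hS : Ioc τ t ⊆ S) (x : EN N) : ‖D F τ t x‖ ≤ M * (t - τ) := by
  unfold D
  have := intervalIntegral.norm_integral_le_of_norm_le_const (a := τ) (b := t) (C := M)
    (f := fun s => P (t - s) (F s) x) (fun s hs => P_norm_le (h.bd s (hS (by
      rwa [uIoc_of_le hτ] at hs))) x)
  rwa [abs_of_nonneg (by linarith)] at this

lemma mem_theta {τ t θ : ℝ} (h : τ < t) (hθ : θ ∈ Ioc (0:ℝ) 1) :
    τ + (t - τ) * θ ∈ Ioc τ t := by
  have : 0 < t - τ := by linarith
  constructor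
  · nlinarith [mul_pos this hθ.1]
  · nlinarith [mul_le_mul_of_nonneg_left hθ.2 this.le]

lemma D_contOn {S A : Set ℝ} {F : ℝ → EN N → G} {M : ℝ} (h : CB S F M) {τ : ℝ}
    (hA : ∀ t ∈ A, τ < t ∧ Ioc τ t ⊆ S) :
    ContinuousOn (fun p : ℝ × EN N => D F τ p.1 p.2) (A ×ˢ univ) := by
  simp_rw [D_theta]
  refine ContinuousOn.smul (by fun_prop) ?_
  simp_rw [intervalIntegral.integral_of_le (zero_le_one (α := ℝ))]
  refine continuousOn_of_dominated (bound := fun _ => M) ?_ ?_ (integrable_const _) ?_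
  · rintro ⟨t, x⟩ ⟨ht, _⟩
    refine ContinuousOn.aestronglyMeasurable ?_ measurableSet_Ioc
    exact (P_contOn h.cont h.bd).comp
      (f := fun θ => ((1 - θ) * (t - τ), τ + (t - τ) * θ, x)) (by fun_prop)
      fun s hs => ⟨mem_univ _, (hA t ht).2 (mem_theta (hA t ht).1 hs), mem_univ _⟩
  · rintro ⟨t, x⟩ ⟨ht, _⟩
    refine (ae_restrict_iff' measurableSet_Ioc).2 (Eventually.of_forall fun s hs => ?_)
    exact P_norm_le (h.bd _ ((hA t ht).2 (mem_theta (hA t ht).1 hs))) x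
  · refine (ae_restrict_iff' measurableSet_Ioc).2 (Eventually.of_forall fun s hs => ?_)
    exact (P_contOn h.cont h.bd).comp
      (f := fun p : ℝ × EN N => ((1 - s) * (p.1 - τ), τ + (p.1 - τ) * s, p.2)) (by fun_prop)
      fun p hp => ⟨mem_univ _, (hA p.1 hp.1).2 (mem_theta (hA p.1 hp.1).1 hs), mem_univ _⟩

lemma Q_norm_le' {σ M : ℝ} {φ : EN N → G} (h : ∀ y, ‖φ y‖ ≤ M) (x : EN N) :
    ‖Q σ φ x‖ ≤ M * m1 N / (2 * √σ) := by
  rcases lt_or_ge 0 σ with hσ | hσ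
  · exact Q_norm_le hσ h x
  · rw [Real.sqrt_eq_zero_of_nonpos hσ]
    unfold Q
    simp [Real.sqrt_eq_zero_of_nonpos hσ]

lemma ii_sqrt (T τ t : ℝ) (K : ℝ) :
    IntervalIntegrable (fun s : ℝ => K / (2 * √(T - s))) volume τ t := by
  have h := (intervalIntegral.intervalIntegrable_rpow' (a := T - τ) (b := T - t)
    (r := -(1/2)) (by norm_num))
  have h2 := (h.comp_sub_left T).symm.const_mul (K / 2)
  rw [_root_.sub_sub_cancel, _root_.sub_sub_cancel] at h2
  have h3 : IntegrableOn (fun s : ℝ => K / (2 * √(T - s))) (Set.uIoc τ t) := by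
    have h4 := (intervalIntegrable_iff.1 h2.symm).norm
    refine Integrable.mono h4 (by
      apply Measurable.aestronglyMeasurable; fun_prop) (Eventually.of_forall fun s => ?_)
    rcases le_or_gt (T - s) 0 with hs | hs
    · rw [Real.sqrt_eq_zero_of_nonpos hs]; simp; positivity
    · rw [Real.rpow_neg hs.le, ← Real.sqrt_eq_rpow, norm_norm]
      apply le_of_eq; congr 1
      field_simp
  exact intervalIntegrable_iff.2 h3

/-- The constant in the Duhamel gradient bound. -/
noncomputable def I1 : ℝ := ∫ θ in (0:ℝ)..1, 1 / (2 * √(1 - θ))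

lemma Q_theta_bound {M : ℝ} {φ : EN N → G} (h : ∀ y, ‖φ y‖ ≤ M) (x : EN N) {c θ : ℝ} (hc : 0 < c)
    (hθ : θ ∈ Ioc (0:ℝ) 1) :
    ‖√c • Q ((1 - θ) * c) φ x‖ ≤ M * m1 N * (1 / (2 * √(1 - θ))) := by
  have h1 := Q_norm_le' (σ := (1 - θ) * c) h x
  have hs : 0 < √c := Real.sqrt_pos.2 hc
  rw [norm_smul, Real.norm_of_nonneg hs.le]
  rw [Real.sqrt_mul (by linarith [hθ.2])] at h1
  calc _ ≤ √c * (M * m1 N / (2 * (√(1 - θ) * √c))) := by gcongr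
    _ = _ := by
      rcases eq_or_ne (√(1 - θ)) 0 with h0 | h0
      · rw [h0]; simp
      · field_simp

lemma DQ_theta' (F : ℝ → EN N → G) {τ t : ℝ} (h : τ ≤ t) (x : EN N) :
    DQ F τ t x = √(t - τ) • ∫ θ in (0:ℝ)..1,
      √(t - τ) • Q ((1 - θ) * (t - τ)) (F (τ + (t - τ) * θ)) x := by
  rw [DQ_theta, intervalIntegral.integral_smul, smul_smul, Real.mul_self_sqrt (by linarith)]

lemma I1_int (K : ℝ) : IntegrableOn (fun θ : ℝ => K * (1 / (2 * √(1 - θ)))) (Ioc 0 1) := by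
  have := ((ii_sqrt 1 0 1 1).const_mul K)
  rwa [intervalIntegrable_iff_integrableOn_Ioc_of_le zero_le_one] at this

lemma DQ_norm_le {S : Set ℝ} {F : ℝ → EN N → G} {M : ℝ} (h : CB S F M) {τ t : ℝ} (hτ : τ < t)
    (hS : Ioc τ t ⊆ S) (x : EN N) : ‖DQ F τ t x‖ ≤ √(t - τ) * (M * m1 N * I1) := by
  rw [DQ_theta' F hτ.le, norm_smul, Real.norm_of_nonneg (Real.sqrt_nonneg _)]
  gcongr
  unfold I1
  rw [← intervalIntegral.integral_const_mul, intervalIntegral.integral_of_le zero_le_one,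
    intervalIntegral.integral_of_le zero_le_one]
  refine norm_integral_le_of_norm_le (I1_int _) ?_
  refine (ae_restrict_iff' measurableSet_Ioc).2 (Eventually.of_forall fun s hs => ?_)
  exact Q_theta_bound (h.bd _ (hS (mem_theta hτ hs))) x (by linarith) hs

lemma DQ_contOn {S A : Set ℝ} {F : ℝ → EN N → G} {M : ℝ} (h : CB S F M) {τ : ℝ}
    (hA : ∀ t ∈ A, τ < t ∧ Ioc τ t ⊆ S) :
    ContinuousOn (fun p : ℝ × EN N => DQ F τ p.1 p.2) (A ×ˢ univ) := by
  have e : EqOn (fun p : ℝ × EN N => DQ F τ p.1 p.2) (fun p : ℝ × EN N =>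
    √(p.1 - τ) • ∫ θ in Ioo (0:ℝ) 1,
      √(p.1 - τ) • Q ((1 - θ) * (p.1 - τ)) (F (τ + (p.1 - τ) * θ)) p.2) (A ×ˢ univ) := by
    rintro ⟨t, x⟩ ⟨ht, _⟩
    simp only
    rw [DQ_theta' F (hA t ht).1.le, intervalIntegral.integral_of_le zero_le_one,
      integral_Ioc_eq_integral_Ioo]
  refine ContinuousOn.congr ?_ e
  refine ContinuousOn.smul (f := fun p : ℝ × EN N => √(p.1 - τ)) (g := fun p : ℝ × EN N =>
    ∫ θ in Ioo (0:ℝ) 1, √(p.1 - τ) • Q ((1 - θ) * (p.1 - τ)) (F (τ + (p.1 - τ) * θ)) p.2)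
    (by fun_prop) ?_
  have key : ∀ s ∈ Ioo (0:ℝ) 1, ∀ t ∈ A, 0 < (1 - s) * (t - τ) ∧ τ + (t - τ) * s ∈ S :=
    fun s hs t ht => ⟨mul_pos (by linarith [hs.2]) (by linarith [(hA t ht).1]),
      (hA t ht).2 (mem_theta (hA t ht).1 (Ioo_subset_Ioc_self hs))⟩
  refine continuousOn_of_dominated (bound := fun θ => M * m1 N * (1 / (2 * √(1 - θ)))) ?_ ?_
    ((I1_int _).mono_set Ioo_subset_Ioc_self) ?_
  · rintro ⟨t, x⟩ ⟨ht, _⟩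
    refine ContinuousOn.aestronglyMeasurable ?_ measurableSet_Ioo
    refine ContinuousOn.const_smul (?_ : ContinuousOn (fun θ =>
      Q ((1 - θ) * (t - τ)) (F (τ + (t - τ) * θ)) x) _) (√(t - τ))
    exact (Q_contOn h.cont h.bd).comp
      (f := fun θ => ((1 - θ) * (t - τ), τ + (t - τ) * θ, x)) (by fun_prop)
      fun s hs => ⟨(key s hs t ht).1, (key s hs t ht).2, mem_univ _⟩
  · rintro ⟨t, x⟩ ⟨ht, _⟩
    refine (ae_restrict_iff' measurableSet_Ioo).2 (Eventually.of_forall fun s hs => ?_)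
    exact Q_theta_bound (h.bd _ (key s hs t ht).2) x (by linarith [(hA t ht).1])
      (Ioo_subset_Ioc_self hs)
  · refine (ae_restrict_iff' measurableSet_Ioo).2 (Eventually.of_forall fun s hs => ?_)
    refine ContinuousOn.smul (f := fun p : ℝ × EN N => √(p.1 - τ)) (g := fun p : ℝ × EN N =>
      Q ((1 - s) * (p.1 - τ)) (F (τ + (p.1 - τ) * s)) p.2) (by fun_prop) ?_
    exact (Q_contOn h.cont h.bd).comp
      (f := fun p : ℝ × EN N => ((1 - s) * (p.1 - τ), τ + (p.1 - τ) * s, p.2)) (by fun_prop)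
      fun p hp => ⟨(key s hs p.1 hp.1).1, (key s hs p.1 hp.1).2, mem_univ _⟩

lemma D_hasFDerivAt [CompleteSpace G] {S : Set ℝ} {F : ℝ → EN N → G} {M : ℝ} (h : CB S F M)
    {τ t : ℝ} (hτ : τ < t) (hS : Ioc τ t ⊆ S) (x : EN N) :
    HasFDerivAt (D F τ t) (DQ F τ t x) x := by
  unfold D DQ
  rw [intervalIntegral.integral_of_le hτ.le, integral_Ioc_eq_integral_Ioo]
  simp_rw [intervalIntegral.integral_of_le hτ.le, integral_Ioc_eq_integral_Ioo]
  refine hasFDerivAt_integral_of_dominated_of_fderiv_le (s := univ) (μ := volume.restrict (Ioo τ t))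
    (F := fun x s => P (t - s) (F s) x) (F' := fun x s => Q (t - s) (F s) x)
    (bound := fun s => M * m1 N / (2 * √(t - s))) univ_mem ?_ ?_ ?_ ?_ ?_ ?_
  · refine Eventually.of_forall fun x => ?_
    exact ((P_ii h hτ.le hS t x).1.mono_set Ioo_subset_Ioc_self).aestronglyMeasurable
  · exact ((P_ii h hτ.le hS t x).1.mono_set Ioo_subset_Ioc_self)
  · refine ContinuousOn.aestronglyMeasurable ?_ measurableSet_Ioo
    exact (Q_contOn h.cont h.bd).comp (f := fun s => (t - s, s, x)) (by fun_prop)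
      fun s hs => ⟨by simpa using hs.2, hS (Ioo_subset_Ioc_self hs), mem_univ _⟩
  · refine (ae_restrict_iff' measurableSet_Ioo).2 (Eventually.of_forall fun s hs x _ => ?_)
    exact Q_norm_le' (h.bd s (hS (Ioo_subset_Ioc_self hs))) x
  · exact ((ii_sqrt t τ t _).1.mono_set Ioo_subset_Ioc_self)
  · refine (ae_restrict_iff' measurableSet_Ioo).2 (Eventually.of_forall fun s hs x _ => ?_)
    have hs' := hS (Ioo_subset_Ioc_self hs)
    exact P_hasFDerivAt (by linarith [hs.2]) (h.slice hs').stronglyMeasurable (h.bd s hs') x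

lemma D_hasFDerivAt_C1 [CompleteSpace G] {S : Set ℝ} {F : ℝ → EN N → G} {M M' : ℝ} (h : CB S F M)
    {F' : ℝ → EN N → EN N →L[ℝ] G} (h' : CB S F' M')
    (hd : ∀ s ∈ S, ∀ y, HasFDerivAt (F s) (F' s y) y)
    {τ t : ℝ} (hτ : τ < t) (hS : Ioc τ t ⊆ S) (x : EN N) :
    HasFDerivAt (D F τ t) (D F' τ t x) x := by
  unfold D
  rw [intervalIntegral.integral_of_le hτ.le]
  simp_rw [intervalIntegral.integral_of_le hτ.le]
  refine hasFDerivAt_integral_of_dominated_of_fderiv_le (s := univ) (μ := volume.restrict (Ioc τ t))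
    (F := fun x s => P (t - s) (F s) x) (F' := fun x s => P (t - s) (F' s) x)
    (bound := fun s => M') univ_mem ?_ ?_ ?_ ?_ ?_ ?_
  · refine Eventually.of_forall fun x => ?_
    exact (P_ii h hτ.le hS t x).1.aestronglyMeasurable
  · exact (P_ii h hτ.le hS t x).1
  · exact (P_ii h' hτ.le hS t x).1.aestronglyMeasurable
  · refine (ae_restrict_iff' measurableSet_Ioc).2 (Eventually.of_forall fun s hs x _ => ?_)
    exact P_norm_le (h'.bd s (hS hs)) x
  · exact integrable_const _
  · refine (ae_restrict_iff' measurableSet_Ioc).2 (Eventually.of_forall fun s hs x _ => ?_)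
    exact P_hasFDerivAt_C1 (hd s (hS hs)) (h'.slice (hS hs)) (h.bd s (hS hs)) (h'.bd s (hS hs)) x

lemma D_restart [CompleteSpace G] {S : Set ℝ} {F : ℝ → EN N → G} {M : ℝ} (h : CB S F M)
    {a τ t : ℝ} (ha : a < τ) (hτ : τ < t) (hS : Ioc a t ⊆ S) (x : EN N) :
    D F a t x = P (t - τ) (D F a τ) x + D F τ t x := by
  have hS1 : Ioc a τ ⊆ S := (Ioc_subset_Ioc_right hτ.le).trans hS
  have hS2 : Ioc τ t ⊆ S := (Ioc_subset_Ioc_left ha.le).trans hS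
  unfold D
  rw [← intervalIntegral.integral_add_adjacent_intervals (P_ii h ha.le hS1 t x)
    (P_ii h hτ.le hS2 t x)]
  congr 1
  rw [intervalIntegral.integral_of_le ha.le]
  simp_rw [intervalIntegral.integral_of_le ha.le]
  show _ = ∫ z, (∫ s in Ioc a τ, P (τ - s) (F s) (x + √(t - τ) • z)) ∂(gm N)
  rw [integral_integral_swap (f := fun z s => P (τ - s) (F s) (x + √(t - τ) • z))]
  · refine setIntegral_congr_fun (measurableSet_Ioc : MeasurableSet (Ioc a τ)) fun s hs => ?_
    have hs' := hS1 hs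
    have := P_semigroup (a := t - τ) (b := τ - s) (by linarith) (by linarith [hs.2])
      (h.slice hs').stronglyMeasurable (h.bd s hs') x
    rw [show t - τ + (τ - s) = t - s by ring] at this
    exact this.symm
  · refine (integrable_const M).mono' ?_ ?_
    · have h1 := (P_contOn h.cont h.bd).comp
        (f := fun p : EN N × ℝ => (τ - p.2, p.2, x + √(t - τ) • p.1)) (s := univ ×ˢ Ioc a τ)
        (by fun_prop) fun s hs => ⟨mem_univ _, hS1 hs.2, mem_univ _⟩
      have h2 := h1.aestronglyMeasurable (μ := (gm N).prod volume)
        (MeasurableSet.univ.prod measurableSet_Ioc)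
      rw [← Measure.prod_restrict, Measure.restrict_univ] at h2
      exact h2
    · have : ∀ᵐ p : EN N × ℝ ∂((gm N).prod (volume.restrict (Ioc a τ))), p.2 ∈ Ioc a τ := by
        have h0 := ae_restrict_mem (μ := (gm N).prod volume) (s := (univ : Set (EN N)) ×ˢ Ioc a τ)
          (MeasurableSet.univ.prod measurableSet_Ioc)
        rw [← Measure.prod_restrict, Measure.restrict_univ] at h0
        filter_upwards [h0] with p hp using hp.2
      filter_upwards [this] with p hp
      exact P_norm_le (h.bd p.2 (hS1 hp)) _

end

end HeatW


set_option maxSynthPendingDepth 3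
namespace HeatW

section
variable {N : ℕ} {G : Type*} [NormedAddCommGroup G] [NormedSpace ℝ G]

/-- Mild solutions of the inhomogeneous heat equation. -/
structure IsMild (a b : ℝ) (w F : ℝ → EN N → G) (W M : ℝ) : Prop where
  hw : CB (Ioo a b) w W
  hF : CB (Ioo a b) F M
  eq : ∀ τ t, a < τ → τ < t → t < b → ∀ x, w t x = P (t - τ) (w τ) x + D F τ t x

/-- Spatial gradient. -/
noncomputable def gr (w : ℝ → EN N → G) (t : ℝ) (x : EN N) : EN N →L[ℝ] G := fderiv ℝ (w t) x

variable [CompleteSpace G] {a b W M : ℝ} {w F : ℝ → EN N → G}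

lemma IsMild.sub {τ t : ℝ} (hτ : a < τ) (ht : t < b) : Ioc τ t ⊆ Ioo a b :=
  fun s hs => ⟨hτ.trans hs.1, hs.2.trans_lt ht⟩

lemma IsMild.mono (h : IsMild a b w F W M) {a' b' : ℝ} (ha : a ≤ a') (hb : b' ≤ b) :
    IsMild a' b' w F W M :=
  ⟨h.hw.mono (Ioo_subset_Ioo ha hb), h.hF.mono (Ioo_subset_Ioo ha hb),
    fun τ t h1 h2 h3 => h.eq τ t (ha.trans_lt h1) h2 (h3.trans_le hb)⟩

lemma IsMild.formula (h : IsMild a b w F W M) {τ t : ℝ} (hτ : a < τ) (ht : τ < t) (hb : t < b)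
    (x : EN N) : HasFDerivAt (w t) (Q (t - τ) (w τ) x + DQ F τ t x) x := by
  have e : w t = fun x => P (t - τ) (w τ) x + D F τ t x := funext (h.eq τ t hτ ht hb)
  have hτ' : τ ∈ Ioo a b := ⟨hτ, ht.trans hb⟩
  rw [e]
  exact (P_hasFDerivAt (by linarith) (h.hw.slice hτ').stronglyMeasurable (h.hw.bd τ hτ') x).add
    (D_hasFDerivAt h.hF ht (IsMild.sub hτ hb) x)

lemma IsMild.gr_eq (h : IsMild a b w F W M) {τ t : ℝ} (hτ : a < τ) (ht : τ < t) (hb : t < b)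
    (x : EN N) : gr w t x = Q (t - τ) (w τ) x + DQ F τ t x :=
  (h.formula hτ ht hb x).fderiv

lemma IsMild.hasFDerivAt (h : IsMild a b w F W M) {t : ℝ} (ht : t ∈ Ioo a b) (x : EN N) :
    HasFDerivAt (w t) (gr w t x) x := by
  have := h.formula (τ := (a + t) / 2) (t := t) (by linarith [ht.1]) (by linarith [ht.1]) ht.2 x
  exact this.differentiableAt.hasFDerivAt

lemma IsMild.gr_contOn (h : IsMild a b w F W M) :
    ContinuousOn (fun p : ℝ × EN N => gr w p.1 p.2) (Ioo a b ×ˢ univ) := by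
  rintro ⟨t, x⟩ ⟨ht, _⟩
  simp only at ht
  obtain ⟨τ, hτ1, hτ2⟩ : ∃ τ, a < τ ∧ τ < t := exists_between ht.1
  have hτ : τ ∈ Ioo a b := ⟨hτ1, hτ2.trans ht.2⟩
  have hc : ContinuousOn (fun p : ℝ × EN N => gr w p.1 p.2) (Ioo τ b ×ˢ univ) := by
    have h1 : ContinuousOn (fun p : ℝ × EN N => Q (p.1 - τ) (w τ) p.2 + DQ F τ p.1 p.2)
        (Ioo τ b ×ˢ univ) := by
      refine ContinuousOn.add ?_ (DQ_contOn h.hF fun t ht => ⟨ht.1, IsMild.sub hτ1 ht.2⟩)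
      exact (Q_contOn h.hw.cont h.hw.bd).comp (f := fun p : ℝ × EN N => (p.1 - τ, τ, p.2))
        (by fun_prop) fun p hp => ⟨by simpa using hp.1.1, hτ, mem_univ _⟩
    exact h1.congr fun p hp => h.gr_eq hτ1 hp.1.1 hp.1.2 p.2
  have := hc.continuousAt (x := (t, x))
    ((isOpen_Ioo.prod isOpen_univ).mem_nhds ⟨⟨hτ2, ht.2⟩, mem_univ _⟩)
  exact this.continuousWithinAt

lemma IsMild.gr_CB (h : IsMild a b w F W M) {a' : ℝ} (ha : a < a') :
    ∃ W', CB (Ioo a' b) (gr w) W' := by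
  have hc : 0 < (a' - a) / 2 := by linarith
  set c := (a' - a) / 2 with hcd
  refine ⟨W * m1 N / (2 * √c) + √c * (M * m1 N * I1),
    h.gr_contOn.mono (prod_mono (Ioo_subset_Ioo_left ha.le) subset_rfl), fun t ht x => ?_⟩
  have h1 : a < t - c := by rw [hcd]; linarith [ht.1]
  have hτ : t - c ∈ Ioo a b := ⟨h1, by linarith [ht.2]⟩
  rw [h.gr_eq (τ := t - c) h1 (by linarith) ht.2]
  have e : t - (t - c) = c := by ring
  refine (norm_add_le _ _).trans (add_le_add ?_ ?_)
  · rw [e]; exact Q_norm_le' (h.hw.bd _ hτ) x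
  · have := DQ_norm_le h.hF (τ := t - c) (t := t) (by linarith) (IsMild.sub h1 ht.2) x
    rwa [e] at this

lemma IsMild.grad (h : IsMild a b w F W M) {a' W' M' : ℝ} (ha : a < a')
    (hg : CB (Ioo a' b) (gr w) W') {F' : ℝ → EN N → EN N →L[ℝ] G} (hF' : CB (Ioo a' b) F' M')
    (hd : ∀ s ∈ Ioo a' b, ∀ y, HasFDerivAt (F s) (F' s y) y) :
    IsMild a' b (gr w) F' W' M' := by
  refine ⟨hg, hF', fun τ t hτ ht hb x => ?_⟩
  have hτ' : τ ∈ Ioo a' b := ⟨hτ, ht.trans hb⟩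
  have hsub : Ioo a' b ⊆ Ioo a b := Ioo_subset_Ioo_left ha.le
  have e : w t = fun x => P (t - τ) (w τ) x + D F τ t x := funext (h.eq τ t (ha.trans hτ) ht hb)
  have h1 := (P_hasFDerivAt_C1 (σ := t - τ) (fun y => h.hasFDerivAt (hsub hτ') y) (hg.slice hτ')
    (h.hw.bd τ (hsub hτ')) (hg.bd τ hτ') x).add
    (D_hasFDerivAt_C1 (h.hF.mono hsub) hF' hd ht (IsMild.sub hτ hb) x)
  have h2 := h.hasFDerivAt (hsub ⟨hτ.trans ht, hb⟩) x
  rw [e] at h2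
  have h3 : w t = P (t - τ) (w τ) + D F τ t := e
  exact h2.unique h1

end

section
variable {N : ℕ}

/-- Trace functional. -/
noncomputable def trL (N : ℕ) : (EN N →L[ℝ] EN N →L[ℝ] ℝ) →L[ℝ] ℝ :=
  ∑ i : Fin N, (ContinuousLinearMap.apply ℝ ℝ (EuclideanSpace.single i (1:ℝ) : EN N)).comp
    (ContinuousLinearMap.apply ℝ (EN N →L[ℝ] ℝ) (EuclideanSpace.single i (1:ℝ) : EN N))

lemma trL_apply (A : EN N →L[ℝ] EN N →L[ℝ] ℝ) : trL N A =
    ∑ i : Fin N, A (EuclideanSpace.single i 1) (EuclideanSpace.single i 1) := by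
  simp [trL]

lemma trL_smulRight (z : EN N) (l : EN N →L[ℝ] ℝ) :
    trL N ((innerSL ℝ z).smulRight l) = l z := by
  rw [trL_apply]
  have : z = ∑ i : Fin N, z i • (EuclideanSpace.single i (1:ℝ) : EN N) := by
    ext j
    simp [Finset.sum_apply, Pi.single_apply]
  conv_rhs => rw [this, map_sum]
  refine Finset.sum_congr rfl fun i _ => ?_
  simp [EuclideanSpace.inner_single_right]

lemma trL_Q {σ M : ℝ} {ψ : EN N → EN N →L[ℝ] ℝ} (hψ : Continuous ψ) (h : ∀ y, ‖ψ y‖ ≤ M)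
    (x : EN N) : trL N (Q σ ψ x) = ∫ z, ψ (x + √σ • z) ((1 / (2 * √σ)) • z) ∂(gm N) := by
  have hi : Integrable (fun z => (innerSL ℝ z).smulRight (ψ (x + √σ • z))) (gm N) := by
    refine (integrable_norm_gm.const_mul M).mono' ?_ (Eventually.of_forall fun z => ?_)
    · apply Continuous.aestronglyMeasurable
      have : Continuous fun z : EN N => ψ (x + √σ • z) := by fun_prop
      exact ((ContinuousLinearMap.smulRightL ℝ (EN N) (EN N →L[ℝ] ℝ)).continuous₂).comp
        (((innerSL ℝ).continuous).prodMk this)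
    · rw [norm_smulRight_inner, mul_comm]
      gcongr; exact h _
  have h2 := (trL N).integral_comp_comm hi
  unfold Q
  rw [map_smul]
  refine (congrArg (fun r => (1 / (2 * √σ)) • r) h2.symm).trans ?_
  rw [← integral_smul]
  simp_rw [trL_smulRight, map_smul]

lemma P_hasDerivAt {σ M M' M'' : ℝ} (hσ : 0 < σ) {φ : EN N → ℝ} {φ' : EN N → EN N →L[ℝ] ℝ}
    {φ'' : EN N → EN N →L[ℝ] EN N →L[ℝ] ℝ}
    (hφ : ∀ y, HasFDerivAt φ (φ' y) y) (hφ' : ∀ y, HasFDerivAt φ' (φ'' y) y)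
    (hc : Continuous φ'') (h : ∀ y, ‖φ y‖ ≤ M)
    (h' : ∀ y, ‖φ' y‖ ≤ M') (h'' : ∀ y, ‖φ'' y‖ ≤ M'') (x : EN N) :
    HasDerivAt (fun σ => P σ φ x) (trL N (P σ φ'' x)) σ := by
  have hφc : Continuous φ := continuous_iff_continuousAt.2 fun y => (hφ y).continuousAt
  have hφc' : Continuous φ' := continuous_iff_continuousAt.2 fun y => (hφ' y).continuousAt
  rw [← IBP hσ hφ' hc h' h'' x, trL_Q hφc' h' x]
  unfold P
  refine (hasDerivAt_integral_of_dominated_loc_of_deriv_le (s := Ioi (σ / 2))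
    (F := fun σ z => φ (x + √σ • z)) (F' := fun σ z => φ' (x + √σ • z) ((1 / (2 * √σ)) • z))
    (bound := fun z => M' * ((1 / (2 * √(σ / 2))) * ‖z‖)) (Ioi_mem_nhds (by linarith)) ?_ ?_ ?_ ?_ ?_ ?_).2
  · exact Eventually.of_forall fun s => Continuous.aestronglyMeasurable (by fun_prop)
  · exact int_shift hφc.stronglyMeasurable h x _
  · refine Continuous.aestronglyMeasurable ?_
    have : Continuous fun z : EN N => φ' (x + √σ • z) := by fun_prop
    exact this.clm_apply (by fun_prop)
  · refine Eventually.of_forall fun z s hs => ?_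
    have hs' : σ / 2 < s := hs
    have hp : 0 < σ / 2 := by linarith
    refine (ContinuousLinearMap.le_opNorm _ _).trans ?_
    have hM : 0 ≤ M' := (norm_nonneg _).trans (h' 0)
    gcongr
    · exact h' _
    · rw [norm_smul, Real.norm_of_nonneg (by positivity)]
      have : 0 < √(σ / 2) := Real.sqrt_pos.2 hp
      gcongr
  · exact (integrable_norm_gm.const_mul _).const_mul _
  · refine Eventually.of_forall fun z s hs => ?_
    have hs' : 0 < s := by have : σ / 2 < s := hs; linarith
    have h1 : HasDerivAt (fun s : ℝ => x + √s • z) ((1 / (2 * √s)) • z) s :=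
      ((Real.hasDerivAt_sqrt hs'.ne').smul_const z).const_add x
    exact (hφ _).comp_hasDerivAt s h1

lemma P_zero {G : Type*} [NormedAddCommGroup G] [NormedSpace ℝ G] [CompleteSpace G]
    (φ : EN N → G) (x : EN N) : P 0 φ x = φ x := by
  simp [P]

lemma P_cont_sigma {G : Type*} [NormedAddCommGroup G] [NormedSpace ℝ G] {φ : EN N → G} {M : ℝ}
    (hc : Continuous φ) (h : ∀ y, ‖φ y‖ ≤ M) (x : EN N) :
    Continuous (fun σ => P σ φ x) := by
  have h1 := P_contOn (S := univ) (F := fun _ => φ) (M := M) (N := N) (by fun_prop) (fun _ _ => h)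
  rw [← continuousOn_univ]
  exact h1.comp (f := fun σ => (σ, 0, x)) (by fun_prop)
    fun σ _ => ⟨mem_univ _, mem_univ _, mem_univ _⟩

lemma P_hasDeriv_zero {M M' M'' : ℝ} {φ : EN N → ℝ} {φ' : EN N → EN N →L[ℝ] ℝ}
    {φ'' : EN N → EN N →L[ℝ] EN N →L[ℝ] ℝ}
    (hφ : ∀ y, HasFDerivAt φ (φ' y) y) (hφ' : ∀ y, HasFDerivAt φ' (φ'' y) y)
    (hc : Continuous φ'') (h : ∀ y, ‖φ y‖ ≤ M)
    (h' : ∀ y, ‖φ' y‖ ≤ M') (h'' : ∀ y, ‖φ'' y‖ ≤ M'') (x : EN N) :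
    HasDerivWithinAt (fun σ => P σ φ x) (trL N (φ'' x)) (Ici 0) 0 := by
  have hφc : Continuous φ := continuous_iff_continuousAt.2 fun y => (hφ y).continuousAt
  have hd : ∀ σ : ℝ, 0 < σ → HasDerivAt (fun σ => P σ φ x) (trL N (P σ φ'' x)) σ :=
    fun σ hσ => P_hasDerivAt hσ hφ hφ' hc h h' h'' x
  refine hasDerivWithinAt_Ici_of_tendsto_deriv (s := Ioi 0)
    (fun σ hσ => (hd σ hσ).differentiableAt.differentiableWithinAt)
    ((P_cont_sigma hφc h x).continuousWithinAt) self_mem_nhdsWithin ?_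
  have h1 : Tendsto (fun σ => trL N (P σ φ'' x)) (nhdsWithin 0 (Ioi 0)) (nhds (trL N (φ'' x))) := by
    have hcs := (P_cont_sigma hc h'' x).tendsto 0
    rw [P_zero] at hcs
    exact (((trL N).continuous.tendsto _).comp hcs).mono_left nhdsWithin_le_nhds
  refine h1.congr' ?_
  filter_upwards [self_mem_nhdsWithin] with σ hσ using (hd σ hσ).deriv.symm

lemma D_hasDeriv_zero {a b M : ℝ} {F : ℝ → EN N → ℝ} (hF : CB (Ioo a b) F M) {t : ℝ}
    (ht : t ∈ Ioo a b) (x : EN N) :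
    HasDerivWithinAt (fun h => D F t (t + h) x) (F t x) (Ici 0) 0 := by
  have hc : ContinuousOn (fun h : ℝ => ∫ θ in Ioc (0:ℝ) 1, P ((1 - θ) * h) (F (t + h * θ)) x)
      (Ico 0 (b - t)) := by
    have key : ∀ θ ∈ Ioc (0:ℝ) 1, ∀ h ∈ Ico 0 (b - t), t + h * θ ∈ Ioo a b := by
      intro θ hθ h hh
      have h1 : 0 ≤ h * θ := mul_nonneg hh.1 hθ.1.le
      have h2 : h * θ ≤ h := mul_le_of_le_one_right hh.1 hθ.2
      exact ⟨by linarith [ht.1], by linarith [hh.2]⟩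
    refine continuousOn_of_dominated (bound := fun _ => M) ?_ ?_ (integrable_const _) ?_
    · intro h hh
      refine ContinuousOn.aestronglyMeasurable ?_ measurableSet_Ioc
      exact (P_contOn hF.cont hF.bd).comp
        (f := fun θ => ((1 - θ) * h, t + h * θ, x)) (by fun_prop)
        fun s hs => ⟨mem_univ _, key s hs h hh, mem_univ _⟩
    · intro h hh
      refine (ae_restrict_iff' measurableSet_Ioc).2 (Eventually.of_forall fun s hs => ?_)
      exact P_norm_le (hF.bd _ (key s hs h hh)) x
    · refine (ae_restrict_iff' measurableSet_Ioc).2 (Eventually.of_forall fun s hs => ?_)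
      exact (P_contOn hF.cont hF.bd).comp
        (f := fun h : ℝ => ((1 - s) * h, t + h * s, x)) (by fun_prop)
        fun p hp => ⟨mem_univ _, key s hs p hp, mem_univ _⟩
  have h0 : (0:ℝ) < b - t := by linarith [ht.2]
  have hc0 := hc 0 ⟨le_rfl, h0⟩
  have hv : (∫ θ in Ioc (0:ℝ) 1, P ((1 - θ) * 0) (F (t + 0 * θ)) x) = F t x := by
    simp [P_zero]
  rw [hasDerivWithinAt_iff_tendsto_slope]
  have hc1 : Tendsto (fun h : ℝ => ∫ θ in Ioc (0:ℝ) 1, P ((1 - θ) * h) (F (t + h * θ)) x)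
      (nhdsWithin 0 (Ici 0 \ {0})) (nhds (F t x)) := by
    have h2 : Tendsto _ _ (nhds (∫ θ in Ioc (0:ℝ) 1, P ((1 - θ) * 0) (F (t + 0 * θ)) x)) := hc0
    rw [hv] at h2
    refine h2.mono_left ?_
    have : nhdsWithin (0:ℝ) (Ico 0 (b - t)) = nhdsWithin 0 (Ici 0) := nhdsWithin_Ico_eq_nhdsGE h0
    rw [this]
    exact nhdsWithin_mono _ diff_subset
  refine hc1.congr' ?_
  filter_upwards [self_mem_nhdsWithin] with h hh
  have hne : h ≠ 0 := hh.2
  rw [slope_def_field, D_theta, D_theta]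
  rw [intervalIntegral.integral_of_le zero_le_one, add_zero, sub_self, zero_smul, sub_zero, sub_zero,
    add_sub_cancel_left, smul_eq_mul, mul_div_cancel_left₀ _ hne]

lemma hasDerivAt_of_right {f g : ℝ → ℝ} {a b : ℝ} (hf : ContinuousOn f (Ioo a b))
    (hg : ContinuousOn g (Ioo a b))
    (h : ∀ t ∈ Ioo a b, HasDerivWithinAt f (g t) (Ici t) t) :
    ∀ t ∈ Ioo a b, HasDerivAt f (g t) t := by
  intro t ht
  obtain ⟨c, hc1, hc2⟩ := exists_between ht.1
  obtain ⟨d, hd1, hd2⟩ := exists_between ht.2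
  have hI : ∀ s ∈ Ioo a b, HasDerivAt (fun s => ∫ r in c..s, g r) (g s) s := by
    intro s hs
    have hcs : uIcc c s ⊆ Ioo a b := by
      intro r hr
      rcases uIcc_subset_uIcc (a₂ := c ⊓ s) (b₂ := c ⊔ s) (by simp [mem_uIcc]) (by simp [mem_uIcc]) hr
        with hr
      rw [uIcc_of_le (inf_le_sup), mem_Icc] at hr
      exact ⟨lt_of_lt_of_le (lt_min hc1 hs.1) hr.1, lt_of_le_of_lt hr.2 (max_lt (hc2.trans ht.2) hs.2)⟩
    refine intervalIntegral.integral_hasDerivAt_right (hg.mono hcs).intervalIntegrable ?_ ?_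
    · exact hg.stronglyMeasurableAtFilter isOpen_Ioo s hs
    · exact hg.continuousAt (isOpen_Ioo.mem_nhds hs)
  have hsub : Icc c d ⊆ Ioo a b := fun s hs => ⟨hc1.trans_le hs.1, hs.2.trans_lt hd2⟩
  have hconst := constant_of_has_deriv_right_zero (f := fun s => f s - ∫ r in c..s, g r) (a := c) (b := d)
    (fun s hs => ((hf.mono hsub) s hs).sub (hI s (hsub hs)).continuousAt.continuousWithinAt)
    (fun s hs => by
      have hs' := hsub (Ico_subset_Icc_self hs)
      have := (h s hs').sub (hI s hs').hasDerivWithinAt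
      rw [sub_self] at this
      exact this)
  have h2 : HasDerivAt (fun s => (f c - ∫ r in c..c, g r) + ∫ r in c..s, g r) (g t) t :=
    (hI t ht).const_add _
  refine h2.congr_of_eventuallyEq ?_
  filter_upwards [Ioo_mem_nhds hc2 hd1] with s hs
  have := hconst s (Ioo_subset_Icc_self hs)
  linarith

/-- Time derivative of a mild solution. -/
lemma IsMild.hasDerivAt {a b W W1 W2 M : ℝ} {w F : ℝ → EN N → ℝ} (h : IsMild a b w F W M)
    (h1 : CB (Ioo a b) (gr w) W1) (h2 : CB (Ioo a b) (gr (gr w)) W2)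
    (hd : ∀ t ∈ Ioo a b, ∀ x, HasFDerivAt (gr w t) (gr (gr w) t x) x) {t : ℝ} (ht : t ∈ Ioo a b)
    (x : EN N) : HasDerivAt (fun s => w s x) (trL N (gr (gr w) t x) + F t x) t := by
  have sl : ∀ {H : Type} [TopologicalSpace H] (f : ℝ → EN N → H),
      ContinuousOn (fun p : ℝ × EN N => f p.1 p.2) (Ioo a b ×ˢ univ) →
      ContinuousOn (fun s => f s x) (Ioo a b) := fun f hf =>
    hf.comp (f := fun s => (s, x)) (by fun_prop) fun s hs => ⟨hs, mem_univ _⟩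
  refine hasDerivAt_of_right (a := a) (b := b) (g := fun t => trL N (gr (gr w) t x) + F t x)
    (sl _ h.hw.cont) (((trL N).continuous.comp_continuousOn (sl _ h2.cont)).add (sl _ h.hF.cont))
    ?_ t ht
  intro t ht
  have e1 := (P_hasDeriv_zero (fun y => h.hasFDerivAt ht y) (hd t ht) (h2.slice ht) (h.hw.bd t ht)
    (h1.bd t ht) (h2.bd t ht) x).add (D_hasDeriv_zero h.hF ht x)
  have e2 : HasDerivWithinAt (fun r => w (t + r) x) (trL N (gr (gr w) t x) + F t x) (Ici 0) 0 := by
    refine e1.congr_of_eventuallyEq ?_ ?_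
    · have : Ico 0 (b - t) ∈ nhdsWithin (0:ℝ) (Ici 0) := Ico_mem_nhdsGE (by linarith [ht.2])
      filter_upwards [this] with r hr
      rcases eq_or_lt_of_le hr.1 with h0 | h0
      · subst h0; simp [P_zero, D]
      · have := h.eq t (t + r) ht.1 (by linarith) (by linarith [hr.2]) x
        rw [add_sub_cancel_left] at this
        exact this
    · simp [P_zero, D]
  have e3 := e2.scomp_of_eq (x := t) (h := fun s => s - t) (h' := 1) (s := Ici t)
    ((hasDerivAt_id t).sub_const t).hasDerivWithinAt
    (fun s hs => by simpa using hs) (by simp)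
  simpa [Function.comp_def] using e3

end

end HeatW

namespace HeatW

lemma pt_aux (n : ℕ) {p w y : ℝ} (hp : 0 ≤ p) (hw : 0 ≤ w) (hwp : w ≤ p) (hy : y ^ 2 ≤ 4 * p * w)
    (h1 : 0 ≤ p + y) (h2 : 0 ≤ p - y) :
    ((p + y) ^ n + (p - y) ^ n) / 2 ≤ (p + Real.exp (2 * n) * w) ^ n := by
  rcases eq_or_lt_of_le hp with h0 | h0
  · have hw0 : w = 0 := by linarith
    have hy0 : y = 0 := by
      have : y ^ 2 ≤ 0 := by rw [hw0] at hy; linarith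
      nlinarith
    subst hw0; subst hy0; simp
  · have e1 : (p + y) ^ n ≤ p ^ n * Real.exp (n * (y / p)) := by
      rw [Real.exp_nat_mul, ← mul_pow]
      have := Real.add_one_le_exp (y / p)
      refine pow_le_pow_left₀ h1 ?_ n
      calc p + y = p * (y / p + 1) := by field_simp; ring
        _ ≤ _ := by gcongr
    have e2 : (p - y) ^ n ≤ p ^ n * Real.exp (-(n * (y / p))) := by
      rw [show -(n * (y / p)) = n * (-(y / p)) by ring, Real.exp_nat_mul, ← mul_pow]
      have := Real.add_one_le_exp (-(y / p))
      refine pow_le_pow_left₀ h2 ?_ n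
      calc p - y = p * (-(y / p) + 1) := by field_simp; ring
        _ ≤ _ := by gcongr
    have e3 : ((p + y) ^ n + (p - y) ^ n) / 2 ≤ p ^ n * Real.cosh (n * (y / p)) := by
      rw [Real.cosh_eq]
      linarith
    have e4 := Real.cosh_le_exp_half_sq (n * (y / p))
    have hs : 0 ≤ w / p := by positivity
    have hs1 : w / p ≤ 1 := by rw [div_le_one h0]; exact hwp
    have e5 : (n * (y / p)) ^ 2 / 2 ≤ n * (2 * n * (w / p)) := by
      have : (y / p) ^ 2 ≤ 4 * (w / p) := by
        rw [div_pow, div_le_iff₀ (by positivity)]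
        calc y ^ 2 ≤ 4 * p * w := hy
          _ = _ := by field_simp
      nlinarith [sq_nonneg (n : ℝ)]
    have e6 : Real.exp (2 * n * (w / p)) ≤ 1 + Real.exp (2 * n) * (w / p) := by
      have hc := convexOn_exp.2 (mem_univ (0:ℝ)) (mem_univ (2 * n : ℝ))
        (by linarith : 0 ≤ 1 - w / p) hs (by ring)
      simp only [smul_eq_mul, mul_zero, zero_add, Real.exp_zero, mul_one] at hc
      rw [mul_comm (w / p)] at hc
      nlinarith
    calc _ ≤ p ^ n * Real.cosh (n * (y / p)) := e3
      _ ≤ p ^ n * Real.exp (n * (2 * n * (w / p))) := by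
        gcongr; exact e4.trans (Real.exp_le_exp.2 e5)
      _ = (p * Real.exp (2 * n * (w / p))) ^ n := by rw [Real.exp_nat_mul, mul_pow]
      _ ≤ (p * (1 + Real.exp (2 * n) * (w / p))) ^ n := by gcongr
      _ = _ := by congr 1; field_simp

lemma pt_aux2 (n : ℕ) {q s ζ : ℝ} (hq : 0 ≤ q) (hs : 0 ≤ s) (h0 : 0 < q + s) (hζ : 0 ≤ ζ) :
    (q + s * ζ) ^ n ≤ (q + s) ^ n * (q / (q + s) + s / (q + s) * ζ ^ n) := by
  have hc := (convexOn_pow (𝕜 := ℝ) n).2 (show (1:ℝ) ∈ Ici 0 by simp) (show ζ ∈ Ici 0 by simpa using hζ)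
    (by positivity : 0 ≤ q / (q + s)) (by positivity : 0 ≤ s / (q + s)) (by field_simp)
  simp only [smul_eq_mul, one_pow, mul_one] at hc
  calc (q + s * ζ) ^ n = (q + s) ^ n * (q / (q + s) + s / (q + s) * ζ) ^ n := by
        rw [← mul_pow]; congr 1; field_simp
    _ ≤ _ := by gcongr

lemma integrable_poly {N : ℕ} (n : ℕ) (q s : ℝ) :
    Integrable (fun z : EN N => (q + s * ‖z‖ ^ 2) ^ n) (gm N) := by
  simp_rw [add_pow]
  refine integrable_finset_sum _ fun k _ => ?_
  have := ((integrable_pow_gm (N := N) (2 * (n - k))).const_mul (q ^ k * s ^ (n - k))).mul_const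
    (n.choose k : ℝ)
  refine this.congr (Eventually.of_forall fun z => ?_)
  simp only [mul_pow, ← pow_mul]; ring

lemma integrable_shift_poly {N : ℕ} (n : ℕ) {a : ℝ} (ha : 0 ≤ a) (c : ℝ) (x : EN N) :
    Integrable (fun z : EN N => (a + ‖x + c • z‖ ^ 2) ^ n) (gm N) := by
  refine (integrable_poly n (a + 2 * ‖x‖ ^ 2) (2 * c ^ 2)).mono'
    (Continuous.aestronglyMeasurable (by fun_prop)) (Eventually.of_forall fun z => ?_)
  rw [Real.norm_of_nonneg (by positivity)]
  have h1 : ‖x + c • z‖ ≤ ‖x‖ + |c| * ‖z‖ := by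
    refine (norm_add_le _ _).trans ?_
    rw [norm_smul, Real.norm_eq_abs]
  refine pow_le_pow_left₀ (by positivity) ?_ n
  have h2 : ‖x + c • z‖ ^ 2 ≤ (‖x‖ + |c| * ‖z‖) ^ 2 := by gcongr
  have h3 : (|c| * ‖z‖) ^ 2 = c ^ 2 * ‖z‖ ^ 2 := by rw [mul_pow, sq_abs]
  nlinarith [sq_nonneg (‖x‖ - |c| * ‖z‖)]

lemma moment (N n : ℕ) : ∃ B : ℝ, 1 ≤ B ∧ ∀ a σ : ℝ, 0 ≤ a → 0 ≤ σ → ∀ x : EN N,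
    P σ (fun y => (a + ‖y‖ ^ 2) ^ n) x ≤ (a + B * σ + ‖x‖ ^ 2) ^ n := by
  set M := ∫ z, (‖z‖ ^ 2) ^ n ∂(gm N) with hM
  have hM0 : 0 ≤ M := integral_nonneg fun z => by positivity
  set c := 1 + Real.exp (2 * n) with hc
  have hc1 : 1 ≤ c := by rw [hc]; linarith [Real.exp_pos (2 * n : ℝ)]
  refine ⟨c * (1 + M), by nlinarith, fun a σ ha hσ x => ?_⟩
  unfold P
  set q := a + ‖x‖ ^ 2 with hq
  have hq0 : 0 ≤ q := by positivity
  have hsq : √σ ^ 2 = σ := Real.sq_sqrt hσ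
  -- symmetrize
  have hsym : ∫ z, (a + ‖x + √σ • z‖ ^ 2) ^ n ∂(gm N) ≤ ∫ z, (q + c * σ * ‖z‖ ^ 2) ^ n ∂(gm N) := by
    have i1 := integrable_shift_poly n ha (√σ) x
    have i2 := integrable_shift_poly n ha (-√σ) x
    have e1 : ∫ z, (a + ‖x + (-√σ) • z‖ ^ 2) ^ n ∂(gm N) = ∫ z, (a + ‖x + √σ • z‖ ^ 2) ^ n ∂(gm N) := by
      rw [← integral_gm_neg]; simp
    have e2 : ∫ z, (a + ‖x + √σ • z‖ ^ 2) ^ n ∂(gm N) =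
        ∫ z, ((a + ‖x + √σ • z‖ ^ 2) ^ n + (a + ‖x + (-√σ) • z‖ ^ 2) ^ n) / 2 ∂(gm N) := by
      rw [integral_div, integral_add i1 i2, e1]; ring
    rw [e2]
    refine integral_mono ((i1.add i2).div_const 2) (integrable_poly n _ _) fun z => ?_
    have hn1 : ‖x + √σ • z‖ ^ 2 = ‖x‖ ^ 2 + σ * ‖z‖ ^ 2 + 2 * √σ * inner ℝ x z := by
      rw [norm_add_sq_real, norm_smul, inner_smul_right, mul_pow, Real.norm_eq_abs, sq_abs, hsq]; ring
    have hn2 : ‖x + (-√σ) • z‖ ^ 2 = ‖x‖ ^ 2 + σ * ‖z‖ ^ 2 - 2 * √σ * inner ℝ x z := by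
      rw [norm_add_sq_real, norm_smul, inner_smul_right, mul_pow, Real.norm_eq_abs, sq_abs, neg_sq, hsq]; ring
    set y := 2 * √σ * inner ℝ x z with hy
    have f1 : a + ‖x + √σ • z‖ ^ 2 = (q + σ * ‖z‖ ^ 2) + y := by rw [hn1, hq]; ring
    have f2 : a + ‖x + (-√σ) • z‖ ^ 2 = (q + σ * ‖z‖ ^ 2) - y := by rw [hn2, hq]; ring
    have hw0 : 0 ≤ σ * ‖z‖ ^ 2 := by positivity
    have hy2 : y ^ 2 ≤ 4 * (q + σ * ‖z‖ ^ 2) * (σ * ‖z‖ ^ 2) := by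
      have hi : (inner ℝ x z : ℝ) ^ 2 ≤ (‖x‖ * ‖z‖) ^ 2 := by
        rw [sq_le_sq, abs_of_nonneg (by positivity : 0 ≤ ‖x‖ * ‖z‖)]
        exact abs_real_inner_le_norm x z
      have : y ^ 2 = 4 * σ * (inner ℝ x z) ^ 2 := by rw [hy, mul_pow, mul_pow, hsq]; ring
      have h3 : ‖x‖ ^ 2 ≤ q := by rw [hq]; linarith
      calc y ^ 2 ≤ 4 * σ * (‖x‖ * ‖z‖) ^ 2 := by rw [this]; gcongr
        _ = 4 * ‖x‖ ^ 2 * (σ * ‖z‖ ^ 2) := by ring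
        _ ≤ _ := by gcongr; linarith
    simp only [f1, f2]
    have := pt_aux n (p := q + σ * ‖z‖ ^ 2) (w := σ * ‖z‖ ^ 2) (y := y) (by positivity) hw0
      (by linarith) hy2 (by rw [← f1]; positivity) (by rw [← f2]; positivity)
    refine this.trans (le_of_eq ?_)
    congr 1; rw [hc]; ring
  refine hsym.trans ?_
  set s := c * σ with hs
  have hs0 : 0 ≤ s := by positivity
  rcases Nat.eq_zero_or_pos n with hn | hn
  · subst hn; simp
  rcases eq_or_lt_of_le (add_nonneg hq0 hs0) with h0 | h0
  · have hq' : q = 0 := by linarith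
    have hs' : s = 0 := by linarith
    simp only [hq', hs', zero_mul, add_zero]
    rw [zero_pow hn.ne']; simp; positivity
  · calc _ ≤ ∫ z, (q + s) ^ n * (q / (q + s) + s / (q + s) * (‖z‖ ^ 2) ^ n) ∂(gm N) := by
          refine integral_mono (integrable_poly n _ _) ?_ fun z => pt_aux2 n hq0 hs0 h0 (by positivity)
          have i0 : Integrable (fun z : EN N => (‖z‖ ^ 2) ^ n) (gm N) := by
            simpa using integrable_poly (N := N) n 0 1
          exact ((integrable_const _).add (i0.const_mul _)).const_mul _
      _ = (q + s) ^ n * (q / (q + s) + s / (q + s) * M) := by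
          have i0 : Integrable (fun z : EN N => (‖z‖ ^ 2) ^ n) (gm N) := by
            simpa using integrable_poly (N := N) n 0 1
          rw [integral_const_mul, integral_add (integrable_const _) (i0.const_mul _),
            integral_const_mul, ← hM]
          simp
      _ ≤ (q + s) ^ n * (1 + s / (q + s) * M) ^ n := by
          have hl : q / (q + s) ≤ 1 := by rw [div_le_one h0]; linarith
          have h1 : 1 ≤ 1 + s / (q + s) * M := by
            have : 0 ≤ s / (q + s) * M := by positivity
            linarith
          gcongr
          calc _ ≤ 1 + s / (q + s) * M := by linarith
            _ ≤ _ := le_self_pow₀ h1 hn.ne'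
      _ = _ := by
          rw [← mul_pow]; congr 1
          field_simp; rw [hs, hq]; ring

end HeatW

namespace HeatW

section
variable {N : ℕ}

lemma D_sub {S : Set ℝ} {F F' : ℝ → EN N → ℝ} {M M' : ℝ} (h : CB S F M) (h' : CB S F' M') {τ t : ℝ}
    (hτ : τ ≤ t) (hS : Ioc τ t ⊆ S) (x : EN N) :
    D (fun s y => F s y - F' s y) τ t x = D F τ t x - D F' τ t x := by
  unfold D
  rw [← intervalIntegral.integral_sub (P_ii h hτ hS t x) (P_ii h' hτ hS t x)]
  rw [intervalIntegral.integral_of_le hτ, intervalIntegral.integral_of_le hτ]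
  refine setIntegral_congr_fun measurableSet_Ioc fun s hs => ?_
  exact integral_sub (int_shift (h.slice (hS hs)).stronglyMeasurable (h.bd s (hS hs)) x _)
    (int_shift (h'.slice (hS hs)).stronglyMeasurable (h'.bd s (hS hs)) x _)

/-- The weight. -/
noncomputable def wt (A K : ℝ) (m : ℕ) (t : ℝ) (x : EN N) : ℝ := Real.exp (K * t) * (A * t + ‖x‖ ^ 2) ^ m

/-- The Lipschitz weight. -/
noncomputable def Lw (C₁ : ℝ) (t : ℝ) (x : EN N) : ℝ := C₁ / (t + ‖x‖ ^ 2) + C₁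

lemma Lw_wt_le {C₁ A K : ℝ} (k : ℕ) (hC : 0 ≤ C₁) (hA : 1 ≤ A) {t : ℝ} (ht : 0 < t) (x : EN N) :
    Lw C₁ t x * wt A K (k + 1) t x ≤ Real.exp (K * t) *
      (C₁ * A * (A * t + ‖x‖ ^ 2) ^ k + C₁ * (A * t + ‖x‖ ^ 2) ^ (k + 1)) := by
  unfold Lw wt
  have h0 : 0 < t + ‖x‖ ^ 2 := by positivity
  have h1 : A * t + ‖x‖ ^ 2 ≤ A * (t + ‖x‖ ^ 2) := by nlinarith [sq_nonneg ‖x‖]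
  have h2 : C₁ / (t + ‖x‖ ^ 2) * (A * t + ‖x‖ ^ 2) ≤ C₁ * A := by
    calc _ ≤ C₁ / (t + ‖x‖ ^ 2) * (A * (t + ‖x‖ ^ 2)) := by gcongr
      _ = _ := by field_simp
  have h3 : C₁ / (t + ‖x‖ ^ 2) * (A * t + ‖x‖ ^ 2) ^ (k + 1) ≤ C₁ * A * (A * t + ‖x‖ ^ 2) ^ k := by
    rw [pow_succ (A * t + ‖x‖ ^ 2) k]
    calc _ = C₁ / (t + ‖x‖ ^ 2) * (A * t + ‖x‖ ^ 2) * (A * t + ‖x‖ ^ 2) ^ k := by ring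
      _ ≤ _ := by gcongr
  calc _ = Real.exp (K * t) * (C₁ / (t + ‖x‖ ^ 2) * (A * t + ‖x‖ ^ 2) ^ (k + 1) +
      C₁ * (A * t + ‖x‖ ^ 2) ^ (k + 1)) := by ring
    _ ≤ _ := by gcongr

lemma P_weight {C₁ B K R A : ℝ} {k : ℕ} (hC : 0 ≤ C₁) (hB : 1 ≤ B) (hA : A = 2 * B)
    (hk : ∀ a σ : ℝ, 0 ≤ a → 0 ≤ σ → ∀ x : EN N,
      P σ (fun y => (a + ‖y‖ ^ 2) ^ k) x ≤ (a + B * σ + ‖x‖ ^ 2) ^ k)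
    (hk1 : ∀ a σ : ℝ, 0 ≤ a → 0 ≤ σ → ∀ x : EN N,
      P σ (fun y => (a + ‖y‖ ^ 2) ^ (k + 1)) x ≤ (a + B * σ + ‖x‖ ^ 2) ^ (k + 1))
    (hK0 : 0 < K) (hR : 0 ≤ R) {F : ℝ → EN N → ℝ}
    (hF : ∀ s, 0 < s → ∀ y, |F s y| ≤ R * (Lw C₁ s y * wt A K (k + 1) s y)) {t : ℝ}
    (x : EN N) (s : ℝ) (hs : s ∈ Ioc 0 t) :
    |P (t - s) (F s) x| ≤ R * (Real.exp (K * t) * (C₁ * A) * (B * (t + s) + ‖x‖ ^ 2) ^ k +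
      Real.exp (K * s) * (C₁ * (A * t + ‖x‖ ^ 2) ^ (k + 1))) := by
  have hs0 := hs.1
  have hA0 : 0 ≤ A := by linarith
  have hA1 : 1 ≤ A := by linarith
  have i1 := integrable_shift_poly k (mul_nonneg hA0 hs0.le) (√(t - s)) x
  have i2 := integrable_shift_poly (k + 1) (mul_nonneg hA0 hs0.le) (√(t - s)) x
  have h1 : |P (t - s) (F s) x| ≤ ∫ z, R * (Real.exp (K * s) *
    (C₁ * A * (A * s + ‖x + √(t - s) • z‖ ^ 2) ^ k +
      C₁ * (A * s + ‖x + √(t - s) • z‖ ^ 2) ^ (k + 1))) ∂(gm N) := by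
    rw [← Real.norm_eq_abs]
    refine norm_integral_le_of_norm_le ?_ (Eventually.of_forall fun z => ?_)
    · exact (((i1.const_mul _).add (i2.const_mul _)).const_mul _).const_mul _
    · refine (hF s hs0 _).trans ?_
      exact mul_le_mul_of_nonneg_left (Lw_wt_le k hC hA1 hs0 _) hR
  refine h1.trans ?_
  rw [integral_const_mul, integral_const_mul, integral_add (i1.const_mul _) (i2.const_mul _),
    integral_const_mul, integral_const_mul]
  have hts : 0 ≤ t - s := by linarith [hs.2]
  have e1 := hk (A * s) (t - s) (by positivity) hts x
  have e2 := hk1 (A * s) (t - s) (by positivity) hts x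
  unfold P at e1 e2
  rw [show A * s + B * (t - s) + ‖x‖ ^ 2 = B * (t + s) + ‖x‖ ^ 2 by rw [hA]; ring] at e1 e2
  have e3 : B * (t + s) + ‖x‖ ^ 2 ≤ A * t + ‖x‖ ^ 2 := by rw [hA]; nlinarith [hs.2]
  have ht : 0 < t := hs0.trans_le hs.2
  have e4 : (B * (t + s) + ‖x‖ ^ 2) ^ (k + 1) ≤ (A * t + ‖x‖ ^ 2) ^ (k + 1) :=
    pow_le_pow_left₀ (by positivity) e3 _
  have e5 : Real.exp (K * s) ≤ Real.exp (K * t) :=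
    Real.exp_le_exp.2 (mul_le_mul_of_nonneg_left hs.2 hK0.le)
  refine mul_le_mul_of_nonneg_left ?_ hR
  rw [mul_add]
  refine add_le_add ?_ ?_
  · rw [mul_assoc (Real.exp (K * t))]
    refine mul_le_mul e5 (mul_le_mul_of_nonneg_left e1 (by positivity)) ?_ (by positivity)
    exact mul_nonneg (by positivity) (integral_nonneg fun z => by positivity)
  · exact mul_le_mul_of_nonneg_left (mul_le_mul_of_nonneg_left (e2.trans e4) hC) (by positivity)

lemma D_weight {C₁ B K R : ℝ} {k : ℕ} (hC : 0 ≤ C₁) (hB : 1 ≤ B)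
    (hk : ∀ a σ : ℝ, 0 ≤ a → 0 ≤ σ → ∀ x : EN N,
      P σ (fun y => (a + ‖y‖ ^ 2) ^ k) x ≤ (a + B * σ + ‖x‖ ^ 2) ^ k)
    (hk1 : ∀ a σ : ℝ, 0 ≤ a → 0 ≤ σ → ∀ x : EN N,
      P σ (fun y => (a + ‖y‖ ^ 2) ^ (k + 1)) x ≤ (a + B * σ + ‖x‖ ^ 2) ^ (k + 1))
    (hm : 8 * C₁ ≤ (k + 1 : ℕ)) (hK : 4 * C₁ ≤ K) (hK0 : 0 < K) (hR : 0 ≤ R)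
    {F : ℝ → EN N → ℝ}
    (hF : ∀ s, 0 < s → ∀ y, |F s y| ≤ R * (Lw C₁ s y * wt (2 * B) K (k + 1) s y)) {t : ℝ} (ht : 0 < t)
    (x : EN N) : |D F 0 t x| ≤ R / 2 * wt (2 * B) K (k + 1) t x := by
  have hP := P_weight (t := t) hC hB rfl hk hk1 hK0 hR hF x
  generalize hq : ‖x‖ ^ 2 = q at hP
  have hq0 : 0 ≤ q := by rw [← hq]; positivity
  generalize hA : 2 * B = A at hP hF ⊢
  have hA0 : 0 ≤ A := by linarith
  set H : ℝ → ℝ := fun s => R * (Real.exp (K * t) * (C₁ * A) * ((B * (t + s) + q) ^ (k + 1) / (B * (k + 1 : ℕ))) +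
      Real.exp (K * s) / K * (C₁ * (A * t + q) ^ (k + 1))) with hH
  have hd : ∀ s : ℝ, HasDerivAt H (R * (Real.exp (K * t) * (C₁ * A) * (B * (t + s) + q) ^ k +
      Real.exp (K * s) * (C₁ * (A * t + q) ^ (k + 1)))) s := by
    intro s
    have d1 : HasDerivAt (fun s => B * (t + s) + q) B s := by
      simpa using (((hasDerivAt_id s).const_add t).const_mul B).add_const q
    have d2 := ((d1.pow (k + 1)).div_const (B * (k + 1 : ℕ))).const_mul (Real.exp (K * t) * (C₁ * A))
    have d3 : HasDerivAt (fun s => Real.exp (K * s)) (Real.exp (K * s) * K) s := by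
      simpa using ((hasDerivAt_id s).const_mul K).exp
    have d4 := ((d3.div_const K).mul_const (C₁ * (A * t + q) ^ (k + 1)))
    have := (d2.add d4).const_mul R
    refine this.congr_deriv ?_
    have hk0 : ((k + 1 : ℕ) : ℝ) ≠ 0 := by positivity
    simp only [Nat.add_sub_cancel]
    field_simp
  have hcont : Continuous fun s => (R * (Real.exp (K * t) * (C₁ * A) * (B * (t + s) + q) ^ k +
      Real.exp (K * s) * (C₁ * (A * t + q) ^ (k + 1)))) := by fun_prop
  have h2 : |D F 0 t x| ≤ H t - H 0 := by
    rw [← intervalIntegral.integral_eq_sub_of_hasDerivAt (fun s _ => hd s)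
      (hcont.intervalIntegrable _ _), ← Real.norm_eq_abs]
    unfold D
    exact intervalIntegral.norm_integral_le_of_norm_le ht.le
      (Eventually.of_forall fun s hs => hP s hs) (hcont.intervalIntegrable _ _)
  have h3 : 0 ≤ H 0 := by
    simp only [hH]; positivity
  refine (h2.trans (sub_le_self _ h3)).trans ?_
  simp only [hH]
  unfold wt
  rw [hq]
  have e6 : B * (t + t) + q = A * t + q := by rw [← hA]; ring
  rw [e6]
  set Y := (A * t + q) ^ (k + 1)
  have hY : 0 ≤ Y := by positivity
  set E := Real.exp (K * t)
  have hE : 0 < E := Real.exp_pos _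
  have hk0 : (0:ℝ) < ((k + 1 : ℕ) : ℝ) := by positivity
  have a1 : C₁ * A / (B * (k + 1 : ℕ)) ≤ 1 / 4 := by
    rw [div_le_iff₀ (by positivity), ← hA]
    nlinarith
  have a2 : C₁ / K ≤ 1 / 4 := by
    rw [div_le_iff₀ hK0]; linarith
  calc _ = R * (E * Y) * (C₁ * A / (B * (k + 1 : ℕ)) + C₁ / K) := by field_simp
    _ ≤ R * (E * Y) * (1 / 4 + 1 / 4) := by gcongr
    _ = _ := by ring

/-- The space-time domain. -/
abbrev Dom (N : ℕ) : Set (ℝ × EN N) := Ioi (0:ℝ) ×ˢ (univ : Set (EN N))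

open BoundedContinuousFunction in
/-- Abstract fixed point. -/
lemma fixedPoint {C₁ C₂ M₀ : ℝ} {B K : ℝ} {k : ℕ} (hC : 0 ≤ C₁) (hC2 : 0 ≤ C₂) (hM0 : 0 ≤ M₀) (hB : 1 ≤ B)
    (hk : ∀ a σ : ℝ, 0 ≤ a → 0 ≤ σ → ∀ x : EN N,
      P σ (fun y => (a + ‖y‖ ^ 2) ^ k) x ≤ (a + B * σ + ‖x‖ ^ 2) ^ k)
    (hk1 : ∀ a σ : ℝ, 0 ≤ a → 0 ≤ σ → ∀ x : EN N,
      P σ (fun y => (a + ‖y‖ ^ 2) ^ (k + 1)) x ≤ (a + B * σ + ‖x‖ ^ 2) ^ (k + 1))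
    (hm : 8 * C₁ ≤ (k + 1 : ℕ)) (hK : 4 * C₁ ≤ K) (hK0 : 0 < K)
    {Φ : ℝ → EN N → ℝ → ℝ}
    (hΦc : ContinuousOn (fun p : (ℝ × EN N) × ℝ => Φ p.1.1 p.1.2 p.2) (Dom N ×ˢ univ))
    (hΦL : ∀ t, 0 < t → ∀ x v v', |Φ t x v - Φ t x v'| ≤ Lw C₁ t x * |v - v'|)
    (hΦ0 : ∀ t, 0 < t → ∀ x, |Φ t x 0| ≤ C₂ * (Lw C₁ t x * wt (2 * B) K (k + 1) t x))
    (hΦM : ∀ t, 0 < t → ∀ x, 1 ≤ t + ‖x‖ ^ 2 → ∀ v, |Φ t x v| ≤ M₀) :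
    ∃ v : ℝ → EN N → ℝ, ∃ M, CB (Ioi 0) (fun t x => Φ t x (v t x)) M ∧
      ∀ t, 0 < t → ∀ x, v t x = D (fun t x => Φ t x (v t x)) 0 t x := by
  set φ : ℝ → EN N → ℝ := wt (2 * B) K (k + 1) with hφ
  have hφpos : ∀ t, 0 < t → ∀ x, 0 < φ t x := fun t ht x => by
    rw [hφ]; unfold wt; positivity
  have hφc : Continuous fun p : ℝ × EN N => φ p.1 p.2 := by
    rw [hφ]; unfold wt; fun_prop
  have hL0 : ∀ t, 0 < t → ∀ x : EN N, 0 ≤ Lw C₁ t x := fun t ht x => by unfold Lw; positivity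
  let X := Dom N →ᵇ ℝ
  let vb : X → ℝ → EN N → ℝ := fun b t x => φ t x * (if h : (t, x) ∈ Dom N then b ⟨(t, x), h⟩ else 0)
  let Fb : X → ℝ → EN N → ℝ := fun b t x => Φ t x (vb b t x)
  have hvc : ∀ b : X, ContinuousOn (fun p : ℝ × EN N => vb b p.1 p.2) (Dom N) := by
    intro b
    refine hφc.continuousOn.mul ?_
    rw [continuousOn_iff_continuous_restrict]
    refine b.continuous.congr fun p => ?_
    have hp := p.2
    simp only [Set.restrict_apply]
    rw [dif_pos hp]
  have hv : ∀ (b : X) t (ht : 0 < t) x, vb b t x = φ t x * b ⟨(t, x), ⟨ht, mem_univ _⟩⟩ := by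
    intro b t ht x
    show φ t x * _ = _
    rw [dif_pos (show (t, x) ∈ Dom N from ⟨ht, mem_univ _⟩)]
  have hvb : ∀ (b : X) t, 0 < t → ∀ x, |vb b t x| ≤ ‖b‖ * φ t x := by
    intro b t ht x
    rw [hv b t ht, abs_mul, abs_of_pos (hφpos t ht x), mul_comm]
    have := (hφpos t ht x).le
    gcongr
    exact b.norm_coe_le_norm _
  have hFb : ∀ (b : X) t, 0 < t → ∀ x, |Fb b t x| ≤ (C₂ + ‖b‖) * (Lw C₁ t x * φ t x) := by
    intro b t ht x
    have h1 := hΦL t ht x (vb b t x) 0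
    have h2 := hΦ0 t ht x
    have h3 := hvb b t ht x
    rw [sub_zero] at h1
    have h4 : |Φ t x (vb b t x)| ≤ |Φ t x 0| + |Φ t x (vb b t x) - Φ t x 0| := by
      have := abs_add_le (Φ t x 0) (Φ t x (vb b t x) - Φ t x 0)
      simpa using this
    have h5 : Lw C₁ t x * |vb b t x| ≤ Lw C₁ t x * (‖b‖ * φ t x) :=
      mul_le_mul_of_nonneg_left h3 (hL0 t ht x)
    show |Φ t x (vb b t x)| ≤ _
    calc _ ≤ _ := h4
      _ ≤ C₂ * (Lw C₁ t x * φ t x) + Lw C₁ t x * (‖b‖ * φ t x) := add_le_add h2 (h1.trans h5)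
      _ = _ := by ring
  have hCB : ∀ b : X, ∃ M, CB (Ioi 0) (Fb b) M := by
    intro b
    refine ⟨M₀ + (C₂ + ‖b‖) * (Real.exp K * (C₁ * (2 * B) * (2 * B + 1) ^ k + C₁ * (2 * B + 1) ^ (k + 1))),
      ?_, ?_⟩
    · exact hΦc.comp (f := fun p : ℝ × EN N => (p, vb b p.1 p.2)) (continuousOn_id.prodMk (hvc b))
        fun p hp => ⟨hp, mem_univ _⟩
    · intro t ht x
      have ht' : 0 < t := ht
      rw [Real.norm_eq_abs]
      have hn : 0 ≤ (C₂ + ‖b‖) * (Real.exp K * (C₁ * (2 * B) * (2 * B + 1) ^ k + C₁ * (2 * B + 1) ^ (k + 1))) := by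
        positivity
      rcases le_total 1 (t + ‖x‖ ^ 2) with h1 | h1
      · have := hΦM t ht x h1 (vb b t x)
        show |Φ t x (vb b t x)| ≤ _
        linarith
      · refine (hFb b t ht x).trans ?_
        have h2 := Lw_wt_le (C₁ := C₁) (A := 2 * B) (K := K) k hC (by linarith) ht' x
        have h3 : Lw C₁ t x * φ t x ≤ Real.exp K * (C₁ * (2 * B) * (2 * B + 1) ^ k + C₁ * (2 * B + 1) ^ (k + 1)) := by
          refine h2.trans ?_
          have t1 : t ≤ 1 := by nlinarith [sq_nonneg ‖x‖]
          have x1 : ‖x‖ ^ 2 ≤ 1 := by linarith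
          have e1 : 2 * B * t + ‖x‖ ^ 2 ≤ 2 * B + 1 := by nlinarith
          have e2 : K * t ≤ K := by nlinarith
          gcongr
        have : (C₂ + ‖b‖) * (Lw C₁ t x * φ t x) ≤ (C₂ + ‖b‖) * (Real.exp K * (C₁ * (2 * B) * (2 * B + 1) ^ k + C₁ * (2 * B + 1) ^ (k + 1))) := by
          gcongr
        linarith
  have hDb : ∀ (b : X) t, 0 < t → ∀ x, |D (Fb b) 0 t x| ≤ (C₂ + ‖b‖) / 2 * φ t x := by
    intro b t ht x
    exact D_weight hC hB hk hk1 hm hK hK0 (by positivity) (hFb b) ht x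
  have hsub0 : ∀ t : ℝ, Ioc 0 t ⊆ Ioi 0 := fun t s hs => hs.1
  have hDc : ∀ b : X, ContinuousOn (fun p : ℝ × EN N => D (Fb b) 0 p.1 p.2 / φ p.1 p.2) (Dom N) := by
    intro b
    obtain ⟨M, hM⟩ := hCB b
    exact (D_contOn hM fun t ht => ⟨ht, hsub0 t⟩).div hφc.continuousOn fun p hp => (hφpos _ hp.1 _).ne'
  let Ψ : X → X := fun b => BoundedContinuousFunction.ofNormedAddCommGroup
    (fun p : Dom N => D (Fb b) 0 p.1.1 p.1.2 / φ p.1.1 p.1.2)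
    (continuousOn_iff_continuous_restrict.1 (hDc b)) ((C₂ + ‖b‖) / 2) (fun p => by
      have hp := hφpos p.1.1 p.2.1 p.1.2
      rw [Real.norm_eq_abs, abs_div, abs_of_pos hp, div_le_iff₀ hp]
      exact hDb b _ p.2.1 _)
  have hΨ : ContractingWith (1 / 2 : NNReal) Ψ := by
    refine ⟨by rw [← NNReal.coe_lt_coe]; norm_num, LipschitzWith.of_dist_le_mul fun b b' => ?_⟩
    rw [BoundedContinuousFunction.dist_le (by positivity)]
    intro p
    obtain ⟨⟨t, x⟩, ht, hx⟩ := p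
    have ht' : 0 < t := ht
    have hp := hφpos t ht' x
    obtain ⟨M, hM⟩ := hCB b
    obtain ⟨M', hM'⟩ := hCB b'
    show dist (D (Fb b) 0 t x / φ t x) (D (Fb b') 0 t x / φ t x) ≤ _
    rw [Real.dist_eq, ← sub_div, abs_div, abs_of_pos hp, div_le_iff₀ hp,
      ← D_sub hM hM' ht'.le (hsub0 t) x]
    have := D_weight (F := fun s y => Fb b s y - Fb b' s y) (R := dist b b') hC hB hk hk1 hm hK hK0
      dist_nonneg (fun s hs y => ?_) ht' x
    · refine this.trans (le_of_eq ?_)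
      push_cast; ring
    · refine (hΦL s hs y _ _).trans ?_
      have e : |vb b s y - vb b' s y| ≤ dist b b' * φ s y := by
        have hp := hφpos s hs y
        rw [hv b s hs, hv b' s hs, ← mul_sub, abs_mul, abs_of_pos hp, mul_comm]
        gcongr
        have := BoundedContinuousFunction.dist_coe_le_dist (f := b) (g := b') ⟨(s, y), ⟨hs, mem_univ _⟩⟩
        rwa [Real.dist_eq] at this
      calc _ ≤ Lw C₁ s y * (dist b b' * φ s y) := mul_le_mul_of_nonneg_left e (hL0 s hs y)
        _ = _ := by ring
  have : Nonempty X := ⟨0⟩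
  have hfix : Ψ (ContractingWith.fixedPoint Ψ hΨ) = ContractingWith.fixedPoint Ψ hΨ :=
    hΨ.fixedPoint_isFixedPt
  set b := ContractingWith.fixedPoint Ψ hΨ
  obtain ⟨M, hM⟩ := hCB b
  refine ⟨vb b, M, hM, fun t ht x => ?_⟩
  rw [hv b t ht]
  have h1 : b ⟨(t, x), ⟨ht, mem_univ _⟩⟩ = Ψ b ⟨(t, x), ⟨ht, mem_univ _⟩⟩ := by rw [hfix]
  rw [h1]
  show φ t x * (D (Fb b) 0 t x / φ t x) = _
  rw [mul_div_cancel₀ _ (hφpos t ht x).ne']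

end
end HeatW

namespace HeatW

section
variable {N : ℕ}

/-- The inner product as a bilinear map. -/
noncomputable def J (N : ℕ) : EN N →L[ℝ] EN N →L[ℝ] ℝ :=
  LinearMap.mkContinuous₂ (LinearMap.mk₂ ℝ (fun x y : EN N => (inner ℝ x y : ℝ))
    (fun a b c => inner_add_left a b c) (fun c a b => by simp [inner_smul_left])
    (fun a b c => inner_add_right a b c) (fun c a b => by simp [inner_smul_right])) 1
    (fun x y => by simpa using norm_inner_le_norm (𝕜 := ℝ) x y)

lemma J_apply (x y : EN N) : J N x y = inner ℝ x y := rfl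

lemma J_eq (x : EN N) : J N x = innerSL ℝ x := by ext y; simp [J_apply]

lemma J_norm (x : EN N) : ‖J N x‖ = ‖x‖ := by rw [J_eq, innerSL_apply_norm]

lemma norm_hasFDerivAt {y : EN N} (hy : y ≠ 0) :
    HasFDerivAt (fun y : EN N => ‖y‖) ((1 / ‖y‖) • J N y) y := by
  have h1 : HasFDerivAt (fun z : EN N => ‖z‖ ^ 2) (2 • innerSL ℝ y) y :=
    (hasStrictFDerivAt_norm_sq y).hasFDerivAt
  have hn : ‖y‖ ≠ 0 := norm_ne_zero_iff.2 hy
  have h2 := h1.sqrt (by positivity)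
  simp only [Real.sqrt_sq (norm_nonneg _)] at h2
  refine h2.congr_fderiv ?_
  ext z
  simp [J_apply]
  field_simp

/-- Profile data. -/
structure Prof (f f1 f2 : ℝ → ℝ) : Prop where
  d1 : ∀ r, 0 ≤ r → HasDerivWithinAt f (f1 r) (Ici 0) r
  d2 : ∀ r, 0 ≤ r → HasDerivWithinAt f1 (f2 r) (Ici 0) r
  c2 : ContinuousOn f2 (Ici 0)
  z1 : f1 0 = 0

variable {f f1 f2 : ℝ → ℝ}

open Classical in
/-- The quotient. -/
noncomputable def qf (f1 f2 : ℝ → ℝ) (y : EN N) : ℝ := if y = 0 then f2 0 else f1 ‖y‖ / ‖y‖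

lemma norm_tendsto : Tendsto (fun y : EN N => ‖y‖) (nhdsWithin 0 {0}ᶜ) (nhdsWithin 0 (Ici 0 \ {0})) := by
  refine tendsto_nhdsWithin_iff.2 ⟨?_, ?_⟩
  · have := (continuous_norm (E := EN N)).tendsto 0
    rw [norm_zero] at this
    exact this.mono_left nhdsWithin_le_nhds
  · filter_upwards [self_mem_nhdsWithin] with y hy
    exact ⟨norm_nonneg _, by simpa using hy⟩

lemma Prof.q_cont (h : Prof f f1 f2) : Continuous (qf (N := N) f1 f2) := by
  have c1 : ContinuousOn f1 (Ici 0) := fun r hr => (h.d2 r hr).continuousWithinAt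
  rw [continuous_iff_continuousAt]
  intro y
  by_cases hy : y = 0
  · subst hy
    rw [← continuousWithinAt_compl_self]
    have h0 := hasDerivWithinAt_iff_tendsto_slope.1 (h.d2 0 le_rfl)
    have h1 := h0.comp (norm_tendsto (N := N))
    have : qf (N := N) f1 f2 0 = f2 0 := by simp [qf]
    unfold ContinuousWithinAt
    rw [this]
    refine h1.congr' ?_
    filter_upwards [self_mem_nhdsWithin] with y hy
    have hy' : y ≠ 0 := hy
    simp [qf, hy', slope_def_field, h.z1]
  · have : ContinuousAt (fun y : EN N => f1 ‖y‖ / ‖y‖) y := by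
      refine ContinuousAt.div ?_ continuous_norm.continuousAt (norm_ne_zero_iff.2 hy)
      have hc : ContinuousAt f1 ‖y‖ := c1.continuousAt (Ici_mem_nhds (norm_pos_iff.2 hy))
      exact hc.comp (f := fun y : EN N => ‖y‖) continuous_norm.continuousAt
    refine this.congr ?_
    filter_upwards [isOpen_ne.mem_nhds hy] with z hz
    have hz' : z ≠ 0 := hz
    simp [qf, hz']

lemma Prof.hasFDerivAt (h : Prof f f1 f2) (y : EN N) :
    HasFDerivAt (fun y : EN N => f ‖y‖) (qf f1 f2 y • J N y) y := by
  by_cases hy : y = 0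
  · subst hy
    have h0 := hasDerivWithinAt_iff_isLittleO.1 (h.d1 0 le_rfl)
    rw [h.z1] at h0
    have ht : Tendsto (fun y : EN N => ‖y‖) (nhds 0) (nhdsWithin 0 (Ici 0)) := by
      refine tendsto_nhdsWithin_iff.2 ⟨?_, Eventually.of_forall fun y => norm_nonneg y⟩
      have := (continuous_norm (E := EN N)).tendsto 0
      rwa [norm_zero] at this
    have h1 := h0.comp_tendsto ht
    rw [hasFDerivAt_iff_isLittleO]
    have h2 : (fun y : EN N => ‖y‖) =O[nhds 0] fun y => y := Asymptotics.isBigO_norm_left.2 (Asymptotics.isBigO_refl _ _)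
    have h3 := h1.trans_isBigO (g := fun y : EN N => ‖y‖ - 0) (k := fun y : EN N => y - 0) (by simpa using h2)
    simpa [Function.comp_def] using h3
  · have hd : HasDerivAt f (f1 ‖y‖) ‖y‖ := (h.d1 _ (norm_nonneg y)).hasDerivAt (Ici_mem_nhds (norm_pos_iff.2 hy))
    have := hd.comp_hasFDerivAt y (norm_hasFDerivAt hy)
    refine this.congr_fderiv ?_
    rw [smul_smul]; simp [qf, hy, div_eq_mul_inv]

/-- Unit projector. -/
noncomputable def Ep (y : EN N) : EN N →L[ℝ] EN N →L[ℝ] ℝ :=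
  (1 / ‖y‖ ^ 2) • (J N y).smulRight (J N y)

/-- Hessian. -/
noncomputable def Hs (f1 f2 : ℝ → ℝ) (y : EN N) : EN N →L[ℝ] EN N →L[ℝ] ℝ :=
  qf f1 f2 y • J N + (f2 ‖y‖ - qf f1 f2 y) • Ep y

lemma Ep_norm (y : EN N) : ‖Ep y‖ ≤ 1 := by
  unfold Ep
  rw [norm_smul, ContinuousLinearMap.norm_smulRight_apply, J_norm, Real.norm_of_nonneg (by positivity)]
  rcases eq_or_ne ‖y‖ 0 with h | h
  · simp [h]
  · apply le_of_eq; field_simp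

lemma Prof.hasFDerivAt2 (h : Prof f f1 f2) (y : EN N) :
    HasFDerivAt (fun y : EN N => qf f1 f2 y • J N y) (Hs f1 f2 y) y := by
  by_cases hy : y = 0
  · subst hy
    have : Hs f1 f2 (0 : EN N) = qf (N := N) f1 f2 0 • J N := by simp [Hs, Ep]
    rw [this, hasFDerivAt_iff_isLittleO]
    have hq : (fun y : EN N => qf f1 f2 y - qf (N := N) f1 f2 0) =o[nhds 0] fun _ => (1:ℝ) := by
      rw [Asymptotics.isLittleO_one_iff]
      have := (h.q_cont (N := N)).tendsto 0
      simpa using this.sub_const (qf (N := N) f1 f2 0)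
    have h2 : (fun y : EN N => J N y) =O[nhds 0] fun y => y := by
      refine Asymptotics.IsBigO.of_bound 1 (Eventually.of_forall fun y => ?_)
      rw [J_norm]; simp
    have h3 := hq.smul_isBigO h2
    simpa [sub_smul] using h3
  · have hn : ‖y‖ ≠ 0 := norm_ne_zero_iff.2 hy
    have hd : HasDerivAt f1 (f2 ‖y‖) ‖y‖ := (h.d2 _ (norm_nonneg y)).hasDerivAt (Ici_mem_nhds (norm_pos_iff.2 hy))
    have hd2 := (hd.div (hasDerivAt_id _) hn).comp_hasFDerivAt y (norm_hasFDerivAt hy)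
    have hd3 := hd2.smul (J N).hasFDerivAt
    refine (hd3.congr_of_eventuallyEq ?_).congr_fderiv ?_
    · filter_upwards [isOpen_ne.mem_nhds hy] with z hz
      have hz' : z ≠ 0 := hz
      simp [qf, hz']
    · ext a b
      simp [Hs, Ep, qf, hy, J_apply]
      field_simp

lemma Prof.Hs_cont (h : Prof f f1 f2) : Continuous (Hs (N := N) f1 f2) := by
  have hq := h.q_cont (N := N)
  have hf2 : Continuous fun y : EN N => f2 ‖y‖ :=
    continuousOn_univ.1 (h.c2.comp continuous_norm.continuousOn fun y _ => norm_nonneg y)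
  unfold Hs
  refine (hq.smul continuous_const).add ?_
  rw [continuous_iff_continuousAt]
  intro y
  by_cases hy : y = 0
  · subst hy
    have h0 : Tendsto (fun y : EN N => f2 ‖y‖ - qf f1 f2 y) (nhds 0) (nhds 0) := by
      have hz : f2 ‖(0:EN N)‖ - qf f1 f2 (0:EN N) = 0 := by simp [qf]
      have h9 : Tendsto (fun y : EN N => f2 ‖y‖ - qf f1 f2 y) (nhds 0) (nhds (f2 ‖(0:EN N)‖ - qf f1 f2 (0:EN N))) :=
        (hf2.sub hq).tendsto 0
      rwa [hz] at h9
    show Tendsto _ _ (nhds ((f2 ‖(0 : EN N)‖ - qf f1 f2 (0 : EN N)) • Ep (0 : EN N)))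
    have : (f2 ‖(0 : EN N)‖ - qf f1 f2 (0 : EN N)) • Ep (0 : EN N) = 0 := by simp [Ep]
    rw [this, tendsto_zero_iff_norm_tendsto_zero]
    refine squeeze_zero (fun _ => norm_nonneg _) (fun y => ?_) (tendsto_zero_iff_norm_tendsto_zero.1 h0)
    rw [norm_smul]
    exact mul_le_of_le_one_right (norm_nonneg _) (Ep_norm y)
  · refine (hf2.sub hq).continuousAt.smul ?_
    unfold Ep
    have hn : ‖y‖ ≠ 0 := norm_ne_zero_iff.2 hy
    refine ContinuousAt.smul (f := fun y : EN N => 1/‖y‖^2) (g := fun y => (J N y).smulRight (J N y))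
      (ContinuousAt.div continuousAt_const (continuous_norm.pow 2).continuousAt (pow_ne_zero 2 hn)) ?_
    exact (((ContinuousLinearMap.smulRightL ℝ (EN N) (EN N →L[ℝ] ℝ)).continuous₂).comp
        ((J N).continuous.prodMk (J N).continuous)).continuousAt

lemma trL_J : trL N (J N) = N := by
  rw [trL_apply]; simp [J_apply]

lemma trL_Hs {y : EN N} (hy : y ≠ 0) :
    trL N (Hs f1 f2 y) = f2 ‖y‖ + ((N : ℝ) - 1) / ‖y‖ * f1 ‖y‖ := by
  have hn : ‖y‖ ≠ 0 := norm_ne_zero_iff.2 hy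
  unfold Hs Ep
  rw [map_add, map_smul, map_smul, map_smul, trL_J]
  nth_rewrite 1 [J_eq]
  rw [trL_smulRight, J_apply, real_inner_self_eq_norm_sq]
  simp [qf, hy]
  field_simp
  ring

lemma Prof.pde (h : Prof f f1 f2) (hN : 1 ≤ N) {α : ℝ} (hα : 0 < α)
    (hODE : ∀ r > (0 : ℝ), f2 r + (((N : ℝ) - 1) / r + r / 2) * f1 r + f r / α + |f r| ^ α * f r = 0)
    (y : EN N) : trL N (Hs f1 f2 y) + (1 / 2) * (qf f1 f2 y • J N y) y + f ‖y‖ / α +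
      |f ‖y‖| ^ α * f ‖y‖ = 0 := by
  have : Nontrivial (EN N) := by
    have : Nonempty (Fin N) := ⟨⟨0, hN⟩⟩
    infer_instance
  have hd : Dense ({0}ᶜ : Set (EN N)) := dense_compl_singleton 0
  have hf : Continuous fun y : EN N => f ‖y‖ :=
    continuous_iff_continuousAt.2 fun y => (h.hasFDerivAt y).continuousAt
  have hq := h.q_cont (N := N)
  have hc : Continuous fun y : EN N => trL N (Hs f1 f2 y) + (1 / 2) * (qf f1 f2 y • J N y) y + f ‖y‖ / α +
      |f ‖y‖| ^ α * f ‖y‖ := by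
    refine ((((trL N).continuous.comp h.Hs_cont).add (continuous_const.mul ?_)).add (hf.div_const _)).add
      ((hf.abs.rpow_const fun _ => Or.inr hα.le).mul hf)
    exact (hq.smul (J N).continuous).clm_apply continuous_id
  have := hc.ext_on hd continuous_const (g := fun _ => (0:ℝ)) (fun y hy => ?_)
  · exact congrFun this y
  · have hy' : y ≠ 0 := hy
    have hn : ‖y‖ ≠ 0 := norm_ne_zero_iff.2 hy'
    have := hODE ‖y‖ (norm_pos_iff.2 hy')
    simp only
    rw [trL_Hs hy', _root_.smul_apply, J_apply, real_inner_self_eq_norm_sq]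
    rw [← this]
    simp only [qf, hy', if_false, smul_eq_mul]
    field_simp
    ring

end
end HeatW

namespace HeatW

section
variable {N : ℕ} {f f1 f2 : ℝ → ℝ} {α : ℝ}

/-- Gradient of the profile. -/
noncomputable def f1h (f1 f2 : ℝ → ℝ) (y : EN N) : EN N →L[ℝ] ℝ := qf f1 f2 y • J N y

lemma Prof.f1h_norm (h : Prof f f1 f2) (y : EN N) : ‖f1h f1 f2 y‖ = |f1 ‖y‖| := by
  unfold f1h
  rw [norm_smul, J_norm]
  by_cases hy : y = 0
  · simp [hy, h.z1]
  · have hn : ‖y‖ ≠ 0 := norm_ne_zero_iff.2 hy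
    simp [qf, hy]

/-- Gradient of `U`. -/
noncomputable def U1 (α : ℝ) (f1 f2 : ℝ → ℝ) (t : ℝ) (x : EN N) : EN N →L[ℝ] ℝ :=
  (t ^ (-(1/α)) * (√t)⁻¹) • f1h f1 f2 ((√t)⁻¹ • x)

/-- Hessian of `U`. -/
noncomputable def U2 (α : ℝ) (f1 f2 : ℝ → ℝ) (t : ℝ) (x : EN N) : EN N →L[ℝ] EN N →L[ℝ] ℝ :=
  (t ^ (-(1/α)) * (√t)⁻¹ * (√t)⁻¹) • Hs f1 f2 ((√t)⁻¹ • x)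

lemma ssol_eq (t : ℝ) (x : EN N) : ssol α f t x = t ^ (-(1/α)) * f ‖(√t)⁻¹ • x‖ := by
  unfold ssol
  rw [norm_smul, Real.norm_of_nonneg (by positivity)]
  congr 2
  rw [div_eq_inv_mul]

lemma cont_scale : ContinuousOn (fun p : ℝ × EN N => (√p.1)⁻¹ • p.2) (Dom N) := by
  refine ContinuousOn.smul (f := fun p : ℝ × EN N => (√p.1)⁻¹) (g := fun p => p.2) ?_ continuous_snd.continuousOn
  refine ContinuousOn.inv₀ (continuous_fst.sqrt).continuousOn ?_
  intro p hp
  exact (Real.sqrt_pos.2 hp.1).ne'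

lemma cont_tpow (a : ℝ) : ContinuousOn (fun p : ℝ × EN N => p.1 ^ a) (Dom N) := by
  refine ContinuousOn.rpow_const continuous_fst.continuousOn fun p hp => Or.inl ?_
  exact (show (0:ℝ) < p.1 from hp.1).ne'

lemma cont_sqi : ContinuousOn (fun p : ℝ × EN N => (√p.1)⁻¹) (Dom N) := by
  refine ContinuousOn.inv₀ (continuous_fst.sqrt).continuousOn ?_
  intro p hp
  exact (Real.sqrt_pos.2 hp.1).ne'

lemma Prof.cont0 (h : Prof f f1 f2) : Continuous fun y : EN N => f ‖y‖ :=
  continuous_iff_continuousAt.2 fun y => (h.hasFDerivAt y).continuousAt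

lemma Prof.U_cont (h : Prof f f1 f2) : ContinuousOn (fun p : ℝ × EN N => ssol α f p.1 p.2) (Dom N) := by
  simp only [ssol_eq]
  exact (cont_tpow _).mul (h.cont0.comp_continuousOn cont_scale)

lemma Prof.f1h_cont (h : Prof f f1 f2) : Continuous (f1h (N := N) f1 f2) := by
  unfold f1h
  exact (h.q_cont).smul (J N).continuous

lemma Prof.U1_cont (h : Prof f f1 f2) : ContinuousOn (fun p : ℝ × EN N => U1 α f1 f2 p.1 p.2) (Dom N) := by
  unfold U1
  exact ContinuousOn.smul (f := fun p : ℝ × EN N => (p.1 ^ (-(1/α)) * (√p.1)⁻¹))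
    (g := fun p => f1h f1 f2 ((√p.1)⁻¹ • p.2)) ((cont_tpow _).mul cont_sqi)
    (h.f1h_cont.comp_continuousOn cont_scale)

lemma Prof.U2_cont (h : Prof f f1 f2) : ContinuousOn (fun p : ℝ × EN N => U2 α f1 f2 p.1 p.2) (Dom N) := by
  unfold U2
  exact ContinuousOn.smul (f := fun p : ℝ × EN N => (p.1 ^ (-(1/α)) * (√p.1)⁻¹ * (√p.1)⁻¹))
    (g := fun p => Hs f1 f2 ((√p.1)⁻¹ • p.2)) (((cont_tpow _).mul cont_sqi).mul cont_sqi)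
    (h.Hs_cont.comp_continuousOn cont_scale)

lemma Prof.U_d1 (h : Prof f f1 f2) (t : ℝ) (x : EN N) :
    HasFDerivAt (ssol α f t) (U1 α f1 f2 t x) x := by
  have e : (ssol α f t : EN N → ℝ) = fun x => t ^ (-(1/α)) * f ‖(√t)⁻¹ • x‖ := by
    funext x; exact ssol_eq t x
  rw [e]
  have h1 : HasFDerivAt (fun x : EN N => (√t)⁻¹ • x) ((√t)⁻¹ • ContinuousLinearMap.id ℝ (EN N)) x :=
    ((√t)⁻¹ • ContinuousLinearMap.id ℝ (EN N)).hasFDerivAt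
  have h2 := ((h.hasFDerivAt ((√t)⁻¹ • x)).comp x h1).const_mul (t ^ (-(1/α)))
  refine h2.congr_fderiv ?_
  unfold U1 f1h
  ext z
  simp
  ring

lemma Prof.U_d2 (h : Prof f f1 f2) (t : ℝ) (x : EN N) :
    HasFDerivAt (U1 α f1 f2 t) (U2 α f1 f2 t x) x := by
  have h1 : HasFDerivAt (fun x : EN N => (√t)⁻¹ • x) ((√t)⁻¹ • ContinuousLinearMap.id ℝ (EN N)) x :=
    ((√t)⁻¹ • ContinuousLinearMap.id ℝ (EN N)).hasFDerivAt
  have h2 := ((h.hasFDerivAt2 ((√t)⁻¹ • x)).comp x h1).const_smul (t ^ (-(1/α)) * (√t)⁻¹)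
  refine h2.congr_fderiv ?_
  unfold U2
  ext z w
  simp
  ring

/-- Time derivative of `U` (in terms of the profile). -/
lemma Prof.U_t (h : Prof f f1 f2) {t : ℝ} (ht : 0 < t) (x : EN N) :
    HasDerivAt (fun s => ssol α f s x)
      (t ^ (-(1/α)) * t⁻¹ * (-(f ‖(√t)⁻¹ • x‖ / α) - 1/2 * f1h f1 f2 ((√t)⁻¹ • x) ((√t)⁻¹ • x))) t := by
  simp only [ssol_eq]
  have hs : 0 < √t := Real.sqrt_pos.2 ht
  have h1 : HasDerivAt (fun s : ℝ => (√s)⁻¹) (-(1 / (2 * √t)) / √t ^ 2) t :=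
    (Real.hasDerivAt_sqrt ht.ne').inv hs.ne'
  have h2 : HasDerivAt (fun s : ℝ => (√s)⁻¹ • x) ((-(1 / (2 * √t)) / √t ^ 2) • x) t := h1.smul_const x
  have h3 := (h.hasFDerivAt ((√t)⁻¹ • x)).comp_hasDerivAt t h2
  have h4 : HasDerivAt (fun s : ℝ => s ^ (-(1/α))) (-(1/α) * t ^ (-(1/α) - 1)) t :=
    Real.hasDerivAt_rpow_const (Or.inl ht.ne')
  have h5 := h4.mul h3
  refine h5.congr_deriv ?_
  rw [Real.rpow_sub_one ht.ne']
  have e : (-(1 / (2 * √t)) / √t ^ 2) • x = (-(1/2) * t⁻¹) • ((√t)⁻¹ • x) := by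
    rw [smul_smul]; congr 1
    rw [Real.sq_sqrt ht.le]; field_simp
  rw [e, map_smul]
  simp only [f1h, smul_eq_mul, Function.comp]
  ring

lemma Prof.U_pde (h : Prof f f1 f2) (hN : 1 ≤ N) (hα : 0 < α)
    (hODE : ∀ r > (0 : ℝ), f2 r + (((N : ℝ) - 1) / r + r / 2) * f1 r + f r / α + |f r| ^ α * f r = 0)
    {t : ℝ} (ht : 0 < t) (x : EN N) :
    t ^ (-(1/α)) * t⁻¹ * (-(f ‖(√t)⁻¹ • x‖ / α) - 1/2 * f1h f1 f2 ((√t)⁻¹ • x) ((√t)⁻¹ • x)) =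
      trL N (U2 α f1 f2 t x) + |ssol α f t x| ^ α * ssol α f t x := by
  have hs : 0 < √t := Real.sqrt_pos.2 ht
  have hp := h.pde hN hα hODE ((√t)⁻¹ • x)
  rw [ssol_eq]
  unfold U2
  generalize (√t)⁻¹ • x = y at *
  rw [map_smul, abs_mul, Real.mul_rpow (abs_nonneg _) (abs_nonneg _), abs_of_nonneg (by positivity),
    ← Real.rpow_mul ht.le]
  have e1 : -(1/α) * α = -1 := by field_simp
  have e2 : (√t)⁻¹ * (√t)⁻¹ = t⁻¹ := by rw [← mul_inv, Real.mul_self_sqrt ht.le]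
  rw [e1, Real.rpow_neg_one, mul_assoc _ (√t)⁻¹, e2, smul_eq_mul]
  unfold f1h
  linear_combination (- t ^ (-(1/α)) * t⁻¹) * hp

lemma U_bound {C₀ : ℝ} (hα : 0 < α)
    (hd : ∀ r ≥ (0 : ℝ), |f r| + (1 + r) * |f1 r| ≤ C₀ * (1 + r ^ 2) ^ (-(1 / α)))
    {t : ℝ} (ht : 0 < t) (x : EN N) : |ssol α f t x| ≤ C₀ * (t + ‖x‖ ^ 2) ^ (-(1/α)) := by
  unfold ssol
  have hs : 0 < √t := Real.sqrt_pos.2 ht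
  have hr : 0 ≤ ‖x‖ / √t := by positivity
  have h1 := hd _ hr
  have h2 : |f (‖x‖ / √t)| ≤ C₀ * (1 + (‖x‖ / √t) ^ 2) ^ (-(1 / α)) := by
    have : 0 ≤ (1 + ‖x‖ / √t) * |f1 (‖x‖ / √t)| := by positivity
    linarith
  have e : t + ‖x‖ ^ 2 = t * (1 + (‖x‖ / √t) ^ 2) := by
    rw [div_pow, Real.sq_sqrt ht.le]; field_simp
  rw [e, Real.mul_rpow ht.le (by positivity), abs_mul, abs_of_nonneg (by positivity)]
  calc t ^ (-(1/α)) * |f (‖x‖ / √t)| ≤ t ^ (-(1/α)) * (C₀ * (1 + (‖x‖ / √t) ^ 2) ^ (-(1 / α))) := by gcongr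
    _ = _ := by ring

lemma decay0 {C₀ : ℝ} (hα : 0 < α) (hC : 0 < C₀)
    (hd : ∀ r ≥ (0 : ℝ), |f r| + (1 + r) * |f1 r| ≤ C₀ * (1 + r ^ 2) ^ (-(1 / α))) {r : ℝ} (hr : 0 ≤ r) :
    |f r| ≤ C₀ ∧ |f1 r| ≤ C₀ ∧ |f1 r| * r ≤ C₀ := by
  have h1 := hd r hr
  have h2 : (1 + r ^ 2) ^ (-(1 / α)) ≤ 1 :=
    Real.rpow_le_one_of_one_le_of_nonpos (by nlinarith) (by simp; positivity)
  have h3 : C₀ * (1 + r ^ 2) ^ (-(1 / α)) ≤ C₀ := mul_le_of_le_one_right hC.le h2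
  have h4 : 0 ≤ r * |f1 r| := by positivity
  have h5 := abs_nonneg (f r)
  have h6 := abs_nonneg (f1 r)
  refine ⟨by nlinarith, by nlinarith, by nlinarith⟩

lemma Prof.U1_bound (h : Prof f f1 f2) {C₀ : ℝ} (hα : 0 < α) (hC : 0 < C₀)
    (hd : ∀ r ≥ (0 : ℝ), |f r| + (1 + r) * |f1 r| ≤ C₀ * (1 + r ^ 2) ^ (-(1 / α)))
    {τ t : ℝ} (hτ : 0 < τ) (ht : τ ≤ t) (x : EN N) :
    ‖U1 α f1 f2 t x‖ ≤ τ ^ (-(1/α)) * (√τ)⁻¹ * C₀ := by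
  have ht0 : 0 < t := hτ.trans_le ht
  have hs : 0 < √τ := Real.sqrt_pos.2 hτ
  unfold U1
  rw [norm_smul, h.f1h_norm, Real.norm_of_nonneg (by positivity)]
  have h1 := (decay0 hα hC hd (norm_nonneg ((√t)⁻¹ • x))).2.1
  have h2 : t ^ (-(1/α)) ≤ τ ^ (-(1/α)) := Real.rpow_le_rpow_of_nonpos hτ ht (by simp; positivity)
  gcongr

lemma Prof.Ut_bound (h : Prof f f1 f2) {C₀ : ℝ} (hα : 0 < α) (hC : 0 < C₀)
    (hd : ∀ r ≥ (0 : ℝ), |f r| + (1 + r) * |f1 r| ≤ C₀ * (1 + r ^ 2) ^ (-(1 / α)))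
    {τ t : ℝ} (hτ : 0 < τ) (ht : τ ≤ t) (x : EN N) :
    |t ^ (-(1/α)) * t⁻¹ * (-(f ‖(√t)⁻¹ • x‖ / α) - 1/2 * f1h f1 f2 ((√t)⁻¹ • x) ((√t)⁻¹ • x))|
      ≤ τ ^ (-(1/α)) * τ⁻¹ * (C₀ / α + 1 / 2 * C₀) := by
  have ht0 : 0 < t := hτ.trans_le ht
  set y := (√t)⁻¹ • x
  obtain ⟨h1, -, h3⟩ := (decay0 hα hC hd (norm_nonneg y))
  have h2 : t ^ (-(1/α)) ≤ τ ^ (-(1/α)) := Real.rpow_le_rpow_of_nonpos hτ ht (by simp; positivity)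
  have h4 : |f1h f1 f2 y y| ≤ C₀ := by
    refine ((f1h f1 f2 y).le_opNorm y).trans ?_
    rwa [h.f1h_norm]
  rw [abs_mul, abs_of_nonneg (by positivity : 0 ≤ t ^ (-(1/α)) * t⁻¹)]
  have h5 : |-(f ‖y‖ / α) - 1/2 * f1h f1 f2 y y| ≤ C₀ / α + 1 / 2 * C₀ := by
    refine (abs_sub _ _).trans ?_
    rw [abs_neg, abs_div, abs_mul, abs_of_pos hα, abs_of_pos (by norm_num : (0:ℝ) < 1/2)]
    gcongr
  gcongr

lemma U_unif {μ : ℝ} (hα : 0 < α)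
    (hflim : Tendsto (fun r : ℝ => r ^ (2 / α) * f r) atTop (nhds μ)) {ε η : ℝ} (hε : 0 < ε) (hη : 0 < η) :
    ∃ t₀ > 0, ∀ t, 0 < t → t < t₀ → ∀ x : EN N, ε ≤ ‖x‖ →
      |ssol α f t x - μ * ‖x‖ ^ (-(2/α))| ≤ η := by
  have hE : 0 < ε ^ (-(2/α)) := by positivity
  obtain ⟨R, hR⟩ := (Metric.tendsto_atTop.1 hflim) (η / ε ^ (-(2/α))) (by positivity)
  refine ⟨(ε / (|R| + 1)) ^ 2, by positivity, fun t ht htt x hx => ?_⟩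
  have hs : 0 < √t := Real.sqrt_pos.2 ht
  have hx0 : 0 < ‖x‖ := hε.trans_le hx
  have h1 : √t < ε / (|R| + 1) := by
    rw [Real.sqrt_lt' (by positivity)]; exact htt
  have h2 : R ≤ ‖x‖ / √t := by
    rw [le_div_iff₀ hs]
    rw [lt_div_iff₀ (by positivity)] at h1
    have := le_abs_self R
    nlinarith [abs_nonneg R]
  have h3 := (hR _ h2).le
  rw [Real.dist_eq] at h3
  have e : ssol α f t x - μ * ‖x‖ ^ (-(2/α)) = ‖x‖ ^ (-(2/α)) * ((‖x‖ / √t) ^ (2/α) * f (‖x‖ / √t) - μ) := by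
    unfold ssol
    have e1 : ‖x‖ ^ (-(2/α)) * (‖x‖ / √t) ^ (2/α) = t ^ (-(1/α)) := by
      rw [Real.div_rpow hx0.le hs.le, Real.rpow_neg hx0.le, Real.sqrt_eq_rpow, ← Real.rpow_mul ht.le,
        Real.rpow_neg ht.le]
      have : 1 / 2 * (2 / α) = 1 / α := by field_simp
      rw [this]
      have : ‖x‖ ^ (2/α) ≠ 0 := by positivity
      field_simp
    rw [mul_sub, ← mul_assoc, e1]; ring
  rw [e, abs_mul, abs_of_nonneg (by positivity)]
  have h4 : ‖x‖ ^ (-(2/α)) ≤ ε ^ (-(2/α)) := Real.rpow_le_rpow_of_nonpos hε hx (by simp; positivity)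
  calc _ ≤ ε ^ (-(2/α)) * (η / ε ^ (-(2/α))) := by gcongr
    _ = η := by field_simp

lemma mk_prof (hf : ContDiffOn ℝ 2 f (Ici 0)) (hf'0 : derivWithin f (Ici 0) 0 = 0) :
    Prof f (derivWithin f (Ici 0)) (derivWithin (derivWithin f (Ici 0)) (Ici 0)) := by
  have hu := uniqueDiffOn_Ici (0:ℝ)
  have h1 : ContDiffOn ℝ 1 (derivWithin f (Ici 0)) (Ici 0) := hf.derivWithin hu (by norm_num)
  have h2 : ContDiffOn ℝ 0 (derivWithin (derivWithin f (Ici 0)) (Ici 0)) (Ici 0) := h1.derivWithin hu (by norm_num)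
  exact ⟨fun r hr => ((hf.differentiableOn (by norm_num)) r hr).hasDerivWithinAt,
    fun r hr => ((h1.differentiableOn (by norm_num)) r hr).hasDerivWithinAt, h2.continuousOn, hf'0⟩

end
end HeatW

namespace HeatW

section
variable {N : ℕ} {α : ℝ}

/-- Nonlinearity. -/
noncomputable def gN (α s : ℝ) : ℝ := |s| ^ α * s

lemma gN_cont (hα : 0 < α) : Continuous (gN α) := by
  unfold gN
  exact (continuous_abs.rpow_const fun _ => Or.inr hα.le).mul continuous_id

lemma gN_deriv (hα : 0 < α) (s : ℝ) : HasDerivAt (gN α) ((α + 1) * |s| ^ α) s := by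
  rcases lt_trichotomy s 0 with h | h | h
  · have h1 := (hasDerivAt_neg s).rpow_const (p := α + 1) (Or.inl (by linarith))
    have h2 := h1.neg
    have : gN α =ᶠ[nhds s] fun y => -((-y) ^ (α + 1)) := by
      filter_upwards [Iio_mem_nhds h] with y hy
      have hy' : 0 < -y := by simpa using hy
      unfold gN
      rw [abs_of_neg hy, Real.rpow_add_one hy'.ne']; ring
    refine (h2.congr_of_eventuallyEq this).congr_deriv ?_
    rw [abs_of_neg h]; simp; ring
  · subst h
    rw [hasDerivAt_iff_tendsto_slope]
    have e : (α + 1) * |(0:ℝ)| ^ α = |(0:ℝ)| ^ α := by simp [hα.ne']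
    rw [e]
    have hc : Continuous fun s : ℝ => |s| ^ α := continuous_abs.rpow_const fun _ => Or.inr hα.le
    refine ((hc.tendsto 0).mono_left nhdsWithin_le_nhds).congr' ?_
    filter_upwards [self_mem_nhdsWithin] with y hy
    have hy' : y ≠ 0 := hy
    simp [slope_def_field, gN, hy']
  · have h1 := (hasDerivAt_id s).rpow_const (p := α + 1) (Or.inl (by simp; linarith))
    have : gN α =ᶠ[nhds s] fun y => y ^ (α + 1) := by
      filter_upwards [Ioi_mem_nhds h] with y hy
      have hy' : 0 < y := hy
      unfold gN
      rw [abs_of_pos hy', Real.rpow_add_one hy'.ne']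
    refine (h1.congr_of_eventuallyEq this).congr_deriv ?_
    rw [abs_of_pos h]; simp

lemma gN_lip (hα : 0 < α) {L a b : ℝ} (ha : |a| ≤ L) (hb : |b| ≤ L) :
    |gN α a - gN α b| ≤ (α + 1) * L ^ α * |a - b| := by
  have := (convex_Icc (-L) L).norm_image_sub_le_of_norm_hasDerivWithin_le (f := gN α)
    (f' := fun s => (α + 1) * |s| ^ α) (C := (α + 1) * L ^ α)
    (fun x _ => (gN_deriv hα x).hasDerivWithinAt) (fun x hx => by
      rw [Real.norm_of_nonneg (by positivity)]
      have : |x| ≤ L := abs_le.2 hx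
      gcongr) (abs_le.1 hb) (abs_le.1 ha)
  simpa using this

lemma two_pow (hα : 0 < α) {a b : ℝ} (ha : 0 ≤ a) (hb : 0 ≤ b) : (a + b) ^ α ≤ 2 ^ α * (a ^ α + b ^ α) := by
  have ha' : 0 ≤ a ^ α := by positivity
  have hb' : 0 ≤ b ^ α := by positivity
  rcases le_total a b with h | h
  · calc (a + b) ^ α ≤ (2 * b) ^ α := by gcongr; linarith
      _ = 2 ^ α * b ^ α := Real.mul_rpow (by norm_num) hb
      _ ≤ _ := by gcongr; linarith
  · calc (a + b) ^ α ≤ (2 * a) ^ α := by gcongr; linarith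
      _ = 2 ^ α * a ^ α := Real.mul_rpow (by norm_num) ha
      _ ≤ _ := by gcongr; linarith

/-- Truncation. -/
noncomputable def clamp (v : ℝ) : ℝ := max (-1) (min 1 v)

lemma clamp_abs (v : ℝ) : |clamp v| ≤ 1 := by
  unfold clamp
  rw [abs_le]
  exact ⟨le_max_left _ _, max_le (by norm_num) (min_le_left _ _)⟩

lemma clamp_lip (v v' : ℝ) : |clamp v - clamp v'| ≤ |v - v'| := by
  unfold clamp
  refine (abs_max_sub_max_le_max _ _ _ _).trans ?_
  simp only [sub_self, abs_zero]
  refine max_le (abs_nonneg _) ((abs_min_sub_min_le_max _ _ _ _).trans ?_)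
  simp

lemma clamp_eq {v : ℝ} (h : |v| ≤ 1) : clamp v = v := by
  rw [abs_le] at h
  unfold clamp
  rw [min_eq_right h.2, max_eq_right h.1]

lemma clamp_cont : Continuous clamp := by
  unfold clamp; fun_prop

lemma gU_lip (hα : 0 < α) {CU Z r U a b : ℝ} (hr : 0 < r) (hU : |U| ^ α ≤ CU / r) (hCU : 0 ≤ CU) (hZ : 0 ≤ Z)
    (ha : |a| ≤ Z) (hb : |b| ≤ Z) :
    |gN α (U + a) - gN α (U + b)| ≤ ((α + 1) * 2 ^ α * (CU + Z ^ α) / r + (α + 1) * 2 ^ α * (CU + Z ^ α)) * |a - b| := by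
  have h1 : |U + a| ≤ |U| + Z := (abs_add_le _ _).trans (by linarith)
  have h2 : |U + b| ≤ |U| + Z := (abs_add_le _ _).trans (by linarith)
  have h3 := gN_lip hα h1 h2
  have e : U + a - (U + b) = a - b := by ring
  rw [e] at h3
  refine h3.trans ?_
  gcongr
  have h4 := two_pow hα (abs_nonneg U) hZ
  have hZ' : 0 ≤ Z ^ α := by positivity
  calc (α + 1) * (|U| + Z) ^ α ≤ (α + 1) * (2 ^ α * (CU / r + Z ^ α)) := by
        gcongr; exact h4.trans (by gcongr)
    _ ≤ (α + 1) * (2 ^ α * ((CU + Z ^ α) / r + (CU + Z ^ α))) := by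
        gcongr <;> linarith
    _ = _ := by ring

lemma z_sg {w₁ : EN N → ℝ} {Z : ℝ} (hm : StronglyMeasurable w₁) (hZ : ∀ y, ‖w₁ y‖ ≤ Z) {τ t : ℝ}
    (hτ : 0 ≤ τ) (ht : τ ≤ t) (x : EN N) : P t w₁ x = P (t - τ) (P τ w₁) x := by
  rw [P_semigroup (by linarith) hτ hm hZ]; simp

lemma z_cont {w₁ : EN N → ℝ} {Z : ℝ} (hm : StronglyMeasurable w₁) (hZ : ∀ y, ‖w₁ y‖ ≤ Z) :
    ContinuousOn (fun p : ℝ × EN N => P p.1 w₁ p.2) (Dom N) := by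
  rintro ⟨t, x⟩ ⟨ht, -⟩
  have ht : 0 < t := ht
  have hτ : 0 < t / 2 := by linarith
  have hc : Continuous (P (t/2) w₁) :=
    continuous_iff_continuousAt.2 fun y => (P_hasFDerivAt hτ hm hZ y).continuousAt
  have h1 := P_contOn (S := univ) (F := fun _ => P (t/2) w₁) (M := Z) (N := N) (by fun_prop)
    (fun _ _ => P_norm_le hZ)
  have h2 : ContinuousOn (fun p : ℝ × EN N => P (p.1 - t/2) (P (t/2) w₁) p.2) univ :=
    h1.comp (f := fun p : ℝ × EN N => (p.1 - t/2, 0, p.2)) (by fun_prop) (fun p _ => by simp)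
  have h3 := (continuousOn_univ.1 h2).continuousAt (x := (t, x))
  refine (h3.congr ?_).continuousWithinAt
  have : ∀ᶠ p : ℝ × EN N in nhds (t, x), t / 2 < p.1 :=
    continuous_fst.continuousAt.eventually (lt_mem_nhds (by simp; linarith))
  filter_upwards [this] with p hp
  exact (z_sg hm hZ hτ.le hp.le p.2).symm

lemma z_poly {w₁ : EN N → ℝ} {Z C B : ℝ} {n : ℕ} (hm : StronglyMeasurable w₁) (hZ : ∀ y, ‖w₁ y‖ ≤ Z)
    (hC : 0 ≤ C) (hw : ∀ y, |w₁ y| ≤ C * (‖y‖ ^ 2) ^ n)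
    (hk : ∀ a σ : ℝ, 0 ≤ a → 0 ≤ σ → ∀ x : EN N,
      P σ (fun y => (a + ‖y‖ ^ 2) ^ n) x ≤ (a + B * σ + ‖x‖ ^ 2) ^ n) {t : ℝ} (ht : 0 ≤ t) (x : EN N) :
    |P t w₁ x| ≤ C * (B * t + ‖x‖ ^ 2) ^ n := by
  have h1 := hk 0 t le_rfl ht x
  unfold P at h1 ⊢
  have hi := integrable_shift_poly (N := N) n (le_refl (0:ℝ)) (√t) x
  calc |∫ z, w₁ (x + √t • z) ∂(gm N)| ≤ ∫ z, C * (0 + ‖x + √t • z‖ ^ 2) ^ n ∂(gm N) := by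
        have := norm_integral_le_of_norm_le (f := fun z => w₁ (x + √t • z)) (hi.const_mul C)
          (Eventually.of_forall fun z => by simpa using hw (x + √t • z))
        exact this
    _ = C * ∫ z, (0 + ‖x + √t • z‖ ^ 2) ^ n ∂(gm N) := integral_const_mul _ _
    _ ≤ C * (0 + B * t + ‖x‖ ^ 2) ^ n := by gcongr
    _ = _ := by rw [zero_add]

/-- Existence of the perturbation. -/
lemma exists_w (hα : 0 < α) {U : ℝ → EN N → ℝ} {CU : ℝ} (hCU : 0 ≤ CU)
    (hUc : ContinuousOn (fun p : ℝ × EN N => U p.1 p.2) (Dom N))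
    (hU : ∀ t, 0 < t → ∀ x, |U t x| ^ α ≤ CU / (t + ‖x‖ ^ 2))
    {w₁ : EN N → ℝ} {Z δ : ℝ} (hZ0 : 0 ≤ Z) (hδ : 0 < δ) (hm : StronglyMeasurable w₁) (hZ : ∀ y, ‖w₁ y‖ ≤ Z)
    (hw₁ : ∀ y, ‖y‖ < δ → w₁ y = 0) :
    ∃ b > 0, ∃ (w F : ℝ → EN N → ℝ) (W M : ℝ), 0 ≤ M ∧ IsMild 0 b w F W M ∧
      (∀ t ∈ Ioo 0 b, ∀ x, F t x = gN α (U t x + w t x) - gN α (U t x)) ∧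
      (∀ t ∈ Ioo 0 b, ∀ x, |w t x - P t w₁ x| ≤ M * t) := by
  set C₁ : ℝ := (α + 1) * 2 ^ α * (CU + (Z + 1) ^ α) with hC₁
  have hC₁0 : 0 ≤ C₁ := by positivity
  obtain ⟨k, hk⟩ := exists_nat_ge (8 * C₁)
  obtain ⟨B1, hB1, hk1⟩ := moment N k
  obtain ⟨B2, hB2, hk2⟩ := moment N (k + 1)
  set B := max B1 B2 with hB
  have hb1 : B1 ≤ B := le_max_left _ _
  have hb2 : B2 ≤ B := le_max_right _ _
  have hk1' : ∀ a σ : ℝ, 0 ≤ a → 0 ≤ σ → ∀ x : EN N,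
      P σ (fun y => (a + ‖y‖ ^ 2) ^ k) x ≤ (a + B * σ + ‖x‖ ^ 2) ^ k := fun a σ ha hσ x => by
    refine (hk1 a σ ha hσ x).trans ?_
    gcongr
  have hk2' : ∀ a σ : ℝ, 0 ≤ a → 0 ≤ σ → ∀ x : EN N,
      P σ (fun y => (a + ‖y‖ ^ 2) ^ (k + 1)) x ≤ (a + B * σ + ‖x‖ ^ 2) ^ (k + 1) := fun a σ ha hσ x => by
    refine (hk2 a σ ha hσ x).trans ?_
    gcongr
  have hB1 : 1 ≤ B := hB1.trans hb1
  set C₂ : ℝ := Z / (δ ^ 2) ^ (k + 1) with hC₂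
  have hC₂0 : 0 ≤ C₂ := by positivity
  have hwp : ∀ y, |w₁ y| ≤ C₂ * (‖y‖ ^ 2) ^ (k + 1) := fun y => by
    rcases lt_or_ge ‖y‖ δ with h | h
    · rw [hw₁ y h, abs_zero]; positivity
    · refine (hZ y).trans ?_
      rw [hC₂, div_mul_eq_mul_div, le_div_iff₀ (by positivity)]
      gcongr
  set z : ℝ → EN N → ℝ := fun t => P t w₁ with hz
  have hzZ : ∀ t x, |z t x| ≤ Z := fun t x => P_norm_le hZ x
  set Φ : ℝ → EN N → ℝ → ℝ := fun t x v => gN α (U t x + (z t x + clamp v)) - gN α (U t x) with hΦ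
  have hab : ∀ t x v, |z t x + clamp v| ≤ Z + 1 := fun t x v =>
    (abs_add_le _ _).trans (add_le_add (hzZ t x) (clamp_abs v))
  have hzc := z_cont hm hZ
  have hΦb : ∀ t, 0 < t → ∀ x v, |Φ t x v| ≤ Lw C₁ t x * |z t x + clamp v| := fun t ht x v => by
    have := gU_lip (b := 0) hα (r := t + ‖x‖ ^ 2) (by positivity) (hU t ht x) hCU (by linarith : 0 ≤ Z + 1) (hab t x v)
      (by simp; linarith)
    simpa [Lw, hΦ] using this
  obtain ⟨v, M, hM, hv⟩ := fixedPoint (N := N) (C₁ := C₁) (C₂ := C₂) (M₀ := 2 * C₁ * (Z + 1)) (B := B) (K := 4 * C₁ + 1)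
    (k := k) hC₁0 hC₂0 (by positivity) hB1 hk1' hk2' (by push_cast; linarith) (by linarith) (by positivity)
    (Φ := Φ) (by
      have hU' : ContinuousOn (fun p : (ℝ × EN N) × ℝ => U p.1.1 p.1.2) (Dom N ×ˢ univ) :=
        hUc.comp (f := fun p : (ℝ × EN N) × ℝ => p.1) continuous_fst.continuousOn fun p hp => hp.1
      have hz' : ContinuousOn (fun p : (ℝ × EN N) × ℝ => z p.1.1 p.1.2) (Dom N ×ˢ univ) :=
        hzc.comp (f := fun p : (ℝ × EN N) × ℝ => p.1) continuous_fst.continuousOn fun p hp => hp.1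
      exact ((gN_cont hα).comp_continuousOn (hU'.add (hz'.add
        (clamp_cont.comp continuous_snd).continuousOn))).sub ((gN_cont hα).comp_continuousOn hU'))
    (fun t ht x v v' => by
      have := gU_lip hα (r := t + ‖x‖ ^ 2) (by positivity) (hU t ht x) hCU (by linarith : 0 ≤ Z + 1) (hab t x v) (hab t x v')
      have e : Φ t x v - Φ t x v' = gN α (U t x + (z t x + clamp v)) - gN α (U t x + (z t x + clamp v')) := by
        simp [hΦ]
      rw [e]
      refine this.trans ?_
      have e2 : z t x + clamp v - (z t x + clamp v') = clamp v - clamp v' := by ring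
      rw [e2]
      unfold Lw
      exact mul_le_mul_of_nonneg_left (clamp_lip v v') (by positivity))
    (fun t ht x => by
      have h1 := hΦb t ht x 0
      have e : clamp 0 = 0 := clamp_eq (by simp)
      rw [e, add_zero] at h1
      refine h1.trans ?_
      have h2 := z_poly (C := C₂) (B := B) hm hZ hC₂0 hwp hk2' ht.le x
      have h3 : C₂ * (B * t + ‖x‖ ^ 2) ^ (k + 1) ≤ C₂ * wt (2 * B) (4 * C₁ + 1) (k + 1) t x := by
        unfold wt
        gcongr
        have h5 : 1 ≤ Real.exp ((4 * C₁ + 1) * t) := Real.one_le_exp (by positivity)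
        have h6 : (B * t + ‖x‖ ^ 2) ^ (k + 1) ≤ (2 * B * t + ‖x‖ ^ 2) ^ (k + 1) := by
          gcongr; linarith
        have h7 : 0 ≤ (2 * B * t + ‖x‖ ^ 2) ^ (k + 1) := by positivity
        nlinarith
      have h4 : 0 ≤ Lw C₁ t x := by unfold Lw; positivity
      calc Lw C₁ t x * |z t x| ≤ Lw C₁ t x * (C₂ * wt (2 * B) (4 * C₁ + 1) (k + 1) t x) := by
            gcongr; exact h2.trans h3
        _ = _ := by ring)
    (fun t ht x h1 v => by
      refine (hΦb t ht x v).trans ?_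
      have h2 : Lw C₁ t x ≤ 2 * C₁ := by
        unfold Lw
        have := div_le_self hC₁0 h1
        linarith
      have h3 := hab t x v
      gcongr)
  have hM0 : 0 ≤ M := (norm_nonneg _).trans (hM.bd 1 (by simp) 0)
  set F : ℝ → EN N → ℝ := fun t x => Φ t x (v t x) with hF
  have hvM : ∀ t, 0 < t → ∀ x, |v t x| ≤ M * t := fun t ht x => by
    rw [hv t ht x]
    have := D_norm_le hM ht.le (fun s hs => hs.1) x
    simpa using this
  set b : ℝ := 1 / (M + 1) with hb
  have hb0 : 0 < b := by positivity
  have hMb : M * b ≤ 1 := by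
    rw [hb, mul_one_div, div_le_one (by positivity)]; linarith
  have hsub : Ioo 0 b ⊆ Ioi 0 := fun t ht => ht.1
  have hvc : ContinuousOn (fun p : ℝ × EN N => v p.1 p.2) (Dom N) :=
    (D_contOn hM (A := Ioi 0) (τ := 0) fun t ht => ⟨ht, fun s hs => hs.1⟩).congr
      fun p hp => hv p.1 hp.1 p.2
  refine ⟨b, hb0, fun t x => z t x + v t x, F, Z + 1, M, hM0, ⟨⟨?_, ?_⟩, hM.mono hsub, ?_⟩, ?_, ?_⟩
  · exact (hzc.add hvc).mono (prod_mono hsub subset_rfl)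
  · intro t ht x
    refine (norm_add_le _ _).trans (add_le_add (hzZ t x) ((hvM t ht.1 x).trans (le_trans ?_ hMb)))
    gcongr; exact ht.2.le
  · intro τ t hτ ht htb x
    have ht0 : 0 < t := hτ.trans ht
    have h1 := D_restart hM hτ ht (fun s hs => hs.1) x
    have h2 := z_sg hm hZ hτ.le ht.le x
    have e : v τ = D F 0 τ := funext fun x => hv τ hτ x
    have hzs : Continuous (z τ) := continuous_iff_continuousAt.2 fun y => (P_hasFDerivAt hτ hm hZ y).continuousAt
    have hvs : Continuous (v τ) := by
      rw [← continuousOn_univ]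
      exact hvc.comp (f := fun y : EN N => (τ, y)) (by fun_prop) fun y _ => ⟨hτ, mem_univ _⟩
    have h3 : P (t - τ) (fun x => z τ x + v τ x) x = P (t - τ) (z τ) x + P (t - τ) (v τ) x := by
      unfold P
      exact integral_add (int_shift hzs.stronglyMeasurable (M := Z) (fun y => hzZ τ y) x _)
        (int_shift hvs.stronglyMeasurable (M := M * τ) (fun y => hvM τ hτ y) x _)
    show z t x + v t x = P (t - τ) (fun x => z τ x + v τ x) x + D F τ t x
    rw [h3, hv t ht0 x, h1, e]
    show P t w₁ x + _ = _
    rw [h2]; ring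
  · intro t ht x
    have h1 : |v t x| ≤ 1 := (hvM t ht.1 x).trans (le_trans (by gcongr; exact ht.2.le) hMb)
    simp only [hF, hΦ, clamp_eq h1]
  · intro t ht x
    have : z t x + v t x - P t w₁ x = v t x := by simp [hz]
    rw [this]; exact hvM t ht.1 x

end
end HeatW

namespace HeatW

section
variable {N : ℕ} {α : ℝ}

lemma reg1 (hα : 0 < α) {U : ℝ → EN N → ℝ} {V : ℝ → EN N → EN N →L[ℝ] ℝ}
    (hUc : ContinuousOn (fun p : ℝ × EN N => U p.1 p.2) (Dom N))
    (hVc : ContinuousOn (fun p : ℝ × EN N => V p.1 p.2) (Dom N))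
    (hUd : ∀ t, 0 < t → ∀ x, HasFDerivAt (U t) (V t x) x)
    (hUb : ∀ τ, 0 < τ → ∃ C, ∀ t, τ ≤ t → ∀ x, |U t x| ≤ C ∧ ‖V t x‖ ≤ C)
    {b W M : ℝ} {w F : ℝ → EN N → ℝ} (h : IsMild 0 b w F W M)
    (hF : ∀ t ∈ Ioo 0 b, ∀ x, F t x = gN α (U t x + w t x) - gN α (U t x)) {a : ℝ} (ha : 0 < a) :
    ∃ F' W' M', IsMild a b (gr w) F' W' M' := by
  obtain ⟨W', hW'⟩ := h.gr_CB ha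
  obtain ⟨C, hC⟩ := hUb a ha
  have hsub : Ioo a b ⊆ Ioo 0 b := Ioo_subset_Ioo_left ha.le
  have hsub' : Ioo a b ×ˢ (univ : Set (EN N)) ⊆ Dom N := prod_mono (fun t ht => ha.trans ht.1) subset_rfl
  have hgc : Continuous fun s : ℝ => (α + 1) * |s| ^ α :=
    continuous_const.mul (continuous_abs.rpow_const fun _ => Or.inr hα.le)
  have hUc' := hUc.mono hsub'
  have hVc' := hVc.mono hsub'
  have hwc := (h.hw.mono hsub).cont
  refine ⟨fun t x => ((α + 1) * |U t x + w t x| ^ α) • (V t x + gr w t x) - ((α + 1) * |U t x| ^ α) • V t x,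
    W', ((α + 1) * (C + W) ^ α) * (C + W') + ((α + 1) * C ^ α) * C, h.grad ha hW' ⟨?_, ?_⟩ ?_⟩
  · refine ContinuousOn.sub ?_ ?_
    · exact ContinuousOn.smul (f := fun p : ℝ × EN N => (α + 1) * |U p.1 p.2 + w p.1 p.2| ^ α)
        (g := fun p => V p.1 p.2 + gr w p.1 p.2) (hgc.comp_continuousOn (hUc'.add hwc)) (hVc'.add hW'.cont)
    · exact ContinuousOn.smul (f := fun p : ℝ × EN N => (α + 1) * |U p.1 p.2| ^ α)
        (g := fun p => V p.1 p.2) (hgc.comp_continuousOn hUc') hVc'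
  · intro t ht x
    obtain ⟨h1, h2⟩ := hC t ht.1.le x
    have h3 := h.hw.bd t (hsub ht) x
    have h4 := hW'.bd t ht x
    have h0 : 0 ≤ C := (abs_nonneg _).trans h1
    have h5 : |U t x + w t x| ≤ C + W := (abs_add_le _ _).trans (add_le_add h1 h3)
    have h6 : ‖V t x + gr w t x‖ ≤ C + W' := (norm_add_le _ _).trans (add_le_add h2 h4)
    refine (norm_sub_le _ _).trans ?_
    rw [norm_smul, norm_smul, Real.norm_of_nonneg (by positivity), Real.norm_of_nonneg (by positivity)]
    have h7 : 0 ≤ C + W := (abs_nonneg _).trans h5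
    have h8 : 0 ≤ C + W' := (norm_nonneg _).trans h6
    gcongr
  · intro t ht x
    have e : F t = fun x => gN α (U t x + w t x) - gN α (U t x) := funext fun x => hF t (hsub ht) x
    rw [e]
    have hU1 := hUd t (ha.trans ht.1) x
    have hw1 := h.hasFDerivAt (hsub ht) x
    have h1 := (gN_deriv hα (U t x + w t x)).comp_hasFDerivAt x (hU1.add hw1)
    have h2 := (gN_deriv hα (U t x)).comp_hasFDerivAt x hU1
    exact h1.sub h2

lemma reg2 (hα : 0 < α) {U : ℝ → EN N → ℝ} {V : ℝ → EN N → EN N →L[ℝ] ℝ}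
    (hUc : ContinuousOn (fun p : ℝ × EN N => U p.1 p.2) (Dom N))
    (hVc : ContinuousOn (fun p : ℝ × EN N => V p.1 p.2) (Dom N))
    (hUd : ∀ t, 0 < t → ∀ x, HasFDerivAt (U t) (V t x) x)
    (hUb : ∀ τ, 0 < τ → ∃ C, ∀ t, τ ≤ t → ∀ x, |U t x| ≤ C ∧ ‖V t x‖ ≤ C)
    {b W M : ℝ} {w F : ℝ → EN N → ℝ} (h : IsMild 0 b w F W M)
    (hF : ∀ t ∈ Ioo 0 b, ∀ x, F t x = gN α (U t x + w t x) - gN α (U t x)) {a : ℝ} (ha : 0 < a) :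
    ∃ W1 W2, CB (Ioo a b) (gr w) W1 ∧ CB (Ioo a b) (gr (gr w)) W2 ∧
      (∀ t ∈ Ioo a b, ∀ x, HasFDerivAt (gr w t) (gr (gr w) t x) x) ∧
      (∀ t ∈ Ioo a b, ∀ x, HasDerivAt (fun s => w s x) (trL N (gr (gr w) t x) + F t x) t) := by
  obtain ⟨F', W', M', h'⟩ := reg1 hα hUc hVc hUd hUb h hF (half_pos ha)
  obtain ⟨W2, h2⟩ := h'.gr_CB (half_lt_self ha)
  have hsub : Ioo a b ⊆ Ioo (a/2) b := Ioo_subset_Ioo_left (half_lt_self ha).le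
  have hd : ∀ t ∈ Ioo a b, ∀ x, HasFDerivAt (gr w t) (gr (gr w) t x) x := fun t ht x =>
    h'.hasFDerivAt (hsub ht) x
  refine ⟨W', W2, h'.hw.mono hsub, h2, hd, fun t ht x => ?_⟩
  exact (h.mono ha.le le_rfl).hasDerivAt (h'.hw.mono hsub) h2 hd ht x

lemma lap_eq {u : EN N → ℝ} {u1 : EN N → EN N →L[ℝ] ℝ} {u2 : EN N → EN N →L[ℝ] EN N →L[ℝ] ℝ}
    (h1 : ∀ x, HasFDerivAt u (u1 x) x) (h2 : ∀ x, HasFDerivAt u1 (u2 x) x) (x : EN N) :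
    lap N u x = trL N (u2 x) := by
  have e : fderiv ℝ u = u1 := funext fun x => (h1 x).fderiv
  unfold lap
  rw [trL_apply]
  refine Finset.sum_congr rfl fun i _ => ?_
  rw [iteratedFDeriv_two_apply, e, (h2 x).fderiv]
  rfl

lemma contDiff2 {u : EN N → ℝ} {u1 : EN N → EN N →L[ℝ] ℝ} {u2 : EN N → EN N →L[ℝ] EN N →L[ℝ] ℝ}
    (h1 : ∀ x, HasFDerivAt u (u1 x) x) (h2 : ∀ x, HasFDerivAt u1 (u2 x) x) (hc : Continuous u2) :
    ContDiff ℝ 2 u := by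
  have e : fderiv ℝ u = u1 := funext fun x => (h1 x).fderiv
  have e2 : fderiv ℝ u1 = u2 := funext fun x => (h2 x).fderiv
  have : ContDiff ℝ (1 + 1) u := by
    rw [contDiff_succ_iff_fderiv]
    refine ⟨fun x => (h1 x).differentiableAt, by simp, ?_⟩
    rw [e, contDiff_one_iff_fderiv]
    exact ⟨fun x => (h2 x).differentiableAt, by rw [e2]; exact hc⟩
  simpa [one_add_one_eq_two] using this

lemma contDiffOn1 {f f' : ℝ → ℝ} {a b : ℝ} (h : ∀ t ∈ Ioo a b, HasDerivAt f (f' t) t)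
    (hc : ContinuousOn f' (Ioo a b)) : ContDiffOn ℝ 1 f (Ioo a b) := by
  have : ContDiffOn ℝ (0 + 1) f (Ioo a b) := by
    rw [contDiffOn_succ_iff_deriv_of_isOpen isOpen_Ioo]
    refine ⟨fun t ht => (h t ht).differentiableAt.differentiableWithinAt, by simp, ?_⟩
    rw [contDiffOn_zero]
    exact hc.congr fun t ht => (h t ht).deriv
  simpa using this

end
end HeatW

namespace HeatW

section
variable {N : ℕ}

lemma heat_eq {t : ℝ} (ht : 0 < t) {w₀ w₁ : EN N → ℝ} (h : w₀ =ᵐ[volume] w₁) (x : EN N) :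
    ∫ y, heatKernel N t x y * w₀ y = P t w₁ x := by
  have hs : 0 < √t := Real.sqrt_pos.2 ht
  have e1 : ∫ y, heatKernel N t x y * w₀ y = ∫ y, heatKernel N t x y * w₁ y := by
    refine integral_congr_ae ?_
    filter_upwards [h] with y hy
    rw [hy]
  unfold P
  rw [e1, integral_gm, ← integral_add_left_eq_self _ x]
  have e2 := Measure.integral_comp_smul (volume : Measure (EN N))
    (fun y => heatKernel N t x (x + y) * w₁ (x + y)) (√t)
  have hfr : Module.finrank ℝ (EN N) = N := by simp [EN]
  rw [hfr, abs_of_nonneg (by positivity), smul_eq_mul] at e2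
  have e3 : ∫ y, heatKernel N t x (x + y) * w₁ (x + y) =
      √t ^ N * ∫ y, heatKernel N t x (x + √t • y) * w₁ (x + √t • y) := by
    rw [e2]; field_simp
  rw [e3, ← integral_const_mul]
  refine integral_congr_ae (Eventually.of_forall fun z => ?_)
  simp only [smul_eq_mul]
  rw [← mul_assoc]
  congr 1
  unfold heatKernel gd
  have e4 : ‖x - (x + √t • z)‖ ^ 2 = t * ‖z‖ ^ 2 := by
    rw [sub_add_cancel_left, norm_neg, norm_smul, mul_pow, Real.norm_of_nonneg hs.le, Real.sq_sqrt ht.le]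
  rw [e4, Real.mul_rpow (by positivity) ht.le, ← mul_assoc]
  have e5 : -(t * ‖z‖ ^ 2) / (4 * t) = -‖z‖ ^ 2 / 4 := by field_simp
  rw [e5]
  congr 1
  have e6 : √t ^ N * t ^ (-(N:ℝ) / 2) = 1 := by
    rw [Real.sqrt_eq_rpow, ← Real.rpow_natCast, ← Real.rpow_mul ht.le, ← Real.rpow_add ht]
    have : 1 / 2 * (N:ℝ) + -(N:ℝ) / 2 = 0 := by ring
    rw [this, Real.rpow_zero]
  calc √t ^ N * ((4 * π) ^ (-(N:ℝ) / 2) * t ^ (-(N:ℝ) / 2)) = (4 * π) ^ (-(N:ℝ) / 2) * (√t ^ N * t ^ (-(N:ℝ) / 2)) := by ring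
    _ = _ := by rw [e6, mul_one]

lemma bdd_int {K : Set (EN N)} (hK : IsCompact K) {φ : EN N → ℝ} {C : ℝ} (hm : StronglyMeasurable φ)
    (hb : ∀ y, |φ y| ≤ C) : Integrable φ (volume.restrict K) := by
  have : IsFiniteMeasure (volume.restrict K) := ⟨by simpa using hK.measure_lt_top⟩
  exact (integrable_const C).mono' hm.aestronglyMeasurable (Eventually.of_forall hb)

lemma psi_tendsto {K : Set (EN N)} (hK : IsCompact K) {w₁ : EN N → ℝ} {Z : ℝ}
    (hm : StronglyMeasurable w₁) (hZ : ∀ y, ‖w₁ y‖ ≤ Z) :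
    Tendsto (fun h => ∫ x in K, |w₁ (x + h) - w₁ x|) (nhds 0) (nhds 0) := by
  obtain ⟨R, hR⟩ := hK.isBounded.subset_closedBall (0 : EN N)
  have hfin : IsFiniteMeasure (volume.restrict K) := ⟨by simpa using hK.measure_lt_top⟩
  set W : EN N → ℝ := indicator (Metric.closedBall 0 (R + 1)) w₁ with hW
  have hWi : Integrable W := by
    rw [hW, integrable_indicator_iff measurableSet_closedBall]
    exact bdd_int (isCompact_closedBall _ _) hm hZ
  set V := (volume K).toReal with hV
  have hV0 : 0 ≤ V := ENNReal.toReal_nonneg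
  rw [Metric.tendsto_nhds_nhds]
  intro ε₀ hε₀
  set ε := ε₀ / (V + 3) with hε
  have hεp : 0 < ε := by positivity
  obtain ⟨φ, hφs, hφ1, hφc, hφi⟩ := hWi.exists_hasCompactSupport_integral_sub_le hεp
  obtain ⟨η, hη, hη2⟩ := Metric.uniformContinuous_iff.1 (hφs.uniformContinuous_of_continuous hφc) ε hεp
  refine ⟨min η 1, by positivity, fun {h} hh => ?_⟩
  rw [dist_zero_right] at hh
  have hh1 : ‖h‖ < η := hh.trans_le (min_le_left _ _)
  have hh2 : ‖h‖ < 1 := hh.trans_le (min_le_right _ _)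
  have hDi : Integrable fun x => ‖W x - φ x‖ := (hWi.sub hφi).norm
  have hDh : Integrable fun x => ‖W (x + h) - φ (x + h)‖ := hDi.comp_add_right h
  have hle : ∫ x in K, |w₁ (x + h) - w₁ x| ≤ ∫ x in K, (‖W (x + h) - φ (x + h)‖ + ‖W x - φ x‖ + ε) := by
    refine integral_mono_of_nonneg (Eventually.of_forall fun x => abs_nonneg _)
      ((hDh.integrableOn.add hDi.integrableOn).add (integrable_const _)) ?_
    refine (ae_restrict_mem hK.measurableSet).mono fun x hx => ?_
    have hx' : ‖x‖ ≤ R := by simpa using hR hx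
    have w1 : W x = w₁ x := indicator_of_mem (by simp; linarith) _
    have w2 : W (x + h) = w₁ (x + h) := indicator_of_mem (by
      simp; linarith [norm_add_le x h]) _
    have h3 : |φ (x + h) - φ x| < ε := by
      have := hη2 (a := x + h) (b := x) (by simpa [dist_eq_norm] using hh1)
      rwa [Real.dist_eq] at this
    simp only
    rw [w1, w2, Real.norm_eq_abs, Real.norm_eq_abs]
    have := abs_sub_abs_le_abs_sub (w₁ (x+h)) (w₁ x)
    have e : w₁ (x + h) - w₁ x = (w₁ (x+h) - φ (x+h)) - (w₁ x - φ x) + (φ (x+h) - φ x) := by ring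
    rw [e]
    refine (abs_add_le _ _).trans (add_le_add (abs_sub _ _) h3.le)
  have heq : ∫ x in K, (‖W (x + h) - φ (x + h)‖ + ‖W x - φ x‖ + ε) =
      (∫ x in K, ‖W (x + h) - φ (x + h)‖) + (∫ x in K, ‖W x - φ x‖) + V * ε := by
    have hs : Integrable (fun x => ‖W (x + h) - φ (x + h)‖ + ‖W x - φ x‖) (volume.restrict K) :=
      hDh.integrableOn.add hDi.integrableOn
    rw [integral_add hs (integrable_const _),
      integral_add hDh.integrableOn hDi.integrableOn]
    simp [hV, Measure.real]
  have h1 : ∫ x in K, ‖W x - φ x‖ ≤ ε :=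
    (setIntegral_le_integral hDi (Eventually.of_forall fun x => norm_nonneg _)).trans hφ1
  have h2 : ∫ x in K, ‖W (x + h) - φ (x + h)‖ ≤ ε := by
    refine (setIntegral_le_integral hDh (Eventually.of_forall fun x => norm_nonneg _)).trans ?_
    rw [integral_add_right_eq_self (fun x => ‖W x - φ x‖) h]
    exact hφ1
  rw [Real.dist_eq, sub_zero, abs_of_nonneg (integral_nonneg fun x => abs_nonneg _)]
  have : ε * (V + 3) = ε₀ := by rw [hε]; field_simp
  nlinarith

lemma P_L1 {K : Set (EN N)} (hK : IsCompact K) {w₁ : EN N → ℝ} {Z : ℝ}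
    (hm : StronglyMeasurable w₁) (hZ : ∀ y, ‖w₁ y‖ ≤ Z) :
    Tendsto (fun t => ∫ x in K, |P t w₁ x - w₁ x|) (nhdsWithin 0 (Ioi 0)) (nhds 0) := by
  have hfin : IsFiniteMeasure (volume.restrict K) := ⟨by simpa using hK.measure_lt_top⟩
  have hZ0 : 0 ≤ Z := (norm_nonneg _).trans (hZ 0)
  have hmw : Measurable w₁ := hm.measurable
  have hb : ∀ a b, |w₁ a - w₁ b| ≤ 2 * Z := fun a b => (abs_sub _ _).trans (by
    have := hZ a; have := hZ b; rw [Real.norm_eq_abs] at *; linarith)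
  set ψ : EN N → ℝ := fun h => ∫ x in K, |w₁ (x + h) - w₁ x| with hψ
  have hψm : StronglyMeasurable ψ := by
    refine StronglyMeasurable.integral_prod_right (f := fun h x => |w₁ (x + h) - w₁ x|) ?_
    apply Measurable.stronglyMeasurable
    unfold Function.uncurry
    fun_prop
  have hψb : ∀ h, ‖ψ h‖ ≤ 2 * Z * (volume.restrict K).real univ := fun h =>
    norm_integral_le_of_norm_le_const (Eventually.of_forall fun x => by
      rw [Real.norm_eq_abs, abs_abs]; exact hb _ _)
  have h1 : Tendsto (fun t : ℝ => ∫ z, ψ (√t • z) ∂(gm N)) (nhdsWithin 0 (Ioi 0)) (nhds (∫ z, (0:ℝ) ∂(gm N))) := by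
    refine tendsto_integral_filter_of_dominated_convergence (fun _ => 2 * Z * (volume.restrict K).real univ) ?_ ?_
      (integrable_const _) ?_
    · exact Eventually.of_forall fun t => (hψm.comp_measurable (by fun_prop)).aestronglyMeasurable
    · exact Eventually.of_forall fun t => Eventually.of_forall fun z => hψb _
    · refine Eventually.of_forall fun z => ?_
      refine (psi_tendsto hK hm hZ).comp ?_
      have : Continuous fun t : ℝ => √t • z := by fun_prop
      have := (this.tendsto 0).mono_left (nhdsWithin_le_nhds (s := Ioi 0))
      simpa using this
  simp only [integral_zero] at h1
  refine squeeze_zero (fun t => integral_nonneg fun x => abs_nonneg _) (fun t => ?_) h1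
  have hmeas : Measurable (Function.uncurry fun (x z : EN N) => |w₁ (x + √t • z) - w₁ x|) := by
    unfold Function.uncurry
    fun_prop
  have hIntg : Integrable (Function.uncurry fun (x z : EN N) => |w₁ (x + √t • z) - w₁ x|)
      ((volume.restrict K).prod (gm N)) :=
    (integrable_const (2 * Z)).mono' hmeas.aestronglyMeasurable (Eventually.of_forall fun p => by
      simp only [Function.uncurry, Real.norm_eq_abs, abs_abs]; exact hb _ _)
  calc ∫ x in K, |P t w₁ x - w₁ x| ≤ ∫ x in K, ∫ z, |w₁ (x + √t • z) - w₁ x| ∂(gm N) := by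
        refine integral_mono_of_nonneg (Eventually.of_forall fun x => abs_nonneg _) hIntg.integral_prod_left
          (Eventually.of_forall fun x => ?_)
        simp only
        have e : P t w₁ x - w₁ x = ∫ z, (w₁ (x + √t • z) - w₁ x) ∂(gm N) := by
          rw [integral_sub (int_shift hm hZ x _) (integrable_const _)]
          simp [P]
        rw [e]
        exact norm_integral_le_integral_norm (fun z => w₁ (x + √t • z) - w₁ x)
    _ = _ := integral_integral_swap hIntg

end
end HeatW

namespace HeatW

section
variable {N : ℕ} {α : ℝ}

/-- The regular part of the initial value. -/
noncomputable def w1f (α μ : ℝ) (u₀ : EN N → ℝ) : EN N → ℝ :=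
  indicator {0}ᶜ fun y => u₀ y - μ * ‖y‖ ^ (-(2 / α))

lemma w1f_meas {μ : ℝ} {u₀ : EN N → ℝ} (h : Measurable u₀) : StronglyMeasurable (w1f α μ u₀) := by
  apply Measurable.stronglyMeasurable
  unfold w1f
  refine Measurable.indicator (by fun_prop) (measurableSet_singleton _).compl

lemma w1f_zero {μ δ : ℝ} {u₀ : EN N → ℝ} (hu₀eq : ∀ x : EN N, 0 < ‖x‖ → ‖x‖ < δ →
      u₀ x = μ * ‖x‖ ^ (-(2 / α))) (y : EN N) (hy : ‖y‖ < δ) : w1f α μ u₀ y = 0 := by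
  unfold w1f
  by_cases h : y = 0
  · simp [h]
  · rw [indicator_of_mem (by simpa using h), hu₀eq y (norm_pos_iff.2 h) hy, sub_self]

lemma w1f_bdd (hα : 0 < α) {μ δ : ℝ} (hδ : 0 < δ) {u₀ : EN N → ℝ}
    (hu₀loc : ∀ K : Set (EN N), IsCompact K → (0 : EN N) ∉ K → ∃ C, ∀ x ∈ K, |u₀ x| ≤ C)
    (hu₀out : ∃ C, ∀ x : EN N, 1 < ‖x‖ → |u₀ x| ≤ C)
    (hu₀eq : ∀ x : EN N, 0 < ‖x‖ → ‖x‖ < δ → u₀ x = μ * ‖x‖ ^ (-(2 / α))) :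
    ∃ Z, 0 ≤ Z ∧ ∀ y, ‖w1f α μ u₀ y‖ ≤ Z := by
  obtain ⟨C1, h1⟩ := hu₀out
  obtain ⟨C2, h2⟩ := hu₀loc (Metric.closedBall 0 1 \ Metric.ball 0 δ)
    ((isCompact_closedBall _ _).diff Metric.isOpen_ball) (by simp [hδ])
  refine ⟨|C1| + |C2| + |μ| * δ ^ (-(2 / α)), by positivity, fun y => ?_⟩
  rcases lt_or_ge ‖y‖ δ with h | h
  · rw [w1f_zero hu₀eq y h, norm_zero]; positivity
  · have hy : y ≠ 0 := by
      intro h0; rw [h0, norm_zero] at h; linarith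
    unfold w1f
    rw [indicator_of_mem (by simpa using hy)]
    have h3 : |u₀ y| ≤ |C1| + |C2| := by
      rcases lt_or_ge 1 ‖y‖ with h4 | h4
      · linarith [h1 y h4, le_abs_self C1, abs_nonneg C2]
      · have := h2 y ⟨by simpa using h4, by simpa using h⟩
        linarith [le_abs_self C2, abs_nonneg C1]
    refine (abs_sub _ _).trans (add_le_add h3 ?_)
    rw [abs_mul, abs_of_nonneg (by positivity : 0 ≤ ‖y‖ ^ (-(2/α)))]
    have : ‖y‖ ^ (-(2/α)) ≤ δ ^ (-(2/α)) := Real.rpow_le_rpow_of_nonpos hδ h (by simp; positivity)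
    gcongr

lemma w1f_ae (hN : 1 ≤ N) {μ : ℝ} {u₀ : EN N → ℝ} :
    (fun y => u₀ y - μ * ‖y‖ ^ (-(2 / α))) =ᵐ[volume] w1f α μ u₀ := by
  have : Nontrivial (EN N) := by
    have : Nonempty (Fin N) := ⟨⟨0, hN⟩⟩
    infer_instance
  have h : ∀ᵐ y : EN N, y ≠ 0 := by
    rw [ae_iff]; simp
  filter_upwards [h] with y hy
  unfold w1f
  rw [indicator_of_mem (by simpa using hy)]

/-- Convergence in `L^p` on compact sets. -/
lemma conv_d (hα : 0 < α) {μ M Z b : ℝ} (hM : 0 ≤ M) (hb : 0 < b) {f : ℝ → ℝ}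
    (hflim : Tendsto (fun r : ℝ => r ^ (2 / α) * f r) atTop (nhds μ)) {u₀ : EN N → ℝ}
    (hm : Measurable u₀) (hZ : ∀ y, ‖w1f α μ u₀ y‖ ≤ Z) {w : ℝ → EN N → ℝ}
    (hw : ∀ t ∈ Ioo 0 b, ∀ x, |w t x - P t (w1f α μ u₀) x| ≤ M * t)
    {K : Set (EN N)} (hK : IsCompact K) (hK0 : (0 : EN N) ∉ K) {p : ℝ} (hp : 1 ≤ p) :
    Tendsto (fun t : ℝ => ∫ x in K, |ssol α f t x + w t x - u₀ x| ^ p)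
          (nhdsWithin 0 (Ioi 0)) (nhds 0) := by
  have hfin : IsFiniteMeasure (volume.restrict K) := ⟨by simpa using hK.measure_lt_top⟩
  have hZ0 : 0 ≤ Z := (norm_nonneg _).trans (hZ 0)
  have hmw := w1f_meas (α := α) (μ := μ) hm
  obtain ⟨ε, hε, hKε⟩ : ∃ ε > 0, ∀ x ∈ K, ε ≤ ‖x‖ := by
    obtain ⟨ε, hε, h⟩ := Metric.isOpen_iff.1 hK.isClosed.isOpen_compl 0 hK0
    refine ⟨ε, hε, fun x hx => ?_⟩
    by_contra hc
    exact h (by simpa using hc) hx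
  set V := (volume.restrict K).real univ with hV
  have hV0 : 0 ≤ V := measureReal_nonneg
  set A : ℝ := (1 + M * b + 2 * Z) ^ (p - 1) with hA
  have hA0 : 0 < A := by positivity
  rw [Metric.tendsto_nhds]
  intro ε₀ hε₀
  set η : ℝ := min 1 (ε₀ / (A * (2 * V + 1) + 1)) with hη
  have hη0 : 0 < η := by positivity
  have hη1 : η ≤ 1 := min_le_left _ _
  have hη2 : A * (2 * V + 1) * η < ε₀ := by
    have h1 : η ≤ ε₀ / (A * (2 * V + 1) + 1) := min_le_right _ _
    rw [le_div_iff₀ (by positivity)] at h1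
    nlinarith
  obtain ⟨t₀, ht₀, hU⟩ := U_unif (N := N) hα hflim hε hη0
  have hL := (Metric.tendsto_nhds.1 (P_L1 hK hmw hZ)) η hη0
  have hpos : ∀ᶠ t : ℝ in nhdsWithin 0 (Ioi 0), 0 < t := self_mem_nhdsWithin
  have hlt : ∀ c : ℝ, 0 < c → ∀ᶠ t : ℝ in nhdsWithin 0 (Ioi 0), t < c := fun c hc =>
    nhdsWithin_le_nhds (Iio_mem_nhds hc)
  filter_upwards [hL, hpos, hlt t₀ ht₀, hlt b hb, hlt (η / (M + 1)) (by positivity)] with t h1 h2 h3 h4 h5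
  have hMt : M * t ≤ η := by
    rw [lt_div_iff₀ (by positivity)] at h5; nlinarith
  rw [Real.dist_eq, sub_zero, abs_of_nonneg (integral_nonneg fun x => abs_nonneg _)] at h1
  rw [Real.dist_eq, sub_zero, abs_of_nonneg (integral_nonneg fun x => by positivity)]
  have hPc : Continuous (P t (w1f α μ u₀)) :=
    continuous_iff_continuousAt.2 fun y => (P_hasFDerivAt h2 hmw hZ y).continuousAt
  have hi : Integrable (fun x => |P t (w1f α μ u₀) x - w1f α μ u₀ x|) (volume.restrict K) := by
    refine bdd_int hK (C := 2 * Z) ?_ fun y => ?_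
    · exact ((hPc.stronglyMeasurable.sub hmw).norm)
    · rw [abs_abs]
      refine (abs_sub _ _).trans ?_
      have e1 : |P t (w1f α μ u₀) y| ≤ Z := P_norm_le hZ y
      have e2 : |w1f α μ u₀ y| ≤ Z := hZ y
      linarith
  refine lt_of_le_of_lt (b := ∫ x in K, A * (2 * η + |P t (w1f α μ u₀) x - w1f α μ u₀ x|)) ?_ ?_
  · refine integral_mono_of_nonneg (Eventually.of_forall fun x => by positivity)
      (((integrable_const _).add hi).const_mul A) ?_
    refine (ae_restrict_mem hK.measurableSet).mono fun x hx => ?_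
    simp only
    have hx0 : x ≠ 0 := fun h => hK0 (h ▸ hx)
    have e : ssol α f t x + w t x - u₀ x = (ssol α f t x - μ * ‖x‖ ^ (-(2/α))) +
        (w t x - P t (w1f α μ u₀) x) + (P t (w1f α μ u₀) x - w1f α μ u₀ x) := by
      have : w1f α μ u₀ x = u₀ x - μ * ‖x‖ ^ (-(2 / α)) := by
        unfold w1f; rw [indicator_of_mem (by simpa using hx0)]
      rw [this]; ring
    have a1 := hU t h2 h3 x (hKε x hx)
    have a2 := hw t ⟨h2, h4⟩ x
    have a3 : |ssol α f t x + w t x - u₀ x| ≤ 2 * η + |P t (w1f α μ u₀) x - w1f α μ u₀ x| := by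
      rw [e]
      refine (abs_add_three _ _ _).trans ?_
      linarith
    have a4 : |P t (w1f α μ u₀) x - w1f α μ u₀ x| ≤ 2 * Z := by
      refine (abs_sub _ _).trans ?_
      have e1 : |P t (w1f α μ u₀) x| ≤ Z := P_norm_le hZ x
      have e2 : |w1f α μ u₀ x| ≤ Z := hZ x
      linarith
    have a5 : |ssol α f t x + w t x - u₀ x| ≤ 1 + M * b + 2 * Z := by
      rw [e]
      refine (abs_add_three _ _ _).trans ?_
      have : M * t ≤ M * b := by gcongr
      linarith
    rcases (abs_nonneg (ssol α f t x + w t x - u₀ x)).eq_or_lt with h0 | h0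
    · rw [← h0, Real.zero_rpow (by linarith)]; positivity
    · have : |ssol α f t x + w t x - u₀ x| ^ p = |ssol α f t x + w t x - u₀ x| ^ (p - 1) *
          |ssol α f t x + w t x - u₀ x| := by
        rw [← Real.rpow_add_one h0.ne', sub_add_cancel]
      rw [this]
      have a6 : |ssol α f t x + w t x - u₀ x| ^ (p - 1) ≤ A :=
        Real.rpow_le_rpow (abs_nonneg _) a5 (by linarith)
      gcongr
  · rw [integral_const_mul, integral_add (integrable_const _) hi]
    have : ∫ x in K, 2 * η = V * (2 * η) := by simp [hV]
    rw [this]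
    calc A * (V * (2 * η) + ∫ x in K, |P t (w1f α μ u₀) x - w1f α μ u₀ x|)
        ≤ A * (V * (2 * η) + η) := by gcongr
      _ = A * (2 * V + 1) * η := by ring
      _ < ε₀ := hη2

end
end HeatW

/-- Theorem 5.1: perturbation of a self-similar solution on `ℝ^N`. -/
theorem stmt8 (N : ℕ) (hN : 1 ≤ N) (α μ δ C₀ : ℝ)
    (hα : 0 < α) (hδ : 0 < δ) (hC₀ : 0 < C₀)
    (f : ℝ → ℝ) (hf : ContDiffOn ℝ 2 f (Ici 0))
    (hODE : ∀ r > (0 : ℝ),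
      derivWithin (derivWithin f (Ici 0)) (Ici 0) r +
        (((N : ℝ) - 1) / r + r / 2) * derivWithin f (Ici 0) r +
        f r / α + |f r| ^ α * f r = 0)
    (hf'0 : derivWithin f (Ici 0) 0 = 0)
    (hdecay : ∀ r ≥ (0 : ℝ),
      |f r| + (1 + r) * |derivWithin f (Ici 0) r| ≤ C₀ * (1 + r ^ 2) ^ (-(1 / α)))
    (hflim : Tendsto (fun r : ℝ => r ^ (2 / α) * f r) atTop (nhds μ))
    (hUinit : ∀ ε > (0 : ℝ), ∀ p : ℝ, 1 ≤ p →
      Tendsto (fun t : ℝ => ∫ x in {x : EuclideanSpace ℝ (Fin N) | ε < ‖x‖},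
          |ssol α f t x - μ * ‖x‖ ^ (-(2 / α))| ^ p)
        (nhdsWithin 0 (Ioi 0)) (nhds 0))
    (u₀ : EuclideanSpace ℝ (Fin N) → ℝ) (hu₀m : Measurable u₀)
    (hu₀loc : ∀ K : Set (EuclideanSpace ℝ (Fin N)), IsCompact K → (0 : EuclideanSpace ℝ (Fin N)) ∉ K →
      ∃ C, ∀ x ∈ K, |u₀ x| ≤ C)
    (hu₀out : ∃ C, ∀ x : EuclideanSpace ℝ (Fin N), 1 < ‖x‖ → |u₀ x| ≤ C)
    (hu₀eq : ∀ x : EuclideanSpace ℝ (Fin N), 0 < ‖x‖ → ‖x‖ < δ →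
      u₀ x = μ * ‖x‖ ^ (-(2 / α))) :
    ∃ T > (0 : ℝ), ∃ u : ℝ → EuclideanSpace ℝ (Fin N) → ℝ, ∃ C : ℝ,
      -- `u ∈ C((0,T], C_{b,u}(ℝ^N))`
      (∀ t ∈ Ioc 0 T, UniformContinuous (u t) ∧ ∃ b, ∀ x, |u t x| ≤ b) ∧
      (∀ t ∈ Ioc 0 T, ∀ ε > (0 : ℝ), ∃ η > (0 : ℝ), ∀ s ∈ Ioc 0 T, |s - t| < η →
        ∀ x, |u s x - u t x| ≤ ε) ∧
      -- (a) `u` is `C¹` in `t`, `C²` in `x`, and `∂_t u = Δu + |u|^α u` on `(0,T) × ℝ^N`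
      (∀ t ∈ Ioo 0 T, ContDiff ℝ 2 (u t)) ∧
      (∀ x, ContDiffOn ℝ 1 (fun s => u s x) (Ioo 0 T)) ∧
      (∀ t ∈ Ioo 0 T, ∀ x, HasDerivAt (fun s => u s x)
        (lap N (u t) x + |u t x| ^ α * u t x) t) ∧
      -- (b) `u − U ∈ L^∞((0,T) × ℝ^N)`
      (∃ Cb, ∀ t ∈ Ioo 0 T, ∀ x, |u t x - ssol α f t x| ≤ Cb) ∧
      -- (c) `‖u(t,·) − U(t,·) − e^{tΔ}(u₀ − μ|·|^{-2/α})‖_{L^∞} ≤ Ct` for `0 < t < T`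
      (∀ t ∈ Ioo 0 T, ∀ x,
        abs (u t x - ssol α f t x -
          ∫ y, heatKernel N t x y * (u₀ y - μ * ‖y‖ ^ (-(2 / α)))) ≤ C * t) ∧
      -- (d) `u(t,·) → u₀` in `L^p(K)` for every compact `K ⊂ ℝ^N \ {0}` and `1 ≤ p < ∞`
      (∀ K : Set (EuclideanSpace ℝ (Fin N)), IsCompact K →
        (0 : EuclideanSpace ℝ (Fin N)) ∉ K → ∀ p : ℝ, 1 ≤ p →
        Tendsto (fun t : ℝ => ∫ x in K, |u t x - u₀ x| ^ p)
          (nhdsWithin 0 (Ioi 0)) (nhds 0)) := by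
  classical
  have hp := HeatW.mk_prof hf hf'0
  set f1 := derivWithin f (Ici 0) with hf1
  set f2 := derivWithin f1 (Ici 0) with hf2
  have hα' : 0 < 1 / α := by positivity
  obtain ⟨Z, hZ0, hZ⟩ := HeatW.w1f_bdd hα hδ hu₀loc hu₀out hu₀eq
  have hmw := HeatW.w1f_meas (α := α) (μ := μ) hu₀m
  have hUα : ∀ t, 0 < t → ∀ x : HeatW.EN N, |ssol α f t x| ^ α ≤ C₀ ^ α / (t + ‖x‖ ^ 2) := fun t ht x => by
    have h1 := HeatW.U_bound hα hdecay ht x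
    have h2 : 0 < t + ‖x‖ ^ 2 := by positivity
    calc |ssol α f t x| ^ α ≤ (C₀ * (t + ‖x‖ ^ 2) ^ (-(1/α))) ^ α := by gcongr
      _ = C₀ ^ α * (t + ‖x‖ ^ 2) ^ (-(1/α) * α) := by
          rw [Real.mul_rpow hC₀.le (by positivity), ← Real.rpow_mul h2.le]
      _ = _ := by
          have : -(1/α) * α = -1 := by field_simp
          rw [this, Real.rpow_neg_one, div_eq_mul_inv]
  have hUc := hp.U_cont (N := N) (α := α)
  have hVc := hp.U1_cont (N := N) (α := α)
  have hUb : ∀ τ, 0 < τ → ∃ C, ∀ t, τ ≤ t → ∀ x : HeatW.EN N, |ssol α f t x| ≤ C ∧ ‖HeatW.U1 α f1 f2 t x‖ ≤ C :=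
    fun τ hτ => by
      refine ⟨max (C₀ * τ ^ (-(1/α))) (τ ^ (-(1/α)) * (√τ)⁻¹ * C₀), fun t ht x => ⟨le_trans ?_ (le_max_left _ _),
        (hp.U1_bound hα hC₀ hdecay hτ ht x).trans (le_max_right _ _)⟩⟩
      refine (HeatW.U_bound hα hdecay (hτ.trans_le ht) x).trans ?_
      have : (t + ‖x‖ ^ 2) ^ (-(1/α)) ≤ τ ^ (-(1/α)) :=
        Real.rpow_le_rpow_of_nonpos hτ (by nlinarith [sq_nonneg ‖x‖]) (by linarith)
      gcongr
  obtain ⟨b, hb, w, F, W, M, hM, hw, hF, hwM⟩ := HeatW.exists_w (N := N) (α := α) hα (U := fun t x => ssol α f t x)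
    (CU := C₀ ^ α) (by positivity) hUc hUα hZ0 hδ hmw hZ (HeatW.w1f_zero hu₀eq)
  have hreg := fun (a : ℝ) (ha : 0 < a) => HeatW.reg2 (N := N) hα (U := fun t x => ssol α f t x)
    (V := HeatW.U1 α f1 f2) hUc hVc (fun t _ x => hp.U_d1 t x) hUb hw hF (a := a) ha
  have hIoo : ∀ t ∈ Ioo 0 b, t ∈ Ioo (t/2) b := fun t ht => ⟨by linarith [ht.1], ht.2⟩
  have hd1 : ∀ t ∈ Ioo 0 b, ∀ x, HasFDerivAt (fun x => ssol α f t x + w t x)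
      (HeatW.U1 α f1 f2 t x + HeatW.gr w t x) x := fun t ht x =>
    (hp.U_d1 t x).add (hw.hasFDerivAt ht x)
  have hd2 : ∀ t ∈ Ioo 0 b, ∀ x, HasFDerivAt (fun x => HeatW.U1 α f1 f2 t x + HeatW.gr w t x)
      (HeatW.U2 α f1 f2 t x + HeatW.gr (HeatW.gr w) t x) x := fun t ht x => by
    obtain ⟨W1, W2, -, -, h3, -⟩ := hreg (t/2) (by linarith [ht.1])
    exact (hp.U_d2 t x).add (h3 t (hIoo t ht) x)
  have hg2c : ContinuousOn (fun p : ℝ × HeatW.EN N => HeatW.gr (HeatW.gr w) p.1 p.2) (Ioo 0 b ×ˢ univ) := by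
    rintro ⟨t, x⟩ ⟨ht, -⟩
    have ht : t ∈ Ioo 0 b := ht
    obtain ⟨W1, W2, -, h2, -, -⟩ := hreg (t/2) (by linarith [ht.1])
    exact (h2.cont.continuousAt ((isOpen_Ioo.prod isOpen_univ).mem_nhds ⟨hIoo t ht, mem_univ _⟩)).continuousWithinAt
  have hdt : ∀ t ∈ Ioo 0 b, ∀ x, HasDerivAt (fun s => ssol α f s x + w s x)
      ((HeatW.trL N (HeatW.U2 α f1 f2 t x) + |ssol α f t x| ^ α * ssol α f t x) +
        (HeatW.trL N (HeatW.gr (HeatW.gr w) t x) + F t x)) t := fun t ht x => by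
    obtain ⟨W1, W2, -, -, -, h4⟩ := hreg (t/2) (by linarith [ht.1])
    have h5 := hp.U_t (α := α) ht.1 x
    rw [hp.U_pde hN hα hODE ht.1 x] at h5
    exact h5.add (h4 t (hIoo t ht) x)
  have hdtb : ∀ a, 0 < a → ∃ L, 0 ≤ L ∧ ∀ t ∈ Ioo a b, ∀ x,
      |(HeatW.trL N (HeatW.U2 α f1 f2 t x) + |ssol α f t x| ^ α * ssol α f t x) +
        (HeatW.trL N (HeatW.gr (HeatW.gr w) t x) + F t x)| ≤ L := fun a ha => by
    obtain ⟨W1, W2, -, h2, -, -⟩ := hreg a ha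
    refine ⟨|a ^ (-(1/α)) * a⁻¹ * (C₀ / α + 1 / 2 * C₀)| + (‖HeatW.trL N‖ * |W2| + M), by positivity, fun t ht x => ?_⟩
    have ht0 : 0 < t := ha.trans ht.1
    refine (abs_add_le _ _).trans (add_le_add ?_ ((abs_add_le _ _).trans (add_le_add ?_ ?_)))
    · rw [← hp.U_pde hN hα hODE ht0 x]
      exact (hp.Ut_bound hα hC₀ hdecay ha ht.1.le x).trans (le_abs_self _)
    · refine ((HeatW.trL N).le_opNorm _).trans ?_
      have := (h2.bd t ht x).trans (le_abs_self W2)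
      gcongr
    · exact hw.hF.bd t ⟨ht0, ht.2⟩ x
  have hbT : b / 2 < b := half_lt_self hb
  have hsubc : Ioc 0 (b/2) ⊆ Ioo 0 b := fun t ht => ⟨ht.1, ht.2.trans_lt hbT⟩
  have hsubo : Ioo 0 (b/2) ⊆ Ioo 0 b := fun t ht => ⟨ht.1, ht.2.trans hbT⟩
  refine ⟨b / 2, half_pos hb, fun t x => ssol α f t x + w t x, M, ?_, ?_, ?_, ?_, ?_, ?_, ?_, ?_⟩
  · intro t ht'
    have ht := hsubc ht'
    obtain ⟨C, hC⟩ := hUb t ht.1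
    obtain ⟨W1, W2, h1, -, -, -⟩ := hreg (t/2) (by linarith [ht.1])
    refine ⟨?_, C + W, fun x => (abs_add_le _ _).trans (add_le_add (hC t le_rfl x).1 (hw.hw.bd t ht x))⟩
    have hL : LipschitzWith (Real.toNNReal (C + W1)) (fun x => ssol α f t x + w t x) := by
      refine LipschitzWith.of_dist_le_mul fun x y => ?_
      have hb1 : ∀ x, ‖HeatW.U1 α f1 f2 t x + HeatW.gr w t x‖ ≤ C + W1 := fun x =>
        (norm_add_le _ _).trans (add_le_add (hC t le_rfl x).2 (h1.bd t (hIoo t ht) x))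
      have := convex_univ.norm_image_sub_le_of_norm_hasFDerivWithin_le (𝕜 := ℝ)
        (fun x _ => (hd1 t ht x).hasFDerivWithinAt) (fun x _ => hb1 x) (mem_univ y) (mem_univ x)
      rw [Real.coe_toNNReal _ ((norm_nonneg _).trans (hb1 0)), dist_eq_norm, dist_eq_norm]
      exact this
    exact hL.uniformContinuous
  · intro t ht' ε hε
    have ht := hsubc ht'
    obtain ⟨L, hL0, hL⟩ := hdtb (t/2) (by linarith [ht.1])
    refine ⟨min (t/2) (ε / (L + 1)), lt_min (by linarith [ht.1]) (by positivity), fun s hs' hst x => ?_⟩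
    have hs := hsubc hs'
    have h1 : |s - t| < t / 2 := hst.trans_le (min_le_left _ _)
    have h2 : |s - t| < ε / (L + 1) := hst.trans_le (min_le_right _ _)
    have hs2 : s ∈ Ioo (t/2) b := ⟨by have := (abs_lt.1 h1).1; linarith, hs.2⟩
    have := (convex_Ioo (t/2) b).norm_image_sub_le_of_norm_hasDerivWithin_le
      (f := fun s => ssol α f s x + w s x) (fun r hr => (hdt r ⟨lt_trans (by linarith [ht.1]) hr.1, hr.2⟩ x).hasDerivWithinAt)
      (fun r hr => hL r hr x) (hIoo t ht) hs2
    rw [lt_div_iff₀ (by positivity)] at h2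
    refine this.trans ?_
    rw [Real.norm_eq_abs]
    nlinarith [abs_nonneg (s - t)]
  · intro t ht'
    have ht := hsubo ht'
    refine HeatW.contDiff2 (hd1 t ht) (hd2 t ht) ?_
    rw [← continuousOn_univ]
    refine ContinuousOn.add ?_ ?_
    · exact (hp.U2_cont (N := N) (α := α)).comp (f := fun y : HeatW.EN N => (t, y)) (by fun_prop)
        fun y _ => ⟨ht.1, mem_univ _⟩
    · exact hg2c.comp (f := fun y : HeatW.EN N => (t, y)) (by fun_prop) fun y _ => ⟨ht, mem_univ _⟩
  · intro x
    refine HeatW.contDiffOn1 (fun t ht => hdt t (hsubo ht) x) ?_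
    have hcx : ContinuousOn (fun t : ℝ => (t, x)) (Ioo 0 (b/2)) := by fun_prop
    have c1 := hUc.comp hcx (fun t ht => ⟨ht.1, mem_univ _⟩)
    have c2 := (hp.U2_cont (N := N) (α := α)).comp hcx (fun t ht => ⟨ht.1, mem_univ _⟩)
    have c3 := hg2c.comp hcx (fun t ht => ⟨hsubo ht, mem_univ _⟩)
    have c4 := hw.hF.cont.comp hcx (fun t ht => ⟨hsubo ht, mem_univ _⟩)
    exact (((HeatW.trL N).continuous.comp_continuousOn c2).add ((HeatW.gN_cont hα).comp_continuousOn c1)).add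
      (((HeatW.trL N).continuous.comp_continuousOn c3).add c4)
  · intro t ht' x
    have ht := hsubo ht'
    refine (hdt t ht x).congr_deriv ?_
    have e := HeatW.lap_eq (hd1 t ht) (hd2 t ht) x
    rw [e, hF t ht x, map_add]
    unfold HeatW.gN
    ring
  · refine ⟨W, fun t ht x => ?_⟩
    have e : ssol α f t x + w t x - ssol α f t x = w t x := by ring
    simp only [e]
    exact hw.hw.bd t (hsubo ht) x
  · intro t ht x
    have e0 := HeatW.heat_eq ht.1 (HeatW.w1f_ae (α := α) (μ := μ) (u₀ := u₀) hN) x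
    have e : ssol α f t x + w t x - ssol α f t x = w t x := by ring
    simp only [e]
    rw [e0]
    exact hwM t (hsubo ht) x
  · intro K hK hK0 p hp'
    exact HeatW.conv_d hα hM hb hflim hu₀m hZ hwM hK hK0 hp'
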